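/- Let n ≥ 2 and let Ω ⊂ ℝⁿ be a bounded domain with C² boundary, and let Q(u) = Σ_{i,j=1}^n a^{ij}(x,u,Du) D_{ij}u + b(x,u,Du) be an elliptic quasilinear operator with a^{ij}, b ∈ C¹(Ω̄ × ℝ × ℝⁿ). Let T ⊂ ∂Ω be a nonempty relatively open C² portion of the boundary and let Ω₀ ⊂ Ω be a subdomain with C² boundary such that Ω̄₀ ∩ ∂Ω ⊂ T. Let φ ∈ C²(Ω ∪ T) and let u ∈ C⁰(Ω ∪ T) ∩ C²(Ω) satisfy Q(u) = 0 in Ω and u = φ on T. Assume there exists K > 0 such that |u| + |Du| ≤ K on Ω. Then there exist a constant C > 0 and an exponent τ ∈ (0,1) such that u ∈ C¹(Ω̄₀) and |Du(x₁) − Du(x₂)| ≤ C |x₁ − x₂|^τ for all x₁, x₂ ∈ Ω̄₀; in particular u ∈ C^{1,τ}(Ω̄₀). -/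

import Mathlib

open Set Topology

/-- The gradient of `u : ℝⁿ → ℝ`, as a point of `ℝⁿ`. -/
noncomputable def gradE {n : ℕ} (u : EuclideanSpace ℝ (Fin n) → ℝ)
    (x : EuclideanSpace ℝ (Fin n)) : EuclideanSpace ℝ (Fin n) :=
  (EuclideanSpace.equiv (Fin n) ℝ).symm fun i => fderiv ℝ u x (EuclideanSpace.single i 1)

/-- The second partial derivative `D_{ij} u`. -/
noncomputable def sdE {n : ℕ} (u : EuclideanSpace ℝ (Fin n) → ℝ)
    (x : EuclideanSpace ℝ (Fin n)) (i j : Fin n) : ℝ :=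
  fderiv ℝ (fun y => fderiv ℝ u y (EuclideanSpace.single j 1)) x (EuclideanSpace.single i 1)

/-- `Ω` has a `C^k` boundary near the point `p`. -/
def BoundaryCAt {n : ℕ} (k : ℕ) (Ω : Set (EuclideanSpace ℝ (Fin n)))
    (p : EuclideanSpace ℝ (Fin n)) : Prop :=
  ∃ (f : EuclideanSpace ℝ (Fin n) → ℝ) (s : Set (EuclideanSpace ℝ (Fin n))),
    IsOpen s ∧ p ∈ s ∧ ContDiff ℝ (k : ℕ∞) f ∧ (∀ x ∈ s, fderiv ℝ f x ≠ 0) ∧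
    (frontier Ω ∩ s = {x ∈ s | f x = 0}) ∧ (Ω ∩ s = {x ∈ s | f x < 0})

/-- `Ω` has `C^k` boundary. -/
def HasCBoundary {n : ℕ} (k : ℕ) (Ω : Set (EuclideanSpace ℝ (Fin n))) : Prop :=
  ∀ p ∈ frontier Ω, BoundaryCAt k Ω p

/-- `g` has the second-order expansion at `0` with first derivative `a` and second derivative `b`. -/
def HasJet (g : ℝ → ℝ) (a b : ℝ) : Prop :=
  ∃ g' : ℝ → ℝ, (∀ᶠ t in 𝓝 (0 : ℝ), HasDerivAt g (g' t) t) ∧ g' 0 = a ∧ HasDerivAt g' b 0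

namespace HasJet

variable {f g : ℝ → ℝ} {a b a' b' : ℝ}

theorem const (c : ℝ) : HasJet (fun _ => c) 0 0 :=
  ⟨fun _ => 0, Filter.Eventually.of_forall fun t => hasDerivAt_const t c, rfl,
    hasDerivAt_const 0 0⟩

theorem add (hf : HasJet f a b) (hg : HasJet g a' b') :
    HasJet (fun t => f t + g t) (a + a') (b + b') := by
  obtain ⟨f', hf1, hf2, hf3⟩ := hf
  obtain ⟨g', hg1, hg2, hg3⟩ := hg
  refine ⟨fun t => f' t + g' t, ?_, by simp [hf2, hg2], hf3.add hg3⟩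
  filter_upwards [hf1, hg1] with t h1 h2 using h1.add h2

theorem const_mul (c : ℝ) (hf : HasJet f a b) : HasJet (fun t => c * f t) (c * a) (c * b) := by
  obtain ⟨f', hf1, hf2, hf3⟩ := hf
  refine ⟨fun t => c * f' t, ?_, by simp [hf2], hf3.const_mul c⟩
  filter_upwards [hf1] with t h1 using h1.const_mul c

theorem congr (hf : HasJet f a b) (h : ∀ t, g t = f t) (ha : a' = a) (hb : b' = b) :
    HasJet g a' b' := by
  obtain rfl : g = f := funext h
  subst ha hb
  exact hf

theorem sub (hf : HasJet f a b) (hg : HasJet g a' b') :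
    HasJet (fun t => f t - g t) (a - a') (b - b') :=
  (hf.add (hg.const_mul (-1))).congr (fun t => by ring) (by ring) (by ring)

theorem mul (hf : HasJet f a b) (hg : HasJet g a' b') :
    HasJet (fun t => f t * g t) (a * g 0 + f 0 * a') (b * g 0 + 2 * (a * a') + f 0 * b') := by
  obtain ⟨f', hf1, hf2, hf3⟩ := hf
  obtain ⟨g', hg1, hg2, hg3⟩ := hg
  refine ⟨fun t => f' t * g t + f t * g' t, ?_, by simp [hf2, hg2], ?_⟩
  · filter_upwards [hf1, hg1] with t h1 h2 using h1.mul h2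
  · refine ((hf3.mul hg1.self_of_nhds).add (hf1.self_of_nhds.mul hg3)).congr_deriv ?_
    rw [hf2, hg2]; ring

theorem sum {ι : Type*} (s : Finset ι) {F : ι → ℝ → ℝ} {A B : ι → ℝ}
    (h : ∀ i ∈ s, HasJet (F i) (A i) (B i)) :
    HasJet (fun t => ∑ i ∈ s, F i t) (∑ i ∈ s, A i) (∑ i ∈ s, B i) := by
  classical
  induction s using Finset.induction_on with
  | empty => simpa using HasJet.const 0
  | insert i s hi ih =>
    simp only [Finset.sum_insert hi]
    exact (h i (Finset.mem_insert_self i s)).add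
      (ih fun j hj => h j (Finset.mem_insert_of_mem hj))

theorem comp {ψ ψ' : ℝ → ℝ} {c : ℝ} (hf : HasJet f a b)
    (h1 : ∀ᶠ s in 𝓝 (f 0), HasDerivAt ψ (ψ' s) s) (h2 : HasDerivAt ψ' c (f 0)) :
    HasJet (fun t => ψ (f t)) (ψ' (f 0) * a) (c * a ^ 2 + ψ' (f 0) * b) := by
  obtain ⟨f', hf1, hf2, hf3⟩ := hf
  have hc : ContinuousAt f 0 := hf1.self_of_nhds.continuousAt
  refine ⟨fun t => ψ' (f t) * f' t, ?_, by simp [hf2], ?_⟩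
  · filter_upwards [hf1, hc.eventually h1] with t h3 h4 using h4.comp t h3
  · refine ((h2.comp (0 : ℝ) hf1.self_of_nhds).mul hf3).congr_deriv ?_
    simp only [Function.comp, hf2]; ring

theorem of_isLocalMax (hf : HasJet f a b) (hm : IsLocalMax f 0) : a = 0 ∧ b ≤ 0 := by
  obtain ⟨f', hf1, hf2, hf3⟩ := hf
  have h0 : f' 0 = 0 := hm.hasDerivAt_eq_zero hf1.self_of_nhds
  refine ⟨hf2 ▸ h0, ?_⟩
  by_contra! hb
  have hd : deriv f =ᶠ[𝓝 0] f' := by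
    filter_upwards [hf1] with t ht using ht.deriv
  have hdd : deriv (deriv f) 0 = b := by rw [hd.deriv_eq, hf3.deriv]
  have hmin : IsLocalMin f 0 := isLocalMin_of_deriv_deriv_pos (by rw [hdd]; exact hb)
    (by rw [hd.self_of_nhds, h0]) hf1.self_of_nhds.continuousAt
  have hcst : f =ᶠ[𝓝 0] fun _ => f 0 := by
    filter_upwards [hm, hmin] with t h1 h2 using le_antisymm h1 h2
  have h3 : deriv f =ᶠ[𝓝 0] fun _ => 0 := by
    filter_upwards [hcst.deriv] with t ht
    rw [ht]; simp
  have h4 : deriv (deriv f) 0 = 0 := by rw [h3.deriv_eq]; simp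
  linarith

end HasJet

theorem hasJet_line {E : Type*} [NormedAddCommGroup E] [NormedSpace ℝ E] {w : E → ℝ} {x : E}
    (hw : ContDiffAt ℝ 2 w x) (ξ : E) :
    HasJet (fun t : ℝ => w (x + t • ξ)) (fderiv ℝ w x ξ) (fderiv ℝ (fderiv ℝ w) x ξ ξ) := by
  have hl : ∀ t : ℝ, HasDerivAt (fun t : ℝ => x + t • ξ) ξ t := fun t => by
    simpa using ((hasDerivAt_id t).smul_const ξ).const_add x
  have hc : ContinuousAt (fun t : ℝ => x + t • ξ) 0 := (hl 0).continuousAt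
  have h1 : ∀ᶠ y in 𝓝 x, DifferentiableAt ℝ w y := by
    filter_upwards [hw.eventually (by simp)] with y hy using hy.differentiableAt (by simp)
  refine ⟨fun t => fderiv ℝ w (x + t • ξ) ξ, ?_, by simp, ?_⟩
  · have : ∀ᶠ t in 𝓝 (0 : ℝ), DifferentiableAt ℝ w (x + t • ξ) :=
      hc.eventually (by simpa using h1)
    filter_upwards [this] with t ht
    exact ht.hasFDerivAt.comp_hasDerivAt t (hl t)
  · have h2 : DifferentiableAt ℝ (fderiv ℝ w) (x + (0 : ℝ) • ξ) := by
      simpa using (hw.fderiv_right (m := 1) (by norm_num)).differentiableAt (by simp)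
    have h3 := h2.hasFDerivAt.comp_hasDerivAt (0 : ℝ) (hl 0)
    have h4 := h3.clm_apply (hasDerivAt_const (0 : ℝ) ξ)
    simpa using h4

/-- The jet of a power of the distance, along a line avoiding the origin. -/
theorem hasJet_normSq_rpow {E : Type*} [NormedAddCommGroup E] [InnerProductSpace ℝ E]
    {z : E} (hz : z ≠ 0) (ζ : E) (β : ℝ) :
    HasJet (fun t : ℝ => ‖z + t • ζ‖ ^ β) (β * ‖z‖ ^ (β - 2) * inner ℝ z ζ)
      (β * ‖z‖ ^ (β - 2) * ((β - 2) * (inner ℝ z ζ / ‖z‖) ^ 2 + ‖ζ‖ ^ 2)) := by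
  have hz0 : 0 < ‖z‖ := norm_pos_iff.mpr hz
  have hq : HasJet (fun t : ℝ => ‖z‖ ^ 2 + t * (2 * inner ℝ z ζ) + t ^ 2 * ‖ζ‖ ^ 2)
      (2 * inner ℝ z ζ) (2 * ‖ζ‖ ^ 2) := by
    refine ⟨fun t => 2 * inner ℝ z ζ + 2 * t * ‖ζ‖ ^ 2, Filter.Eventually.of_forall fun t => ?_,
      by simp, ?_⟩
    · have := (((hasDerivAt_id t).mul_const (2 * inner ℝ z ζ)).const_add (‖z‖ ^ 2)).add
        ((hasDerivAt_pow 2 t).mul_const (‖ζ‖ ^ 2))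
      exact this.congr_deriv (by simp)
    · have := (((hasDerivAt_id (0 : ℝ)).const_mul 2).mul_const (‖ζ‖ ^ 2)).const_add
        (2 * inner ℝ z ζ)
      exact this.congr_deriv (by simp)
  have hpos : (0 : ℝ) < ‖z‖ ^ 2 := by positivity
  have hc := hq.comp (ψ := fun s => s ^ (β / 2)) (ψ' := fun s => β / 2 * s ^ (β / 2 - 1))
    (c := β / 2 * ((β / 2 - 1) * (‖z‖ ^ 2) ^ (β / 2 - 1 - 1))) ?_ ?_
  · have e1 : (‖z‖ ^ 2) ^ (β / 2 - 1) = ‖z‖ ^ (β - 2) := by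
      rw [← Real.rpow_natCast, ← Real.rpow_mul hz0.le]; congr 1; push_cast; ring
    have e2 : (‖z‖ ^ 2) ^ (β / 2 - 1 - 1) = ‖z‖ ^ (β - 2) / ‖z‖ ^ 2 := by
      rw [Real.rpow_sub hpos, e1, Real.rpow_one]
    refine hc.congr (fun t => ?_) ?_ ?_
    · have : ‖z‖ ^ 2 + t * (2 * inner ℝ z ζ) + t ^ 2 * ‖ζ‖ ^ 2 = ‖z + t • ζ‖ ^ 2 := by
        rw [norm_add_sq_real, inner_smul_right, norm_smul, mul_pow, Real.norm_eq_abs, sq_abs]; ring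
      simp only [this]
      rw [← Real.rpow_natCast, ← Real.rpow_mul (norm_nonneg _)]; congr 1; push_cast; ring
    · simp only [zero_mul, add_zero, ne_eq, OfNat.ofNat_ne_zero, not_false_eq_true, zero_pow, e1]
      ring
    · simp only [zero_mul, add_zero, ne_eq, OfNat.ofNat_ne_zero, not_false_eq_true, zero_pow,
        e1, e2]
      field_simp
  · simp only [zero_mul, add_zero, ne_eq, OfNat.ofNat_ne_zero, not_false_eq_true, zero_pow]
    filter_upwards [eventually_gt_nhds hpos] with s hs
    exact Real.hasDerivAt_rpow_const (Or.inl hs.ne')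
  · simp only [zero_mul, add_zero, ne_eq, OfNat.ofNat_ne_zero, not_false_eq_true, zero_pow]
    exact (Real.hasDerivAt_rpow_const (Or.inl hpos.ne')).const_mul _

theorem exists_gram_factor {ι : Type*} [Fintype ι] [DecidableEq ι] (M : Matrix ι ι ℝ)
    (hs : ∀ i j, M i j = M j i) (hp : ∀ x : ι → ℝ, 0 ≤ ∑ i, ∑ j, M i j * x i * x j) :
    ∃ B : ι → ι → ℝ, ∀ i j, ∑ k, B k i * B k j = M i j := by
  have hM : M.PosSemidef := by
    refine Matrix.posSemidef_iff_dotProduct_mulVec.mpr ⟨?_, fun x => ?_⟩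
    · ext i j
      simp [Matrix.conjTranspose_apply, hs j i]
    · refine (hp x).trans_eq ?_
      simp only [dotProduct, Matrix.mulVec, Pi.star_apply, star_trivial, Finset.mul_sum]
      exact Finset.sum_congr rfl fun i _ => Finset.sum_congr rfl fun j _ => by ring
  obtain ⟨B, hB⟩ : ∃ B : Matrix ι ι ℝ, M = star B * B := by
    open scoped MatrixOrder in
    exact CStarAlgebra.nonneg_iff_eq_star_mul_self.mp hM.nonneg
  refine ⟨B, fun i j => ?_⟩
  rw [hB]
  simp [Matrix.mul_apply, Matrix.star_eq_conjTranspose]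

/-- `ℝⁿ` with its Euclidean norm. -/
abbrev Eu (n : ℕ) := EuclideanSpace ℝ (Fin n)

/-- A symmetric matrix with quadratic form bounded below by `lam` and entries bounded by `Lam`. -/
structure EllipticMatrix {n : ℕ} (lam Lam : ℝ) (A : Matrix (Fin n) (Fin n) ℝ) : Prop where
  symm : ∀ i j, A i j = A j i
  lower : ∀ ξ : Eu n, lam * ‖ξ‖ ^ 2 ≤ ∑ i, ∑ j, A i j * ξ i * ξ j
  upper : ∀ i j, |A i j| ≤ Lam

/-- The contraction `∑ A_{ij} B(e_i, e_j)`. -/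
noncomputable def trHess {n : ℕ} (A : Matrix (Fin n) (Fin n) ℝ) (B : Eu n →L[ℝ] Eu n →L[ℝ] ℝ) : ℝ :=
  ∑ i, ∑ j, A i j * B (EuclideanSpace.single i 1) (EuclideanSpace.single j 1)

section

variable {n : ℕ} {κ : Type*} [Fintype κ]

theorem clm_apply_eq_sum {F : Type*} [NormedAddCommGroup F] [NormedSpace ℝ F]
    (l : Eu n →L[ℝ] F) (ξ : Eu n) :
    l ξ = ∑ i, ξ i • l (EuclideanSpace.single i 1) := by
  conv_lhs => rw [← (EuclideanSpace.basisFun (Fin n) ℝ).sum_repr ξ]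
  simp

theorem bilin_apply_eq_sum (B : Eu n →L[ℝ] Eu n →L[ℝ] ℝ) (ξ η : Eu n) :
    B ξ η = ∑ i, ∑ j, ξ i * η j * B (EuclideanSpace.single i 1) (EuclideanSpace.single j 1) := by
  rw [clm_apply_eq_sum B ξ, sum_apply]
  refine Finset.sum_congr rfl fun i _ => ?_
  rw [smul_apply, clm_apply_eq_sum _ η, Finset.smul_sum]
  refine Finset.sum_congr rfl fun j _ => ?_
  simp only [smul_eq_mul]; ring

theorem sum_bilin_eq_trHess {A : Matrix (Fin n) (Fin n) ℝ} {ξ : κ → Eu n}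
    (h : ∀ i j, ∑ k, ξ k i * ξ k j = A i j) (B : Eu n →L[ℝ] Eu n →L[ℝ] ℝ) :
    ∑ k, B (ξ k) (ξ k) = trHess A B := by
  rw [Finset.sum_congr rfl fun k _ => bilin_apply_eq_sum B (ξ k) (ξ k), trHess, Finset.sum_comm]
  refine Finset.sum_congr rfl fun i _ => ?_
  rw [Finset.sum_comm]
  refine Finset.sum_congr rfl fun j _ => ?_
  rw [← Finset.sum_mul, h]

theorem sum_norm_sq_eq {A : Matrix (Fin n) (Fin n) ℝ} {ξ : κ → Eu n}
    (h : ∀ i j, ∑ k, ξ k i * ξ k j = A i j) : ∑ k, ‖ξ k‖ ^ 2 = ∑ i, A i i := by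
  simp only [EuclideanSpace.norm_sq_eq, Real.norm_eq_abs, sq_abs]
  rw [Finset.sum_comm]
  exact Finset.sum_congr rfl fun i _ => by simp [← h, sq]

theorem sum_inner_sq_eq {A : Matrix (Fin n) (Fin n) ℝ} {ξ : κ → Eu n}
    (h : ∀ i j, ∑ k, ξ k i * ξ k j = A i j) (ν : Eu n) :
    ∑ k, inner ℝ ν (ξ k) ^ 2 = ∑ i, ∑ j, A i j * ν i * ν j := by
  have : ∀ k, inner ℝ ν (ξ k) ^ 2 = ∑ i, ∑ j, (ξ k i * ξ k j) * ν i * ν j := fun k => by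
    rw [PiLp.inner_apply, sq, Finset.sum_mul_sum]
    refine Finset.sum_congr rfl fun i _ => Finset.sum_congr rfl fun j _ => ?_
    simp only [RCLike.inner_apply, conj_trivial]; ring
  simp only [this]
  rw [Finset.sum_comm]
  refine Finset.sum_congr rfl fun i _ => ?_
  rw [Finset.sum_comm]
  refine Finset.sum_congr rfl fun j _ => ?_
  rw [← Finset.sum_mul, ← Finset.sum_mul, h]

/-- The quadratic form of an elliptic matrix controls the norm of a linear functional. -/
theorem EllipticMatrix.le_sum_sq {lam Lam : ℝ} {A : Matrix (Fin n) (Fin n) ℝ}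
    (hA : EllipticMatrix lam Lam A) {ξ : κ → Eu n}
    (h : ∀ i j, ∑ k, ξ k i * ξ k j = A i j) (l : Eu n →L[ℝ] ℝ) :
    lam * ‖l‖ ^ 2 ≤ ∑ k, l (ξ k) ^ 2 := by
  obtain ⟨ν, rfl⟩ := (InnerProductSpace.toDual ℝ (Eu n)).surjective l
  simp only [InnerProductSpace.toDual_apply_apply, LinearIsometryEquiv.norm_map]
  rw [sum_inner_sq_eq h]
  exact hA.lower ν

theorem EllipticMatrix.trace_le {lam Lam : ℝ} {A : Matrix (Fin n) (Fin n) ℝ}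
    (hA : EllipticMatrix lam Lam A) : ∑ i, A i i ≤ n * Lam := by
  calc ∑ i, A i i ≤ ∑ _i : Fin n, Lam :=
        Finset.sum_le_sum fun i _ => (le_abs_self _).trans (hA.upper i i)
    _ = n * Lam := by simp

theorem EllipticMatrix.exists_factor {lam Lam : ℝ} (hl : 0 ≤ lam) {A : Matrix (Fin n) (Fin n) ℝ}
    (hA : EllipticMatrix lam Lam A) :
    ∃ ξ : Fin n → Eu n, ∀ i j, ∑ k, ξ k i * ξ k j = A i j := by
  obtain ⟨B, hB⟩ := exists_gram_factor A hA.symm fun x =>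
    le_trans (by positivity) (hA.lower (WithLp.toLp 2 x))
  exact ⟨fun k => WithLp.toLp 2 (B k), hB⟩

theorem abs_bilin_le_of_entries_le {A : Matrix (Fin n) (Fin n) ℝ} {e : ℝ}
    (h : ∀ i j, |A i j| ≤ e) (s t : Eu n) :
    |∑ i, ∑ j, A i j * s i * t j| ≤ n * e * ‖s‖ * ‖t‖ := by
  have hcs : ∀ s : Eu n, ∑ i, |s i| ≤ √n * ‖s‖ := fun s => by
    have := Finset.sum_mul_sq_le_sq_mul_sq Finset.univ (fun _ : Fin n => (1 : ℝ)) (fun i => |s i|)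
    simp only [one_mul, one_pow, Finset.sum_const, Finset.card_univ, Fintype.card_fin,
      nsmul_eq_mul, mul_one, sq_abs] at this
    have h2 : ∑ i, s i ^ 2 = ‖s‖ ^ 2 := by simp [EuclideanSpace.norm_sq_eq]
    rw [h2] at this
    refine abs_le_of_sq_le_sq' ?_ (by positivity) |>.2
    rw [mul_pow, Real.sq_sqrt (Nat.cast_nonneg n)]
    exact this
  rcases Nat.eq_zero_or_pos n with rfl | hn
  · simp
  have he : 0 ≤ e := (abs_nonneg _).trans (h ⟨0, hn⟩ ⟨0, hn⟩)
  calc |∑ i, ∑ j, A i j * s i * t j| ≤ ∑ i, ∑ j, |A i j * s i * t j| :=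
        (Finset.abs_sum_le_sum_abs _ _).trans
          (Finset.sum_le_sum fun i _ => Finset.abs_sum_le_sum_abs _ _)
    _ ≤ ∑ i, ∑ j, e * (|s i| * |t j|) := by
        refine Finset.sum_le_sum fun i _ => Finset.sum_le_sum fun j _ => ?_
        rw [abs_mul, abs_mul, mul_assoc]
        exact mul_le_mul_of_nonneg_right (h i j) (by positivity)
    _ = e * ((∑ i, |s i|) * ∑ j, |t j|) := by
        rw [Finset.sum_mul_sum, Finset.mul_sum]
        exact Finset.sum_congr rfl fun i _ => (Finset.mul_sum _ _ _).symm
    _ ≤ e * ((√n * ‖s‖) * (√n * ‖t‖)) := by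
        gcongr
        · exact hcs s
        · exact hcs t
    _ = (√n * √n) * e * ‖s‖ * ‖t‖ := by ring
    _ = n * e * ‖s‖ * ‖t‖ := by rw [Real.mul_self_sqrt (Nat.cast_nonneg n)]

/-- Reflection coupling of two nearby elliptic matrices along the direction `ν`. -/
theorem exists_reflection_coupling {lam Lam δ : ℝ} (hl : 0 < lam)
    {A₁ A₂ : Matrix (Fin n) (Fin n) ℝ} (h₁ : EllipticMatrix lam Lam A₁)
    (h₂ : EllipticMatrix lam Lam A₂) (hδ : ∀ i j, |A₁ i j - A₂ i j| ≤ δ) (hδl : n * δ ≤ lam)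
    {ν : Eu n} (hν : ‖ν‖ = 1) :
    ∃ ξ η : Fin n ⊕ Fin n → Eu n, (∀ i j, ∑ k, ξ k i * ξ k j = A₁ i j) ∧
      (∀ i j, ∑ k, η k i * η k j = A₂ i j) ∧
      (∑ k, ‖ξ k - η k‖ ^ 2 = lam + 2 * ((n * δ) ^ 2 / (4 * lam)) * n) ∧
      (∑ k, inner ℝ ν (ξ k - η k) ^ 2 = lam + 2 * ((n * δ) ^ 2 / (4 * lam))) := by
  classical
  set q : ℝ := (n * δ) ^ 2 / (4 * lam) with hq
  let c : Matrix (Fin n) (Fin n) ℝ := Matrix.of fun i j =>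
    (A₁ i j + A₂ i j) / 2 - lam / 2 * (ν i * ν j) - if i = j then q else 0
  have hc : ∀ i j, c i j =
    (A₁ i j + A₂ i j) / 2 - lam / 2 * (ν i * ν j) - if i = j then q else 0 := fun _ _ => rfl
  have hcs : ∀ i j, c i j = c j i := fun i j => by
    simp only [hc, h₁.symm i j, h₂.symm i j, eq_comm (a := i) (b := j)]; ring
  let M : Matrix (Fin n ⊕ Fin n) (Fin n ⊕ Fin n) ℝ := Matrix.fromBlocks A₁ c c A₂
  have hδ0 : 0 ≤ n * δ := by
    rcases Nat.eq_zero_or_pos n with rfl | hn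
    · simp
    exact mul_nonneg (by positivity) ((abs_nonneg _).trans (hδ ⟨0, hn⟩ ⟨0, hn⟩))
  have hq4 : q ≤ lam / 4 := by
    rw [hq, div_le_iff₀ (by positivity)]
    nlinarith
  have hq0 : 0 ≤ q := by positivity
  obtain ⟨B, hB⟩ := exists_gram_factor M (by
      rintro (i | i) (j | j)
      · exact h₁.symm i j
      · exact hcs i j
      · exact hcs i j
      · exact h₂.symm i j) (by
    intro x
    set a : Eu n := WithLp.toLp 2 fun i => x (Sum.inl i) with ha
    set b : Eu n := WithLp.toLp 2 fun i => x (Sum.inr i) with hb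
    have key : ∑ i, ∑ j, M i j * x i * x j =
        (∑ i, ∑ j, A₁ i j * (a + b) i * (a + b) j) / 4 +
        (∑ i, ∑ j, A₂ i j * (a + b) i * (a + b) j) / 4 +
        ((∑ i, ∑ j, c i j * (a + b) i * (a + b) j) / 2) +
        (lam * inner ℝ ν (a - b) ^ 2 / 4 + q / 2 * ‖a - b‖ ^ 2) +
        (∑ i, ∑ j, (A₁ - A₂) i j * (a + b) i * (a - b) j) / 2 := by
      have e1 : inner ℝ ν (a - b) ^ 2 = ∑ i, ∑ j, (ν i * ν j) * (a - b) i * (a - b) j := by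
        rw [PiLp.inner_apply, sq, Finset.sum_mul_sum]
        refine Finset.sum_congr rfl fun i _ => Finset.sum_congr rfl fun j _ => ?_
        simp only [RCLike.inner_apply, conj_trivial]; ring
      have e2 : ‖a - b‖ ^ 2 = ∑ i, ∑ j, (if i = j then (1 : ℝ) else 0) * (a - b) i * (a - b) j := by
        rw [EuclideanSpace.norm_sq_eq]
        refine Finset.sum_congr rfl fun i _ => ?_
        rw [Finset.sum_eq_single i (fun j _ hj => by simp [hj.symm]) (by simp)]
        rw [Real.norm_eq_abs, sq_abs, if_pos rfl]; ring
      rw [e1, e2]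
      simp only [Fintype.sum_sum_type, M, Matrix.fromBlocks_apply₁₁, Matrix.fromBlocks_apply₁₂,
        Matrix.fromBlocks_apply₂₁, Matrix.fromBlocks_apply₂₂]
      have s1 : ∑ i, ∑ j, A₁ i j * a j * b i = ∑ i, ∑ j, A₁ i j * a i * b j := by
        rw [Finset.sum_comm]
        refine Finset.sum_congr rfl fun i _ => Finset.sum_congr rfl fun j _ => ?_
        rw [h₁.symm]
      have s2 : ∑ i, ∑ j, A₂ i j * a j * b i = ∑ i, ∑ j, A₂ i j * a i * b j := by
        rw [Finset.sum_comm]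
        refine Finset.sum_congr rfl fun i _ => Finset.sum_congr rfl fun j _ => ?_
        rw [h₂.symm]
      have s3 : ∑ i, ((∑ j, A₁ i j * a i * a j) + ∑ j, c i j * a i * b j) +
          ∑ i, ((∑ j, c i j * b i * a j) + ∑ j, A₂ i j * b i * b j) =
          ∑ i, ∑ j, (A₁ i j * a i * a j + c i j * a i * b j + c i j * b i * a j
            + A₂ i j * b i * b j) := by
        simp only [Finset.sum_add_distrib]; ring
      have s4 : ∀ i, x (Sum.inl i) = a i := fun i => rfl
      have s5 : ∀ i, x (Sum.inr i) = b i := fun i => rfl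
      simp only [s4, s5]
      rw [s3]
      have s6 : ∀ f : Fin n → Fin n → ℝ, ∀ r : ℝ, r * (∑ i, ∑ j, f i j) = ∑ i, ∑ j, r * f i j :=
        fun f r => by simp only [Finset.mul_sum]
      have t1 : ∑ i, ∑ j, (A₁ - A₂) i j * (a + b) i * (a - b) j =
          ∑ i, ∑ j, ((A₁ i j - A₂ i j) * (a i * a j - b i * b j)) := by
        have : ∑ i, ∑ j, (A₁ - A₂) i j * (a + b) i * (a - b) j =
            ∑ i, ∑ j, ((A₁ i j - A₂ i j) * (a i * a j - b i * b j)) +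
            (∑ i, ∑ j, A₁ i j * a j * b i - ∑ i, ∑ j, A₁ i j * a i * b j) -
            (∑ i, ∑ j, A₂ i j * a j * b i - ∑ i, ∑ j, A₂ i j * a i * b j) := by
          simp only [← Finset.sum_add_distrib, ← Finset.sum_sub_distrib]
          refine Finset.sum_congr rfl fun i _ => Finset.sum_congr rfl fun j _ => ?_
          simp only [Matrix.sub_apply, PiLp.add_apply, PiLp.sub_apply]; ring
        rw [this, s1, s2]; ring
      rw [t1]
      simp only [div_eq_inv_mul, s6, ← Finset.sum_add_distrib]
      refine Finset.sum_congr rfl fun i _ => Finset.sum_congr rfl fun j _ => ?_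
      simp only [PiLp.add_apply, PiLp.sub_apply, hc]
      split_ifs <;> ring
    rw [key]
    have k1 := h₁.lower (a + b)
    have k2 := h₂.lower (a + b)
    have k3 : ∑ i, ∑ j, c i j * (a + b) i * (a + b) j =
        (∑ i, ∑ j, A₁ i j * (a + b) i * (a + b) j) / 2 +
        (∑ i, ∑ j, A₂ i j * (a + b) i * (a + b) j) / 2 - lam / 2 * inner ℝ ν (a + b) ^ 2
          - q * ‖a + b‖ ^ 2 := by
      have e1 : inner ℝ ν (a + b) ^ 2 = ∑ i, ∑ j, (ν i * ν j) * (a + b) i * (a + b) j := by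
        rw [PiLp.inner_apply, sq, Finset.sum_mul_sum]
        refine Finset.sum_congr rfl fun i _ => Finset.sum_congr rfl fun j _ => ?_
        simp only [RCLike.inner_apply, conj_trivial]; ring
      have e2 : ‖a + b‖ ^ 2 = ∑ i, ∑ j, (if i = j then (1 : ℝ) else 0) * (a + b) i * (a + b) j := by
        rw [EuclideanSpace.norm_sq_eq]
        refine Finset.sum_congr rfl fun i _ => ?_
        rw [Finset.sum_eq_single i (fun j _ hj => by simp [hj.symm]) (by simp)]
        rw [Real.norm_eq_abs, sq_abs, if_pos rfl]; ring
      rw [e1, e2]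
      simp only [div_eq_inv_mul, Finset.mul_sum, ← Finset.sum_add_distrib,
        ← Finset.sum_sub_distrib]
      refine Finset.sum_congr rfl fun i _ => Finset.sum_congr rfl fun j _ => ?_
      simp only [hc]
      split_ifs <;> ring
    have k4 : inner ℝ ν (a + b) ^ 2 ≤ ‖a + b‖ ^ 2 := by
      have := abs_real_inner_le_norm ν (a + b)
      rw [hν, one_mul] at this
      exact sq_le_sq' (by linarith [abs_le.mp this]) (abs_le.mp this).2
    have k5 := abs_bilin_le_of_entries_le (A := A₁ - A₂) hδ (a + b) (a - b)
    have k6 := neg_le_of_abs_le k5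
    rw [k3]
    have hE : (n * δ) ^ 2 = 4 * lam * q := by rw [hq]; field_simp
    have k7 : n * δ * ‖a + b‖ * ‖a - b‖ ≤ lam * ‖a + b‖ ^ 2 + q * ‖a - b‖ ^ 2 := by
      have := sq_nonneg (2 * lam * ‖a + b‖ - n * δ * ‖a - b‖)
      have h3 : (n * δ) ^ 2 * ‖a - b‖ ^ 2 = 4 * lam * q * ‖a - b‖ ^ 2 := by rw [hE]
      have : 0 ≤ (4 * lam) * (lam * ‖a + b‖ ^ 2 + q * ‖a - b‖ ^ 2
          - n * δ * ‖a + b‖ * ‖a - b‖) := by nlinarith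
      have := nonneg_of_mul_nonneg_right this (by positivity)
      linarith
    nlinarith [sq_nonneg (inner ℝ ν (a - b)), sq_nonneg ‖a + b‖])
  have hζ : ∀ i j, ∑ k, (B k (Sum.inl i) - B k (Sum.inr i)) * (B k (Sum.inl j) - B k (Sum.inr j))
      = lam * (ν i * ν j) + 2 * (if i = j then q else 0) := fun i j => by
    have : ∀ k, (B k (Sum.inl i) - B k (Sum.inr i)) * (B k (Sum.inl j) - B k (Sum.inr j)) =
        B k (Sum.inl i) * B k (Sum.inl j) - B k (Sum.inl i) * B k (Sum.inr j) -
        B k (Sum.inr i) * B k (Sum.inl j) + B k (Sum.inr i) * B k (Sum.inr j) := fun k => by ring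
    simp only [this, Finset.sum_add_distrib, Finset.sum_sub_distrib, hB]
    simp only [M, Matrix.fromBlocks_apply₁₁, Matrix.fromBlocks_apply₁₂,
        Matrix.fromBlocks_apply₂₁, Matrix.fromBlocks_apply₂₂, hc]
    ring
  have hν2 : ∑ i, ν i ^ 2 = 1 := by
    have : ‖ν‖ ^ 2 = ∑ i, ν i ^ 2 := by simp [EuclideanSpace.norm_sq_eq]
    rw [← this, hν]; norm_num
  refine ⟨fun k => WithLp.toLp 2 fun i => B k (Sum.inl i),
    fun k => WithLp.toLp 2 fun i => B k (Sum.inr i), fun i j => hB _ _, fun i j => hB _ _, ?_, ?_⟩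
  · rw [sum_norm_sq_eq (A := fun i j => lam * (ν i * ν j) + 2 * (if i = j then q else 0)) hζ]
    simp only [if_true, Finset.sum_add_distrib, ← Finset.mul_sum, ← sq, hν2]
    simp; ring
  · rw [sum_inner_sq_eq (A := fun i j => lam * (ν i * ν j) + 2 * (if i = j then q else 0)) hζ]
    have : ∀ i j, (lam * (ν i * ν j) + 2 * (if i = j then q else 0)) * ν i * ν j =
        lam * (ν i ^ 2 * ν j ^ 2) + 2 * (if i = j then q * ν i * ν j else 0) := fun i j => by
      split_ifs <;> ring
    simp only [this, Finset.sum_add_distrib, ← Finset.mul_sum, hν2]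
    simp [mul_assoc, ← sq, ← Finset.mul_sum, hν2]

end

theorem hasJet_norm_sq {E : Type*} [NormedAddCommGroup E] [InnerProductSpace ℝ E] (z ζ : E) :
    HasJet (fun t : ℝ => ‖z + t • ζ‖ ^ 2) (2 * inner ℝ z ζ) (2 * ‖ζ‖ ^ 2) := by
  refine HasJet.congr (f := fun t : ℝ => ‖z‖ ^ 2 + t * (2 * inner ℝ z ζ) + t ^ 2 * ‖ζ‖ ^ 2)
    ⟨fun t => 2 * inner ℝ z ζ + 2 * t * ‖ζ‖ ^ 2, ?_, by simp, ?_⟩ (fun t => ?_) rfl rfl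
  · refine Filter.Eventually.of_forall fun t => ?_
    have h1 := ((hasDerivAt_id t).mul_const (2 * inner ℝ z ζ)).const_add (‖z‖ ^ 2)
    have h2 := ((hasDerivAt_id t).pow 2).mul_const (‖ζ‖ ^ 2)
    exact (h1.add h2).congr_deriv (by simp)
  · exact ((((hasDerivAt_id (0 : ℝ)).const_mul 2).mul_const (‖ζ‖ ^ 2)).const_add
      (2 * inner ℝ z ζ)).congr_deriv (by simp)
  · rw [norm_add_sq_real, inner_smul_right, norm_smul, Real.norm_eq_abs, mul_pow, sq_abs]; ring

/-- An interior maximum of a function of two variables restricts to a local maximum on lines. -/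
theorem isLocalMax_line_of_isMaxOn {E : Type*} [NormedAddCommGroup E] [NormedSpace ℝ E]
    {Φ : E × E → ℝ} {y0 : E} {ρ : ℝ} {x y : E}
    (hmax : IsMaxOn Φ (Metric.closedBall y0 ρ ×ˢ Metric.closedBall y0 ρ) (x, y))
    (hx : x ∈ Metric.ball y0 ρ) (hy : y ∈ Metric.ball y0 ρ) (ξ η : E) :
    IsLocalMax (fun t : ℝ => Φ (x + t • ξ, y + t • η)) 0 := by
  have hc : ∀ p v : E, ContinuousAt (fun t : ℝ => p + t • v) 0 := fun p v => by fun_prop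
  have h1 := (hc x ξ).eventually (Metric.isOpen_ball.mem_nhds (by simpa using hx))
  have h2 := (hc y η).eventually (Metric.isOpen_ball.mem_nhds (by simpa using hy))
  filter_upwards [h1, h2] with t h1 h2
  simpa using hmax (mk_mem_prod (Metric.ball_subset_closedBall h1)
    (Metric.ball_subset_closedBall h2))

/-- One-sided linear growth bounds the derivative. -/
theorem norm_fderiv_le_of_growth {E : Type*} [NormedAddCommGroup E] [NormedSpace ℝ E]
    {w : E → ℝ} {y0 : E} {L N ρ : ℝ} (hρ : 0 < ρ) (hL : 0 ≤ L) (hw : DifferentiableAt ℝ w y0)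
    (h : ∀ x ∈ Metric.closedBall y0 ρ, w x - w y0 ≤ L * ‖x - y0‖ + N * ‖x - y0‖ ^ 2) :
    ‖fderiv ℝ w y0‖ ≤ L := by
  have key : ∀ ξ, fderiv ℝ w y0 ξ ≤ L * ‖ξ‖ := fun ξ => by
    have hd : HasDerivAt (fun t : ℝ => w (y0 + t • ξ)) (fderiv ℝ w y0 ξ) 0 := by
      have hl : HasDerivAt (fun t : ℝ => y0 + t • ξ) ξ 0 := by
        simpa using ((hasDerivAt_id (0 : ℝ)).smul_const ξ).const_add y0
      have hw' : HasFDerivAt w (fderiv ℝ w y0) (y0 + (0 : ℝ) • ξ) := by simpa using hw.hasFDerivAt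
      exact hw'.comp_hasDerivAt 0 hl
    have ht := hd.tendsto_slope_zero_right
    have hlim : Filter.Tendsto (fun t : ℝ => L * ‖ξ‖ + N * t * ‖ξ‖ ^ 2) (𝓝[>] 0) (𝓝 (L * ‖ξ‖)) := by
      have : ContinuousAt (fun t : ℝ => L * ‖ξ‖ + N * t * ‖ξ‖ ^ 2) 0 := by fun_prop
      simpa using this.tendsto.mono_left nhdsWithin_le_nhds
    refine le_of_tendsto_of_tendsto ht hlim ?_
    have hc : ContinuousAt (fun t : ℝ => y0 + t • ξ) 0 := by fun_prop
    have h1 := hc.eventually (Metric.closedBall_mem_nhds (y0 + (0 : ℝ) • ξ) hρ)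
    filter_upwards [self_mem_nhdsWithin, nhdsWithin_le_nhds h1] with t ht h1
    have ht : 0 < t := ht
    have := h (y0 + t • ξ) (by simpa using h1)
    simp only [add_sub_cancel_left, norm_smul, Real.norm_eq_abs, abs_of_pos ht] at this
    simp only [zero_add, zero_smul, add_zero, smul_eq_mul]
    rw [inv_mul_le_iff₀ ht]
    linarith
  refine ContinuousLinearMap.opNorm_le_bound _ hL fun ξ => ?_
  rw [Real.norm_eq_abs, abs_le]
  have h1 := key (-ξ)
  rw [map_neg, norm_neg] at h1
  exact ⟨by linarith, key ξ⟩

theorem coupling_defect_bounds {m lam C0 K' ρ N r G dx dy : ℝ} (hm : 0 ≤ m) (hl : 0 < lam)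
    (hρ : 0 < ρ) (hN0 : 0 ≤ N) (hK0 : 0 ≤ K') (hr0 : 0 < r) (hr : r ≤ 2 * ρ)
    (hG0 : 0 ≤ G) (hG : G ≤ 2 * N * (dx + dy)) (hd : N * (dx ^ 2 + dy ^ 2) ≤ K' * r)
    (hsm1 : m ^ 2 * (C0 ^ 2 * (8 * ρ ^ 2 + 32 * N * ρ * K')) ≤ lam ^ 2)
    (hsm2 : ρ * (m ^ 3 * C0 ^ 2 * (2 * ρ + 8 * N * K')) ≤ lam ^ 2 / 8) :
    m * (C0 * (r + G)) ≤ lam ∧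
      2 * ((m * (C0 * (r + G))) ^ 2 / (4 * lam)) * m / r ≤ lam / (8 * ρ) := by
  have hG2 : G ^ 2 ≤ 8 * N * (K' * r) := by
    have h1 : G ^ 2 ≤ (2 * N * (dx + dy)) ^ 2 := by gcongr
    have h2 : (dx + dy) ^ 2 ≤ 2 * (dx ^ 2 + dy ^ 2) := by nlinarith [sq_nonneg (dx - dy)]
    have h3 : N * (dx + dy) ^ 2 ≤ 2 * (K' * r) := by
      have := mul_le_mul_of_nonneg_left h2 hN0
      linarith
    have h4 := mul_le_mul_of_nonneg_left h3 hN0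
    calc G ^ 2 ≤ _ := h1
      _ = 4 * (N * (N * (dx + dy) ^ 2)) := by ring
      _ ≤ 4 * (N * (2 * (K' * r))) := by linarith
      _ = _ := by ring
  have hδ2 : (C0 * (r + G)) ^ 2 ≤ r * (2 * C0 ^ 2 * (2 * ρ + 8 * N * K')) := by
    have h1 : (r + G) ^ 2 ≤ 2 * (r ^ 2 + G ^ 2) := by nlinarith [sq_nonneg (r - G)]
    have h3 : r ^ 2 ≤ r * (2 * ρ) := by nlinarith
    have h2 : (r + G) ^ 2 ≤ r * (2 * (2 * ρ + 8 * N * K')) := by linarith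
    calc (C0 * (r + G)) ^ 2 = C0 ^ 2 * (r + G) ^ 2 := by ring
      _ ≤ C0 ^ 2 * (r * (2 * (2 * ρ + 8 * N * K'))) := by gcongr
      _ = _ := by ring
  generalize C0 * (r + G) = δ at *
  have hp : 0 ≤ 2 * C0 ^ 2 * (2 * ρ + 8 * N * K') := by positivity
  constructor
  · refine abs_le_of_sq_le_sq' ?_ hl.le |>.2
    refine le_trans ?_ hsm1
    rw [mul_pow]
    gcongr
    refine hδ2.trans ((mul_le_mul_of_nonneg_right hr hp).trans_eq ?_)
    ring
  · have h1 : 2 * ((m * δ) ^ 2 / (4 * lam)) * m / r ≤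
        m ^ 3 * C0 ^ 2 * (2 * ρ + 8 * N * K') / lam := by
      rw [div_le_div_iff₀ hr0 hl]
      have : 2 * ((m * δ) ^ 2 / (4 * lam)) * m * lam = m ^ 3 * δ ^ 2 / 2 := by field_simp; ring
      rw [this]
      have : m ^ 3 * δ ^ 2 ≤ m ^ 3 * (r * (2 * C0 ^ 2 * (2 * ρ + 8 * N * K'))) := by gcongr
      linarith
    refine h1.trans ?_
    rw [div_le_div_iff₀ hl (by positivity)]
    linarith

theorem coupling_contradiction {m lam Lam C0 ρ N L r q α₁ α₂ τ₁ τ₂ : ℝ} (hρ : 0 < ρ) (hr0 : 0 < r)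
    (hN0 : 0 ≤ N) (hL0 : 0 ≤ L) (hm : 0 ≤ m) (hq0 : 0 ≤ q) (t1 : -C0 ≤ α₁) (t2 : α₂ ≤ C0)
    (t3 : τ₁ ≤ m * Lam) (t4 : τ₂ ≤ m * Lam) (hqr : 2 * q * m / r ≤ lam / (8 * ρ))
    (hL : 2 * C0 + 4 * N * m * Lam < L * lam / (8 * ρ))
    (hsum : α₁ - α₂ - L * (1 / r * (lam + 2 * q * m - (lam + 2 * q)) - (lam + 2 * q * m) / (4 * ρ))
      - 2 * N * (τ₁ + τ₂) ≤ 0) : False := by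
  have e1 : L * (1 / r * (lam + 2 * q * m - (lam + 2 * q)) - (lam + 2 * q * m) / (4 * ρ)) ≤
      L * (lam / (8 * ρ) - lam / (4 * ρ)) := by
    refine mul_le_mul_of_nonneg_left ?_ hL0
    have a1 : 1 / r * (lam + 2 * q * m - (lam + 2 * q)) ≤ 2 * q * m / r := by
      rw [one_div, inv_mul_eq_div]
      gcongr
      linarith
    have a2 : lam / (4 * ρ) ≤ (lam + 2 * q * m) / (4 * ρ) := by
      gcongr
      have : 0 ≤ 2 * q * m := by positivity
      linarith
    linarith
  have e2 : L * (lam / (8 * ρ) - lam / (4 * ρ)) = - (L * lam / (8 * ρ)) := by field_simp; ring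
  have e3 : 2 * N * (τ₁ + τ₂) ≤ 2 * N * (m * Lam + m * Lam) := by gcongr
  linarith

section

variable {n : ℕ}

theorem doubling_le_of_small {lam Lam C0 K' : ℝ} (hl : 0 < lam)
    {w : Eu n → ℝ} {A : Eu n → Matrix (Fin n) (Fin n) ℝ} {y0 : Eu n} {ρ S N L : ℝ} (hρ : 0 < ρ)
    (hN0 : 0 ≤ N) (hL0 : 0 ≤ L)
    (hw : ∀ x ∈ Metric.closedBall y0 ρ, ContDiffAt ℝ 2 w x)
    (hA : ∀ x ∈ Metric.closedBall y0 ρ, EllipticMatrix lam Lam (A x))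
    (hAA : ∀ x ∈ Metric.closedBall y0 ρ, ∀ y ∈ Metric.closedBall y0 ρ, ∀ i j,
      |A x i j - A y i j| ≤ C0 * (‖x - y‖ + ‖fderiv ℝ w x - fderiv ℝ w y‖))
    (hQ : ∀ x ∈ Metric.closedBall y0 ρ, |trHess (A x) (fderiv ℝ (fderiv ℝ w) x)| ≤ C0)
    (hK : ∀ x ∈ Metric.closedBall y0 ρ, ‖fderiv ℝ w x‖ ≤ K')
    (hS : ∀ x ∈ Metric.closedBall y0 ρ, |w x| ≤ S)
    (hsm1 : n ^ 2 * (C0 ^ 2 * (8 * ρ ^ 2 + 32 * N * ρ * K')) ≤ lam ^ 2)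
    (hsm2 : ρ * (n ^ 3 * C0 ^ 2 * (2 * ρ + 8 * N * K')) ≤ lam ^ 2 / 8)
    (hL : 2 * C0 + 4 * N * n * Lam < L * lam / (8 * ρ)) (hN : 2 * S < N * ρ ^ 2)
    {x y : Eu n} (hx : x ∈ Metric.closedBall y0 ρ) (hy : y ∈ Metric.closedBall y0 ρ) :
    w x - w y - L * (‖x - y‖ - ‖x - y‖ ^ 2 / (8 * ρ))
      - N * (‖x - y0‖ ^ 2 + ‖y - y0‖ ^ 2) ≤ 0 := by
  by_contra! hpos
  have hK0 : 0 ≤ K' := (norm_nonneg _).trans (hK x hx)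
  let Φ : Eu n × Eu n → ℝ := fun p => w p.1 - w p.2 - L * (‖p.1 - p.2‖ - ‖p.1 - p.2‖ ^ 2 / (8 * ρ))
      - N * (‖p.1 - y0‖ ^ 2 + ‖p.2 - y0‖ ^ 2)
  have hwc : ContinuousOn w (Metric.closedBall y0 ρ) := fun p hp =>
    (hw p hp).continuousAt.continuousWithinAt
  have hΦc : ContinuousOn Φ (Metric.closedBall y0 ρ ×ˢ Metric.closedBall y0 ρ) := by
    have h1 : ContinuousOn (fun p : Eu n × Eu n => w p.1)
        (Metric.closedBall y0 ρ ×ˢ Metric.closedBall y0 ρ) :=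
      hwc.comp continuousOn_fst fun p hp => hp.1
    have h2 : ContinuousOn (fun p : Eu n × Eu n => w p.2)
        (Metric.closedBall y0 ρ ×ˢ Metric.closedBall y0 ρ) :=
      hwc.comp continuousOn_snd fun p hp => hp.2
    refine ((h1.sub h2).sub ?_).sub ?_ <;> fun_prop
  obtain ⟨⟨x₁, y₁⟩, ⟨hx₁, hy₁⟩, hmax⟩ :=
    ((isCompact_closedBall y0 ρ).prod (isCompact_closedBall y0 ρ)).exists_isMaxOn
      ⟨(x, y), hx, hy⟩ hΦc
  have hΦpos : 0 < Φ (x₁, y₁) := hpos.trans_le (hmax (mk_mem_prod hx hy))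
  simp only [Φ] at hΦpos hx₁ hy₁
  have hdx : ‖x₁ - y0‖ ≤ ρ := by simpa [dist_eq_norm] using hx₁
  have hdy : ‖y₁ - y0‖ ≤ ρ := by simpa [dist_eq_norm] using hy₁
  have hr : ‖x₁ - y₁‖ ≤ 2 * ρ := by
    have := norm_sub_le (x₁ - y0) (y₁ - y0)
    rw [sub_sub_sub_cancel_right] at this; linarith
  have hψ : 0 ≤ ‖x₁ - y₁‖ - ‖x₁ - y₁‖ ^ 2 / (8 * ρ) := by
    rw [sub_nonneg, div_le_iff₀ (by positivity)]
    nlinarith [norm_nonneg (x₁ - y₁)]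
  have hLψ := mul_nonneg hL0 hψ
  have hw2 : w x₁ - w y₁ ≤ 2 * S := by
    linarith [(abs_le.mp (hS x₁ hx₁)).2, (abs_le.mp (hS y₁ hy₁)).1]
  have hx₁b : x₁ ∈ Metric.ball y0 ρ := by
    rw [mem_ball_iff_norm]
    refine lt_of_le_of_ne hdx fun h => ?_
    rw [h] at hΦpos
    nlinarith [mul_nonneg hN0 (sq_nonneg ‖y₁ - y0‖)]
  have hy₁b : y₁ ∈ Metric.ball y0 ρ := by
    rw [mem_ball_iff_norm]
    refine lt_of_le_of_ne hdy fun h => ?_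
    rw [h] at hΦpos
    nlinarith [mul_nonneg hN0 (sq_nonneg ‖x₁ - y0‖)]
  have hne : x₁ - y₁ ≠ 0 := fun h => by
    obtain rfl := sub_eq_zero.mp h
    simp only [sub_self, norm_zero] at hΦpos
    have : 0 ≤ N * (‖x₁ - y0‖ ^ 2 + ‖x₁ - y0‖ ^ 2) := by positivity
    norm_num at hΦpos
    linarith
  set z := x₁ - y₁ with hz
  set r := ‖z‖ with hr_def
  have hr0 : 0 < r := norm_pos_iff.mpr hne
  have hjet : ∀ ξ η : Eu n,
      (fderiv ℝ w x₁ ξ - fderiv ℝ w y₁ η - L * (inner ℝ z (ξ - η) / r - 2 * inner ℝ z (ξ - η) / (8 * ρ))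
        - N * (2 * inner ℝ (x₁ - y0) ξ + 2 * inner ℝ (y₁ - y0) η) = 0) ∧
      (fderiv ℝ (fderiv ℝ w) x₁ ξ ξ - fderiv ℝ (fderiv ℝ w) y₁ η η
        - L * (1 / r * (‖ξ - η‖ ^ 2 - (inner ℝ z (ξ - η) / r) ^ 2) - ‖ξ - η‖ ^ 2 / (4 * ρ))
        - 2 * N * (‖ξ‖ ^ 2 + ‖η‖ ^ 2) ≤ 0) := fun ξ η => by
    have j1 := hasJet_line (hw x₁ hx₁) ξ
    have j2 := hasJet_line (hw y₁ hy₁) η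
    have j3 := hasJet_normSq_rpow hne (ξ - η) 1
    have j4 := hasJet_norm_sq z (ξ - η)
    have j5 := hasJet_norm_sq (x₁ - y0) ξ
    have j6 := hasJet_norm_sq (y₁ - y0) η
    have hrp : r ^ ((1 : ℝ) - 2) = 1 / r := by
      rw [show (1 : ℝ) - 2 = -1 by norm_num, Real.rpow_neg_one, one_div]
    rw [← hr_def, hrp] at j3
    have J := ((j1.sub j2).sub ((j3.sub (j4.const_mul (1 / (8 * ρ)))).const_mul L)).sub
      ((j5.add j6).const_mul N)
    have := J.of_isLocalMax ((isLocalMax_line_of_isMaxOn hmax hx₁b hy₁b ξ η).congr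
      (Filter.Eventually.of_forall fun t => ?_))
    · refine ⟨?_, ?_⟩
      · rw [← this.1]; field_simp
      · refine (le_of_eq ?_).trans this.2
        field_simp; ring
    · simp only [Φ, Real.rpow_one]
      have e1 : x₁ + t • ξ - (y₁ + t • η) = z + t • (ξ - η) := by
        rw [hz, smul_sub]; abel
      have e2 : x₁ + t • ξ - y0 = x₁ - y0 + t • ξ := by abel
      have e3 : y₁ + t • η - y0 = y₁ - y0 + t • η := by abel
      rw [e1, e2, e3]; ring
  have hgrad : ‖fderiv ℝ w x₁ - fderiv ℝ w y₁‖ ≤ 2 * N * (‖x₁ - y0‖ + ‖y₁ - y0‖) := by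
    refine ContinuousLinearMap.opNorm_le_bound _ (by positivity) fun ξ => ?_
    have h := (hjet ξ ξ).1
    rw [sub_self, inner_zero_right] at h
    simp only [mul_zero, zero_div, sub_zero] at h
    have h' : (fderiv ℝ w x₁ - fderiv ℝ w y₁) ξ =
        2 * N * inner ℝ ((x₁ - y0) + (y₁ - y0)) ξ := by
      rw [inner_add_left, sub_apply]; linarith
    rw [h', Real.norm_eq_abs, abs_mul, abs_of_nonneg (mul_nonneg zero_le_two hN0)]
    rw [mul_assoc (2 * N) (_ + _)]
    refine mul_le_mul_of_nonneg_left ?_ (mul_nonneg zero_le_two hN0)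
    exact (abs_real_inner_le_norm _ _).trans
      (mul_le_mul_of_nonneg_right (norm_add_le _ _) (norm_nonneg _))
  have hlip : w x₁ - w y₁ ≤ K' * r := by
    have := (convex_closedBall y0 ρ).norm_image_sub_le_of_norm_fderiv_le (𝕜 := ℝ)
      (fun p hp => (hw p hp).differentiableAt (by norm_num)) hK hy₁ hx₁
    exact (le_abs_self _).trans this
  have hNsq : N * (‖x₁ - y0‖ ^ 2 + ‖y₁ - y0‖ ^ 2) ≤ K' * r := by linarith
  obtain ⟨hδl, hqr⟩ := coupling_defect_bounds (Nat.cast_nonneg n) hl hρ hN0 hK0 hr0 hr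
    (norm_nonneg _) hgrad hNsq hsm1 hsm2
  set δ := C0 * (r + ‖fderiv ℝ w x₁ - fderiv ℝ w y₁‖) with hδ
  have hν : ‖r⁻¹ • z‖ = 1 := by
    rw [norm_smul, norm_inv, Real.norm_eq_abs, abs_of_pos hr0, ← hr_def, inv_mul_cancel₀ hr0.ne']
  obtain ⟨ξ, η, hξ, hη, h3, h4⟩ := exists_reflection_coupling hl (hA x₁ hx₁) (hA y₁ hy₁)
    (hAA x₁ hx₁ y₁ hy₁) hδl hν
  have h4' : ∑ k, (inner ℝ z (ξ k - η k) / r) ^ 2 = lam + 2 * ((n * δ) ^ 2 / (4 * lam)) := by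
    rw [← h4]
    refine Finset.sum_congr rfl fun k _ => ?_
    rw [real_inner_smul_left]; ring
  set q := (n * δ) ^ 2 / (4 * lam) with hq
  have hsum := Finset.sum_nonpos fun k (_ : k ∈ Finset.univ) => (hjet (ξ k) (η k)).2
  simp only [Finset.sum_sub_distrib, Finset.sum_add_distrib, ← Finset.mul_sum, ← Finset.sum_div,
    sum_bilin_eq_trHess hξ, sum_bilin_eq_trHess hη, h3, h4', sum_norm_sq_eq hξ,
    sum_norm_sq_eq hη] at hsum
  have t1 := (abs_le.mp (hQ x₁ hx₁)).1
  have t2 := (abs_le.mp (hQ y₁ hy₁)).2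
  have t3 := (hA x₁ hx₁).trace_le
  have t4 := (hA y₁ hy₁).trace_le
  have hq0 : 0 ≤ q := by positivity
  exact coupling_contradiction hρ hr0 hN0 hL0 (Nat.cast_nonneg n) hq0 t1 t2 t3 t4 hqr hL hsum

/-- Interior gradient estimate in terms of the oscillation. -/
theorem exists_gradient_bound (n : ℕ) {lam Lam C0 K' : ℝ} (hl : 0 < lam) (hLam : 0 ≤ Lam)
    (hC0 : 0 ≤ C0) (hK' : 0 ≤ K') :
    ∃ C > 0, ∀ (w : Eu n → ℝ) (A : Eu n → Matrix (Fin n) (Fin n) ℝ) (y0 : Eu n) (ρ S : ℝ),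
      0 < ρ → (∀ x ∈ Metric.closedBall y0 ρ, ContDiffAt ℝ 2 w x) →
      (∀ x ∈ Metric.closedBall y0 ρ, EllipticMatrix lam Lam (A x)) →
      (∀ x ∈ Metric.closedBall y0 ρ, ∀ y ∈ Metric.closedBall y0 ρ, ∀ i j,
        |A x i j - A y i j| ≤ C0 * (‖x - y‖ + ‖fderiv ℝ w x - fderiv ℝ w y‖)) →
      (∀ x ∈ Metric.closedBall y0 ρ, |trHess (A x) (fderiv ℝ (fderiv ℝ w) x)| ≤ C0) →
      (∀ x ∈ Metric.closedBall y0 ρ, ‖fderiv ℝ w x‖ ≤ K') →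
      (∀ x ∈ Metric.closedBall y0 ρ, |w x| ≤ S) →
      ‖fderiv ℝ w y0‖ ≤ C * (S / ρ + ρ) := by
  set B1 : ℝ := n ^ 2 * C0 ^ 2 * (8 + 32 * K') + 1 with hB1
  set B2 : ℝ := n ^ 3 * C0 ^ 2 * (2 + 8 * K') + 1 with hB2
  have hB1p : 0 < B1 := by positivity
  have hB2p : 0 < B2 := by positivity
  set ε : ℝ := min 1 (min (lam ^ 2 / (2 * B1)) (lam ^ 2 / (16 * B2))) with hε
  have hεp : 0 < ε := by positivity
  have hε1 : ε ≤ 1 := min_le_left _ _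
  have hε2 : 2 * B1 * ε ≤ lam ^ 2 := by
    have : ε ≤ lam ^ 2 / (2 * B1) := (min_le_right _ _).trans (min_le_left _ _)
    rwa [le_div_iff₀ (by positivity), mul_comm] at this
  have hε3 : 16 * B2 * ε ≤ lam ^ 2 := by
    have : ε ≤ lam ^ 2 / (16 * B2) := (min_le_right _ _).trans (min_le_right _ _)
    rwa [le_div_iff₀ (by positivity), mul_comm] at this
  set C1 : ℝ := 8 * (2 * C0 + 4 * n * Lam + 1) / lam with hC1
  have hC1p : 0 < C1 := by positivity
  refine ⟨2 * C1 + K' / ε, by positivity, fun w A y0 ρ S hρ hw hA hAA hQ hK hS => ?_⟩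
  have hy0 : y0 ∈ Metric.closedBall y0 ρ := Metric.mem_closedBall_self hρ.le
  have hS0 : 0 ≤ S := (abs_nonneg _).trans (hS y0 hy0)
  have hX : 0 < S / ρ + ρ := by positivity
  rcases le_or_gt ε (S / ρ + ρ) with h | h
  · refine (hK y0 hy0).trans ?_
    have : K' ≤ K' / ε * (S / ρ + ρ) := by
      rw [div_mul_eq_mul_div, le_div_iff₀ hεp]
      gcongr
    nlinarith
  have hSρ : 0 ≤ S / ρ := by positivity
  have hρ1 : ρ ≤ 1 := by linarith
  set N : ℝ := 2 * S / ρ ^ 2 + 1 with hN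
  have hNp : 1 ≤ N := by rw [hN]; linarith [show 0 ≤ 2 * S / ρ ^ 2 by positivity]
  have hNρ : N * ρ = 2 * (S / ρ) + ρ := by rw [hN]; field_simp
  have hNρ' : ρ ^ 2 + N * ρ ≤ 2 * (S / ρ + ρ) := by nlinarith
  have hmain : ∀ x ∈ Metric.closedBall y0 ρ, _ := fun x hx =>
    doubling_le_of_small (L := C1 * (N * ρ)) (S := S) (N := N) hl hρ (by linarith)
    (by positivity) hw hA hAA hQ hK hS ?_ ?_ ?_ ?_ hx hy0
  · have hC : ‖fderiv ℝ w y0‖ ≤ C1 * (N * ρ) := by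
      refine norm_fderiv_le_of_growth (N := N) hρ (by positivity)
        ((hw y0 hy0).differentiableAt (by norm_num)) fun x hx => ?_
      have := hmain x hx
      simp only [sub_self, norm_zero] at this
      have h2 : 0 ≤ C1 * (N * ρ) * (‖x - y0‖ ^ 2 / (8 * ρ)) := by positivity
      norm_num at this
      linarith
    refine hC.trans ?_
    have : 0 ≤ K' / ε * (S / ρ + ρ) := by positivity
    nlinarith
  · have h1 : 8 * ρ ^ 2 + 32 * N * ρ * K' ≤ (8 + 32 * K') * (ρ ^ 2 + N * ρ) := by
      nlinarith [sq_nonneg ρ, mul_nonneg hK' (sq_nonneg ρ), mul_nonneg (zero_le_one.trans hNp) hρ.le]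
    have h2 : (n : ℝ) ^ 2 * (C0 ^ 2 * (8 * ρ ^ 2 + 32 * N * ρ * K')) ≤
        n ^ 2 * (C0 ^ 2 * ((8 + 32 * K') * (2 * ε))) := by
      gcongr; exact h1.trans (by gcongr; linarith)
    refine h2.trans (le_trans ?_ hε2)
    nlinarith
  · have h1 : ρ * (2 * ρ + 8 * N * K') ≤ (2 + 8 * K') * (2 * ε) := by
      have : ρ * (2 * ρ + 8 * N * K') ≤ (2 + 8 * K') * (ρ ^ 2 + N * ρ) := by
        nlinarith [sq_nonneg ρ, mul_nonneg hK' (sq_nonneg ρ), mul_nonneg (zero_le_one.trans hNp) hρ.le]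
      exact this.trans (by gcongr; linarith)
    have h2 : ρ * ((n : ℝ) ^ 3 * C0 ^ 2 * (2 * ρ + 8 * N * K')) ≤
        n ^ 3 * C0 ^ 2 * ((2 + 8 * K') * (2 * ε)) := by
      calc _ = (n : ℝ) ^ 3 * C0 ^ 2 * (ρ * (2 * ρ + 8 * N * K')) := by ring
        _ ≤ _ := by gcongr
    nlinarith
  · have : C1 * (N * ρ) * lam / (8 * ρ) = N * (2 * C0 + 4 * n * Lam + 1) := by
      rw [hC1]; field_simp
    rw [this]
    have : 2 * C0 ≤ N * (2 * C0) := le_mul_of_one_le_left (by positivity) hNp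
    linarith
  · rw [hN, add_mul, div_mul_cancel₀ _ (by positivity)]
    nlinarith [sq_pos_of_pos hρ]

end

theorem pointwise_absorption {lam C0 Γ β ε0 D X : ℝ} (hl : 0 < lam) (hC0 : 0 < C0) (hβ : 0 < β)
    (hε0 : 0 ≤ ε0) (hD : 64 * C0 ≤ lam * D) (hβ1 : 128 * C0 ^ 2 * β ≤ lam ^ 2)
    (hε1 : 16 * C0 * ε0 ≤ lam) (hε2 : 2 * Γ * ε0 ≤ C0) (hβD : 32 ≤ β * D ^ 2) (hX : 0 ≤ X) :
    2 * C0 * (1 + X) * (β * D + ε0 * X) + 4 * β * D * ε0 * Γ * X + 2 * C0 * ε0 * (1 + X) ^ 2 +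
      β * lam * D ^ 2 / 64 < β * lam * D ^ 2 / 8 + 2 * lam * X ^ 2 := by
  have hDp : 0 < D := by
    by_contra! h
    nlinarith
  have h1 : 2 * C0 * (β * D) ≤ β * lam * D ^ 2 / 32 := by
    have := mul_le_mul_of_nonneg_left hD (mul_pos hβ hDp).le
    nlinarith
  have h2 : 2 * C0 * X * (β * D) ≤ lam * X ^ 2 / 2 + β * lam * D ^ 2 / 64 := by
    have a : (2 * C0 * (β * D)) ^ 2 ≤ 2 * lam * (β * lam * D ^ 2 / 64) := by
      have := mul_le_mul_of_nonneg_left hβ1 (mul_nonneg hβ.le (sq_nonneg D))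
      nlinarith
    have b := sq_nonneg (lam * X - 2 * C0 * (β * D))
    have c : 0 ≤ 2 * lam * (lam * X ^ 2 / 2 + β * lam * D ^ 2 / 64 - 2 * C0 * X * (β * D)) := by
      nlinarith
    have := nonneg_of_mul_nonneg_right c (by positivity)
    linarith
  have h3 : 4 * β * D * ε0 * Γ * X ≤ 2 * C0 * X * (β * D) := by
    have := mul_le_mul_of_nonneg_left hε2 (mul_nonneg (mul_pos hβ hDp).le hX)
    nlinarith
  have h4 : 2 * C0 * (1 + X) * (ε0 * X) + 2 * C0 * ε0 * (1 + X) ^ 2 ≤ lam / 2 * (1 + X ^ 2) := by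
    have a : 0 ≤ C0 * ε0 := by positivity
    have b : 2 * C0 * (1 + X) * (ε0 * X) + 2 * C0 * ε0 * (1 + X) ^ 2 ≤
        8 * (C0 * ε0) * (1 + X ^ 2) := by
      have : (1 + X) * X + (1 + X) ^ 2 ≤ 4 * (1 + X ^ 2) := by nlinarith [sq_nonneg (X - 1)]
      have := mul_le_mul_of_nonneg_left this a
      nlinarith
    nlinarith [sq_nonneg X]
  have h5 : lam / 2 ≤ β * lam * D ^ 2 / 64 := by nlinarith
  have h6 : 0 < β * lam * D ^ 2 := by positivity
  nlinarith [mul_nonneg hl.le (sq_nonneg X)]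

theorem holder_doubling_contradiction {lam C0 Γ β ε0 D X Y m N R Gx Gy αx αy s2 g W Hx Hy Bx By τ : ℝ}
    (hl : 0 < lam) (hC0 : 0 < C0) (hβ : 0 < β)
    (hε0 : 0 ≤ ε0) (hD : 64 * C0 ≤ lam * D) (hβ1 : 128 * C0 ^ 2 * β ≤ lam ^ 2)
    (hε1 : 16 * C0 * ε0 ≤ lam) (hε2 : 2 * Γ * ε0 ≤ C0) (hβD : 32 ≤ β * D ^ 2) (hX : 0 ≤ X)
    (hY : 0 ≤ Y) (hm : 0 < m)
    (hGx : Gx ≤ m * β * D + 2 * m * ε0 * X + 2 * N * R)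
    (hGy : Gy ≤ m * β * D + 2 * m * ε0 * Y + 2 * N * R)
    (hNR : 1 + 2 * N * R ≤ m * β * D) (hτ : τ ≤ m * (β * lam * D ^ 2 / 32))
    (hαx : -(C0 * (1 + X) * (1 + Gx)) ≤ αx) (hαy : αy ≤ C0 * (1 + Y) * (1 + Gy))
    (hs2 : s2 ≤ -(m * β * D ^ 2 * lam / 2)) (hg : g ≤ 1 / 2)
    (hW : -(2 * m * β * D * ε0 * Γ * (X + Y)) ≤ W)
    (hHx : lam * X ^ 2 ≤ Hx) (hHy : lam * Y ^ 2 ≤ Hy)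
    (hBx : -(C0 * ε0 * (1 + X) ^ 2) ≤ Bx) (hBy : -(C0 * ε0 * (1 + Y) ^ 2) ≤ By)
    (hsum : αx - αy - (s2 * (1 - g) - 2 * W - m * (2 * (Hx + Bx) + 2 * (Hy + By))) - τ ≤ 0) :
    False := by
  have kx := mul_lt_mul_of_pos_left (pointwise_absorption hl hC0 hβ hε0 hD hβ1 hε1 hε2 hβD hX) hm
  have ky := mul_lt_mul_of_pos_left (pointwise_absorption hl hC0 hβ hε0 hD hβ1 hε1 hε2 hβD hY) hm
  have ax : C0 * (1 + X) * (1 + Gx) ≤ C0 * (1 + X) * (2 * (m * β * D) + 2 * m * ε0 * X) := by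
    refine mul_le_mul_of_nonneg_left (by linarith) (by positivity)
  have ay : C0 * (1 + Y) * (1 + Gy) ≤ C0 * (1 + Y) * (2 * (m * β * D) + 2 * m * ε0 * Y) := by
    refine mul_le_mul_of_nonneg_left (by linarith) (by positivity)
  have a2 : s2 * (1 - g) ≤ -(m * β * D ^ 2 * lam / 4) := by
    have : 0 ≤ m * β * D ^ 2 * lam := by positivity
    nlinarith
  have a4 : m * (2 * (lam * X ^ 2 - C0 * ε0 * (1 + X) ^ 2) + 2 * (lam * Y ^ 2 - C0 * ε0 * (1 + Y) ^ 2))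
      ≤ m * (2 * (Hx + Bx) + 2 * (Hy + By)) :=
    mul_le_mul_of_nonneg_left (by linarith) hm.le
  linarith

section

variable {n : ℕ}

theorem norm_sum_smul_le (c : Eu n) (l : Fin n → Eu n →L[ℝ] ℝ) :
    ‖∑ i, c i • l i‖ ≤ ‖c‖ * √(∑ i, ‖l i‖ ^ 2) := by
  calc ‖∑ i, c i • l i‖ ≤ ∑ i, |c i| * ‖l i‖ :=
        (norm_sum_le _ _).trans_eq (Finset.sum_congr rfl fun i _ => norm_smul _ _)
    _ ≤ √(∑ i, |c i| ^ 2) * √(∑ i, ‖l i‖ ^ 2) := Real.sum_mul_le_sqrt_mul_sqrt _ _ _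
    _ = _ := by rw [EuclideanSpace.norm_eq]; simp

theorem hasJet_sum_sq {v : Fin n → Eu n → ℝ} {x : Eu n} (hv : ∀ i, ContDiffAt ℝ 2 (v i) x)
    (ξ : Eu n) : HasJet (fun t : ℝ => ∑ i, v i (x + t • ξ) ^ 2)
      (2 * ∑ i, v i x * fderiv ℝ (v i) x ξ)
      (2 * (∑ i, fderiv ℝ (v i) x ξ ^ 2 + ∑ i, v i x * fderiv ℝ (fderiv ℝ (v i)) x ξ ξ)) := by
  refine (HasJet.sum Finset.univ fun i _ =>
    (hasJet_line (hv i) ξ).mul (hasJet_line (hv i) ξ)).congr (fun t => ?_) ?_ ?_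
  · exact Finset.sum_congr rfl fun i _ => sq _
  · rw [Finset.mul_sum]
    exact Finset.sum_congr rfl fun i _ => by simp only [zero_smul, add_zero]; ring
  · rw [← Finset.sum_add_distrib, Finset.mul_sum]
    exact Finset.sum_congr rfl fun i _ => by simp only [zero_smul, add_zero]; ring

/-- The jet of the doubled functional used for the Hölder estimate. -/
theorem hasJet_doubling {v : Fin n → Eu n → ℝ} {x y y0 : Eu n} (hx : ∀ i, ContDiffAt ℝ 2 (v i) x)
    (hy : ∀ i, ContDiffAt ℝ 2 (v i) y) (hne : x - y ≠ 0) (e : Eu n) (M N β : ℝ) (ξ η : Eu n) :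
    HasJet (fun t : ℝ => ∑ i, e i * v i (x + t • ξ) - ∑ i, e i * v i (y + t • η)
        - M * (‖(x + t • ξ) - (y + t • η)‖ ^ β *
          (1 - (∑ i, v i (x + t • ξ) ^ 2 + ∑ i, v i (y + t • η) ^ 2)))
        - N * (‖x + t • ξ - y0‖ ^ 2 + ‖y + t • η - y0‖ ^ 2))
      (∑ i, e i * fderiv ℝ (v i) x ξ - ∑ i, e i * fderiv ℝ (v i) y η
        - M * (β * ‖x - y‖ ^ (β - 2) * inner ℝ (x - y) (ξ - η) *
            (1 - (∑ i, v i x ^ 2 + ∑ i, v i y ^ 2))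
          - ‖x - y‖ ^ β * (2 * (∑ i, v i x * fderiv ℝ (v i) x ξ + ∑ i, v i y * fderiv ℝ (v i) y η)))
        - 2 * N * (inner ℝ (x - y0) ξ + inner ℝ (y - y0) η))
      (∑ i, e i * fderiv ℝ (fderiv ℝ (v i)) x ξ ξ - ∑ i, e i * fderiv ℝ (fderiv ℝ (v i)) y η η
        - M * (β * ‖x - y‖ ^ (β - 2) *
              ((β - 2) * (inner ℝ (x - y) (ξ - η) / ‖x - y‖) ^ 2 + ‖ξ - η‖ ^ 2) *
            (1 - (∑ i, v i x ^ 2 + ∑ i, v i y ^ 2))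
          - 2 * (β * ‖x - y‖ ^ (β - 2) * inner ℝ (x - y) (ξ - η) *
            (2 * (∑ i, v i x * fderiv ℝ (v i) x ξ + ∑ i, v i y * fderiv ℝ (v i) y η)))
          - ‖x - y‖ ^ β *
            (2 * (∑ i, fderiv ℝ (v i) x ξ ^ 2 + ∑ i, v i x * fderiv ℝ (fderiv ℝ (v i)) x ξ ξ) +
             2 * (∑ i, fderiv ℝ (v i) y η ^ 2 + ∑ i, v i y * fderiv ℝ (fderiv ℝ (v i)) y η η)))
        - 2 * N * (‖ξ‖ ^ 2 + ‖η‖ ^ 2)) := by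
  have j1 := HasJet.sum Finset.univ fun i (_ : i ∈ Finset.univ) =>
    (hasJet_line (hx i) ξ).const_mul (e i)
  have j2 := HasJet.sum Finset.univ fun i (_ : i ∈ Finset.univ) =>
    (hasJet_line (hy i) η).const_mul (e i)
  have j3 := hasJet_normSq_rpow hne (ξ - η) β
  have j4 := (HasJet.const 1).sub ((hasJet_sum_sq hx ξ).add (hasJet_sum_sq hy η))
  have j5 := hasJet_norm_sq (x - y0) ξ
  have j6 := hasJet_norm_sq (y - y0) η
  refine (((j1.sub j2).sub ((j3.mul j4).const_mul M)).sub ((j5.add j6).const_mul N)).congr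
    (fun t => ?_) ?_ ?_
  · have e1 : x + t • ξ - (y + t • η) = (x - y) + t • (ξ - η) := by rw [smul_sub]; abel
    have e2 : x + t • ξ - y0 = x - y0 + t • ξ := by abel
    have e3 : y + t • η - y0 = y - y0 + t • η := by abel
    rw [e1, e2, e3]
  · simp only [zero_smul, add_zero]; ring
  · simp only [zero_smul, add_zero]; ring

end

section

variable {n : ℕ}

/-- Cross terms between the coupling difference and the gradients. -/
theorem abs_sum_cross_le {lam Lam q X Y ε0 : ℝ} (hLam : 0 ≤ Lam) (hq : 2 * q ≤ lam)
    {κ : Type*} [Fintype κ] {A₁ A₂ : Matrix (Fin n) (Fin n) ℝ} (h₁ : EllipticMatrix lam Lam A₁)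
    (h₂ : EllipticMatrix lam Lam A₂) {ξ η : κ → Eu n} (hξ : ∀ i j, ∑ k, ξ k i * ξ k j = A₁ i j)
    (hη : ∀ i j, ∑ k, η k i * η k j = A₂ i j) {s : κ → ℝ} (hs : ∑ k, s k ^ 2 = lam + 2 * q)
    {l₁ l₂ : Eu n →L[ℝ] ℝ} (hX : 0 ≤ ε0 * X) (hY : 0 ≤ ε0 * Y) (hl₁ : ‖l₁‖ ≤ ε0 * X)
    (hl₂ : ‖l₂‖ ≤ ε0 * Y) :
    -(ε0 * (lam + n * Lam) * (X + Y)) ≤ ∑ k, s k * (l₁ (ξ k) + l₂ (η k)) := by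
  have key : ∀ {A : Matrix (Fin n) (Fin n) ℝ} (_ : EllipticMatrix lam Lam A) {ξ : κ → Eu n}
      (_ : ∀ i j, ∑ k, ξ k i * ξ k j = A i j) {l : Eu n →L[ℝ] ℝ} {Z : ℝ} (_ : 0 ≤ Z) (_ : ‖l‖ ≤ Z),
      -(Z * (lam + n * Lam)) ≤ ∑ k, s k * l (ξ k) := by
    intro A hA ξ hξ l Z hZ hl
    have h1 : ∀ k, -(Z * ((s k ^ 2 + ‖ξ k‖ ^ 2) / 2)) ≤ s k * l (ξ k) := fun k => by
      have a1 : |l (ξ k)| ≤ Z * ‖ξ k‖ :=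
        (l.le_opNorm _).trans (mul_le_mul_of_nonneg_right hl (norm_nonneg _))
      have a2 : |s k * l (ξ k)| ≤ |s k| * (Z * ‖ξ k‖) := by
        rw [abs_mul]; exact mul_le_mul_of_nonneg_left a1 (abs_nonneg _)
      have a3 : |s k| * ‖ξ k‖ ≤ (s k ^ 2 + ‖ξ k‖ ^ 2) / 2 := by
        nlinarith [sq_nonneg (|s k| - ‖ξ k‖), sq_abs (s k)]
      have a4 := mul_le_mul_of_nonneg_left a3 hZ
      have := neg_abs_le (s k * l (ξ k))
      linarith
    refine le_trans ?_ (Finset.sum_le_sum fun k _ => h1 k)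
    rw [Finset.sum_neg_distrib, ← Finset.mul_sum, ← Finset.sum_div, Finset.sum_add_distrib, hs,
      sum_norm_sq_eq hξ]
    refine neg_le_neg (mul_le_mul_of_nonneg_left ?_ hZ)
    have h2 := hA.trace_le
    have h3 : 0 ≤ n * Lam := mul_nonneg (Nat.cast_nonneg _) hLam
    linarith
  have := key h₁ hξ hX hl₁
  have := key h₂ hη hY hl₂
  simp only [mul_add, Finset.sum_add_distrib]
  linarith

theorem norm_clm_le_of_eq {l q : Eu n →L[ℝ] ℝ} {z p : Eu n} {c₁ c₂ c₃ : ℝ}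
    (h : ∀ ξ, l ξ = c₁ * inner ℝ z ξ + c₂ * q ξ + c₃ * inner ℝ p ξ) :
    ‖l‖ ≤ |c₁| * ‖z‖ + |c₂| * ‖q‖ + |c₃| * ‖p‖ := by
  refine ContinuousLinearMap.opNorm_le_bound _ (by positivity) fun ξ => ?_
  rw [h, Real.norm_eq_abs]
  have h1 : |c₁ * inner ℝ z ξ| ≤ |c₁| * (‖z‖ * ‖ξ‖) := by
    rw [abs_mul]; exact mul_le_mul_of_nonneg_left (abs_real_inner_le_norm _ _) (abs_nonneg _)
  have h2 : |c₂ * q ξ| ≤ |c₂| * (‖q‖ * ‖ξ‖) := by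
    rw [abs_mul]; exact mul_le_mul_of_nonneg_left (q.le_opNorm _) (abs_nonneg _)
  have h3 : |c₃ * inner ℝ p ξ| ≤ |c₃| * (‖p‖ * ‖ξ‖) := by
    rw [abs_mul]; exact mul_le_mul_of_nonneg_left (abs_real_inner_le_norm _ _) (abs_nonneg _)
  have := abs_add_three (c₁ * inner ℝ z ξ) (c₂ * q ξ) (c₃ * inner ℝ p ξ)
  linarith

set_option maxHeartbeats 1000000 in
theorem holder_doubling_le {lam Lam C0 β ε0 e0 R M N : ℝ} (hl : 0 < lam) (hLam : 0 ≤ Lam)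
    (hC0 : 0 < C0) (hβ : 0 < β) (hβ4 : β ≤ 1 / 4) (hβ1 : 128 * C0 ^ 2 * β ≤ lam ^ 2)
    (hε0 : 0 ≤ ε0) (hε4 : ε0 ≤ 1 / 4) (hε1 : 16 * C0 * ε0 ≤ lam)
    (hε2 : 2 * (lam + n * Lam) * ε0 ≤ C0)
    (he0 : n * e0 ≤ lam) (hq1 : 2 * ((n * e0) ^ 2 / (4 * lam)) ≤ lam)
    (hq2 : (n * e0) ^ 2 / (4 * lam) * n ≤ lam / 8)
    (hR : 0 < R) (hR1 : 2 * R ≤ 1) (hR2 : 64 * C0 * (2 * R) ≤ lam) (hR3 : 32 * (2 * R) ^ 2 ≤ β)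
    (hN0 : 0 ≤ N) (hN : 2 * ε0 < N * R ^ 2) (hM0 : 0 < M) (hM1 : 1 + 2 * N * R ≤ M * β)
    (hM2 : 2 * N * (n * Lam + n * Lam) ≤ M * (β * lam / 32))
    {v : Fin n → Eu n → ℝ} {A : Eu n → Matrix (Fin n) (Fin n) ℝ} {y0 : Eu n}
    (hv : ∀ x ∈ Metric.closedBall y0 R, ∀ i, ContDiffAt ℝ 2 (v i) x)
    (hA : ∀ x ∈ Metric.closedBall y0 R, EllipticMatrix lam Lam (A x))
    (hAA : ∀ x ∈ Metric.closedBall y0 R, ∀ y ∈ Metric.closedBall y0 R, ∀ i j,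
      |A x i j - A y i j| ≤ e0)
    (hQ : ∀ x ∈ Metric.closedBall y0 R, ∀ c : Eu n,
      |∑ i, c i * trHess (A x) (fderiv ℝ (fderiv ℝ (v i)) x)| ≤
        C0 * (1 + √(∑ i, ‖fderiv ℝ (v i) x‖ ^ 2)) * (‖c‖ + ‖∑ i, c i • fderiv ℝ (v i) x‖))
    (hε : ∀ x ∈ Metric.closedBall y0 R, ∑ i, v i x ^ 2 ≤ ε0 ^ 2)
    {e : Eu n} (he : ‖e‖ ≤ 1)
    {x y : Eu n} (hx : x ∈ Metric.closedBall y0 R) (hy : y ∈ Metric.closedBall y0 R) :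
    ∑ i, e i * v i x - ∑ i, e i * v i y
      - M * (‖x - y‖ ^ β * (1 - (∑ i, v i x ^ 2 + ∑ i, v i y ^ 2)))
      - N * (‖x - y0‖ ^ 2 + ‖y - y0‖ ^ 2) ≤ 0 := by
  by_contra! hpos
  let Φ : Eu n × Eu n → ℝ := fun p => ∑ i, e i * v i p.1 - ∑ i, e i * v i p.2
      - M * (‖p.1 - p.2‖ ^ β * (1 - (∑ i, v i p.1 ^ 2 + ∑ i, v i p.2 ^ 2)))
      - N * (‖p.1 - y0‖ ^ 2 + ‖p.2 - y0‖ ^ 2)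
  have hΦc : ContinuousOn Φ (Metric.closedBall y0 R ×ˢ Metric.closedBall y0 R) := by
    have h1 : ∀ i, ContinuousOn (fun p : Eu n × Eu n => v i p.1)
        (Metric.closedBall y0 R ×ˢ Metric.closedBall y0 R) := fun i =>
      ContinuousOn.comp (t := Metric.closedBall y0 R)
        (fun p hp => (hv p hp i).continuousAt.continuousWithinAt) continuousOn_fst fun p hp => hp.1
    have h2 : ∀ i, ContinuousOn (fun p : Eu n × Eu n => v i p.2)
        (Metric.closedBall y0 R ×ˢ Metric.closedBall y0 R) := fun i =>
      ContinuousOn.comp (t := Metric.closedBall y0 R)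
        (fun p hp => (hv p hp i).continuousAt.continuousWithinAt) continuousOn_snd fun p hp => hp.2
    have h3 : ContinuousOn (fun p : Eu n × Eu n => ‖p.1 - p.2‖ ^ β)
        (Metric.closedBall y0 R ×ˢ Metric.closedBall y0 R) :=
      (Continuous.rpow_const (by fun_prop) fun _ => Or.inr hβ.le).continuousOn
    refine ContinuousOn.sub (ContinuousOn.sub (ContinuousOn.sub ?_ ?_) ?_) (by fun_prop)
    · exact continuousOn_finsetSum _ fun i _ => continuousOn_const.mul (h1 i)
    · exact continuousOn_finsetSum _ fun i _ => continuousOn_const.mul (h2 i)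
    · refine continuousOn_const.mul (h3.mul (continuousOn_const.sub (ContinuousOn.add ?_ ?_)))
      · exact continuousOn_finsetSum _ fun i _ => (h1 i).pow 2
      · exact continuousOn_finsetSum _ fun i _ => (h2 i).pow 2
  obtain ⟨⟨x₁, y₁⟩, ⟨hx₁, hy₁⟩, hmax⟩ :=
    ((isCompact_closedBall y0 R).prod (isCompact_closedBall y0 R)).exists_isMaxOn
      ⟨(x, y), hx, hy⟩ hΦc
  have hΦpos : 0 < Φ (x₁, y₁) := hpos.trans_le (hmax (mk_mem_prod hx hy))
  simp only [Φ] at hΦpos hx₁ hy₁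
  have hdx : ‖x₁ - y0‖ ≤ R := by simpa [dist_eq_norm] using hx₁
  have hdy : ‖y₁ - y0‖ ≤ R := by simpa [dist_eq_norm] using hy₁
  have hr : ‖x₁ - y₁‖ ≤ 2 * R := by
    have := norm_sub_le (x₁ - y0) (y₁ - y0)
    rw [sub_sub_sub_cancel_right] at this; linarith
  have hvn : ∀ p ∈ Metric.closedBall y0 R, ‖(WithLp.toLp 2 fun i => v i p : Eu n)‖ ≤ ε0 :=
    fun p hp => by
      refine abs_le_of_sq_le_sq' ?_ hε0 |>.2
      rw [EuclideanSpace.norm_sq_eq]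
      simpa using hε p hp
  have hfb : ∀ p ∈ Metric.closedBall y0 R, |∑ i, e i * v i p| ≤ ε0 := fun p hp => by
    have h1 : ∑ i, e i * v i p = inner ℝ (WithLp.toLp 2 fun i => v i p : Eu n) e := by
      rw [PiLp.inner_apply]; simp
    rw [h1]
    refine (abs_real_inner_le_norm _ _).trans ?_
    calc _ ≤ ε0 * 1 := mul_le_mul (hvn p hp) he (norm_nonneg _) hε0
      _ = ε0 := mul_one _
  have hgb : ∑ i, v i x₁ ^ 2 + ∑ i, v i y₁ ^ 2 ≤ 1 / 2 := by
    have := hε x₁ hx₁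
    have := hε y₁ hy₁
    nlinarith
  have hg0 : 0 ≤ ∑ i, v i x₁ ^ 2 + ∑ i, v i y₁ ^ 2 := by positivity
  have hpen : 0 ≤ M * (‖x₁ - y₁‖ ^ β * (1 - (∑ i, v i x₁ ^ 2 + ∑ i, v i y₁ ^ 2))) :=
    mul_nonneg hM0.le (mul_nonneg (by positivity) (by linarith))
  have hw2 : ∑ i, e i * v i x₁ - ∑ i, e i * v i y₁ ≤ 2 * ε0 := by
    linarith [(abs_le.mp (hfb x₁ hx₁)).2, (abs_le.mp (hfb y₁ hy₁)).1]
  have hx₁b : x₁ ∈ Metric.ball y0 R := by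
    rw [mem_ball_iff_norm]
    refine lt_of_le_of_ne hdx fun h => ?_
    rw [h] at hΦpos
    have := mul_nonneg hN0 (sq_nonneg ‖y₁ - y0‖)
    linarith
  have hy₁b : y₁ ∈ Metric.ball y0 R := by
    rw [mem_ball_iff_norm]
    refine lt_of_le_of_ne hdy fun h => ?_
    rw [h] at hΦpos
    have := mul_nonneg hN0 (sq_nonneg ‖x₁ - y0‖)
    linarith
  have hne : x₁ - y₁ ≠ 0 := fun h => by
    obtain rfl := sub_eq_zero.mp h
    have : 0 ≤ N * (‖x₁ - y0‖ ^ 2 + ‖x₁ - y0‖ ^ 2) := by positivity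
    linarith
  have hjet := fun ξ η : Eu n =>
    (hasJet_doubling (y0 := y0) (hv x₁ hx₁) (hv y₁ hy₁) hne e M N β ξ η).of_isLocalMax
    (isLocalMax_line_of_isMaxOn hmax hx₁b hy₁b ξ η)
  clear hmax hΦc hpos hΦpos hpen
  clear Φ
  set z := x₁ - y₁ with hz
  set r := ‖z‖ with hr_def
  set g := ∑ i, v i x₁ ^ 2 + ∑ i, v i y₁ ^ 2 with hg
  have hr0 : 0 < r := norm_pos_iff.mpr hne
  have hr1 : r ≤ 1 := hr.trans hR1
  have hp0 : 0 < r ^ β := Real.rpow_pos_of_pos hr0 β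
  have hp2 : r ^ (β - 2) = r ^ β * (1 / r) ^ 2 := by
    rw [Real.rpow_sub hr0]; norm_num; field_simp
  have hpD : 1 ≤ r ^ β * (1 / r) := by
    have h1 : r ^ (β - 1) = r ^ β * (1 / r) := by
      rw [Real.rpow_sub hr0]; norm_num; field_simp
    rw [← h1]
    exact Real.one_le_rpow_of_pos_of_le_one_of_nonpos hr0 hr1 (by linarith)
  have hD1 : 1 ≤ 1 / r := by rw [le_div_iff₀ hr0]; linarith
  set D := 1 / r with hD
  have hDr : D * r = 1 := by rw [hD]; field_simp
  have hD0 : 0 < D := by positivity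
  have hpD2 : 1 ≤ r ^ β * D ^ 2 := by
    calc (1 : ℝ) ≤ r ^ β * D * D := one_le_mul_of_one_le_of_one_le hpD hD1
      _ = _ := by ring
  set m := M * r ^ β with hm
  have hm0 : 0 < m := by positivity
  set qx : Eu n →L[ℝ] ℝ := ∑ i, v i x₁ • fderiv ℝ (v i) x₁ with hqx
  set qy : Eu n →L[ℝ] ℝ := ∑ i, v i y₁ • fderiv ℝ (v i) y₁ with hqy
  have hqxa : ∀ ξ, ∑ i, v i x₁ * fderiv ℝ (v i) x₁ ξ = qx ξ := fun ξ => by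
    rw [hqx, sum_apply]; simp
  have hqya : ∀ ξ, ∑ i, v i y₁ * fderiv ℝ (v i) y₁ ξ = qy ξ := fun ξ => by
    rw [hqy, sum_apply]; simp
  have hPa : ∀ p ξ, ∑ i, e i * fderiv ℝ (v i) p ξ = (∑ i, e i • fderiv ℝ (v i) p) ξ := fun p ξ => by
    rw [sum_apply]; simp
  simp only [hqxa, hqya, hPa] at hjet
  set X := √(∑ i, ‖fderiv ℝ (v i) x₁‖ ^ 2) with hX
  set Y := √(∑ i, ‖fderiv ℝ (v i) y₁‖ ^ 2) with hY
  have hX0 : 0 ≤ X := Real.sqrt_nonneg _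
  have hY0 : 0 ≤ Y := Real.sqrt_nonneg _
  have hqxn : ‖qx‖ ≤ ε0 * X :=
    (norm_sum_smul_le (WithLp.toLp 2 fun i => v i x₁) _).trans
      (mul_le_mul_of_nonneg_right (hvn x₁ hx₁) hX0)
  have hqyn : ‖qy‖ ≤ ε0 * Y :=
    (norm_sum_smul_le (WithLp.toLp 2 fun i => v i y₁) _).trans
      (mul_le_mul_of_nonneg_right (hvn y₁ hy₁) hY0)
  have hc1 : |m * β * D ^ 2 * (1 - g)| * r ≤ m * β * D := by
    rw [abs_of_nonneg (mul_nonneg (by positivity) (by linarith))]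
    calc m * β * D ^ 2 * (1 - g) * r = m * β * D * (1 - g) * (D * r) := by ring
      _ = m * β * D * (1 - g) := by rw [hDr, mul_one]
      _ ≤ m * β * D * 1 := mul_le_mul_of_nonneg_left (by linarith) (by positivity)
      _ = _ := mul_one _
  have hGx : ‖∑ i, e i • fderiv ℝ (v i) x₁‖ ≤ m * β * D + 2 * m * ε0 * X + 2 * N * R := by
    refine (norm_clm_le_of_eq (c₁ := m * β * D ^ 2 * (1 - g)) (c₂ := -(2 * m)) (c₃ := 2 * N)
      (z := z) (q := qx) (p := x₁ - y0) fun ξ => ?_).trans ?_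
    · have h := (hjet ξ 0).1
      rw [hp2] at h
      simp only [map_zero, inner_zero_right, sub_zero] at h
      linarith
    · rw [abs_neg, abs_of_nonneg (by positivity : 0 ≤ 2 * m), abs_of_nonneg (mul_nonneg zero_le_two hN0)]
      have h2 : 2 * m * ‖qx‖ ≤ 2 * m * (ε0 * X) := mul_le_mul_of_nonneg_left hqxn (by positivity)
      have h3 : 2 * N * ‖x₁ - y0‖ ≤ 2 * N * R := mul_le_mul_of_nonneg_left hdx (by positivity)
      linarith
  have hGy : ‖∑ i, e i • fderiv ℝ (v i) y₁‖ ≤ m * β * D + 2 * m * ε0 * Y + 2 * N * R := by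
    refine (norm_clm_le_of_eq (c₁ := m * β * D ^ 2 * (1 - g)) (c₂ := 2 * m) (c₃ := -(2 * N))
      (z := z) (q := qy) (p := y₁ - y0) fun ξ => ?_).trans ?_
    · have h := (hjet 0 ξ).1
      rw [hp2] at h
      simp only [map_zero, inner_zero_right, zero_sub, inner_neg_right] at h
      linarith
    · rw [abs_neg, abs_of_nonneg (by positivity : 0 ≤ 2 * m), abs_of_nonneg (mul_nonneg zero_le_two hN0)]
      have h2 : 2 * m * ‖qy‖ ≤ 2 * m * (ε0 * Y) := mul_le_mul_of_nonneg_left hqyn (by positivity)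
      have h3 : 2 * N * ‖y₁ - y0‖ ≤ 2 * N * R := mul_le_mul_of_nonneg_left hdy (by positivity)
      linarith
  have hν : ‖D • z‖ = 1 := by
    rw [norm_smul, Real.norm_eq_abs, abs_of_pos hD0, ← hr_def, hDr]
  obtain ⟨ξ, η, hξ, hη, h3, h4⟩ := exists_reflection_coupling hl (hA x₁ hx₁) (hA y₁ hy₁)
    (hAA x₁ hx₁ y₁ hy₁) he0 hν
  have hsi : ∀ k, inner ℝ (D • z) (ξ k - η k) = inner ℝ z (ξ k - η k) / r := fun k => by
    rw [real_inner_smul_left, hD]; ring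
  have hsum := Finset.sum_nonpos fun k (_ : k ∈ Finset.univ) => (hjet (ξ k) (η k)).2
  simp only [← hsi] at hsum
  set s : Fin n ⊕ Fin n → ℝ := fun k => inner ℝ (D • z) (ξ k - η k) with hs
  have hzs : ∀ k, inner ℝ z (ξ k - η k) = r * s k := fun k => by
    simp only [hs]; rw [hsi]; field_simp
  set q := (n * e0) ^ 2 / (4 * lam) with hq
  have hq0 : 0 ≤ q := by positivity
  have hcross := abs_sum_cross_le hLam hq1 (hA x₁ hx₁) (hA y₁ hy₁) hξ hη (s := s) h4
    (mul_nonneg hε0 hX0) (mul_nonneg hε0 hY0) hqxn hqyn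
  have hsw : ∀ {A : Matrix (Fin n) (Fin n) ℝ} {ξ : Fin n ⊕ Fin n → Eu n}
      (_ : ∀ i j, ∑ k, ξ k i * ξ k j = A i j) (c : Fin n → ℝ) (B : Fin n → Eu n →L[ℝ] Eu n →L[ℝ] ℝ),
      ∑ k, ∑ i, c i * B i (ξ k) (ξ k) = ∑ i, c i * trHess A (B i) := fun hξ c B => by
    rw [Finset.sum_comm]
    exact Finset.sum_congr rfl fun i _ => by rw [← Finset.mul_sum, sum_bilin_eq_trHess hξ]
  have hH : ∀ {A : Matrix (Fin n) (Fin n) ℝ} (_ : EllipticMatrix lam Lam A)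
      {ξ : Fin n ⊕ Fin n → Eu n} (_ : ∀ i j, ∑ k, ξ k i * ξ k j = A i j)
      (l : Fin n → Eu n →L[ℝ] ℝ), lam * √(∑ i, ‖l i‖ ^ 2) ^ 2 ≤ ∑ k, ∑ i, l i (ξ k) ^ 2 :=
    fun hA ξ hξ l => by
      rw [Real.sq_sqrt (by positivity), Finset.sum_comm, Finset.mul_sum]
      exact Finset.sum_le_sum fun i _ => hA.le_sum_sq hξ (l i)
  have hB : ∀ p ∈ Metric.closedBall y0 R,
      -(C0 * ε0 * (1 + √(∑ i, ‖fderiv ℝ (v i) p‖ ^ 2)) ^ 2) ≤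
        ∑ i, v i p * trHess (A p) (fderiv ℝ (fderiv ℝ (v i)) p) := fun p hp => by
    have h1 := (abs_le.mp (hQ p hp (WithLp.toLp 2 fun i => v i p))).1
    refine le_trans (neg_le_neg ?_) h1
    have h2 := (norm_sum_smul_le (WithLp.toLp 2 fun i => v i p) fun i => fderiv ℝ (v i) p).trans
      (mul_le_mul_of_nonneg_right (hvn p hp) (Real.sqrt_nonneg _))
    set X' := √(∑ i, ‖fderiv ℝ (v i) p‖ ^ 2) with hX'
    have hX'0 : 0 ≤ X' := Real.sqrt_nonneg _
    calc _ ≤ C0 * (1 + X') * (ε0 + ε0 * X') :=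
          mul_le_mul_of_nonneg_left (add_le_add (hvn p hp) h2) (by positivity)
      _ = _ := by ring
  have hα : ∀ p ∈ Metric.closedBall y0 R,
      |∑ i, e i * trHess (A p) (fderiv ℝ (fderiv ℝ (v i)) p)| ≤
        C0 * (1 + √(∑ i, ‖fderiv ℝ (v i) p‖ ^ 2)) * (1 + ‖∑ i, e i • fderiv ℝ (v i) p‖) :=
    fun p hp => (hQ p hp e).trans (mul_le_mul_of_nonneg_left (by linarith) (by positivity))
  have hterm : ∀ a b c d f h i j k l σ : ℝ,
      a - b - M * (β * r ^ (β - 2) * ((β - 2) * σ ^ 2 + c) * (1 - g)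
        - 2 * (β * r ^ (β - 2) * (r * σ) * (2 * d)) - r ^ β * (2 * (f + h) + 2 * (i + j)))
        - 2 * N * (k + l) =
      a - b - (m * β * D ^ 2 * (1 - g) * ((β - 2) * σ ^ 2 + c)
        - 4 * m * β * D * (σ * d) - m * 2 * (f + h + (i + j))) - 2 * N * (k + l) := by
    intro a b c d f h i j k l σ
    rw [hp2, hm]
    linear_combination (M * β * r ^ β * 4 * σ * d * D) * hDr
  have hs' : ∀ k, inner ℝ (D • z) (ξ k - η k) = s k := fun _ => rfl
  simp only [hzs, hs'] at hsum
  simp only [hterm] at hsum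
  simp only [Finset.sum_sub_distrib, Finset.sum_add_distrib, ← Finset.mul_sum] at hsum
  rw [hsw hξ, hsw hη, hsw hξ, hsw hη, sum_norm_sq_eq hξ, sum_norm_sq_eq hη, h3] at hsum
  rw [show ∑ k, s k ^ 2 = lam + 2 * q from h4] at hsum
  refine holder_doubling_contradiction (m := m) (X := X) (Y := Y) (D := D) (R := R) (N := N) (g := g)
    (s2 := m * β * D ^ 2 * ((β - 2) * (lam + 2 * q) + (lam + 2 * q * n)))
    (W := 2 * m * β * D * ∑ k, s k * (qx (ξ k) + qy (η k)))
    (τ := 2 * N * (∑ i, A x₁ i i + ∑ i, A y₁ i i))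
    hl hC0 hβ hε0 ?_ hβ1 hε1 hε2 ?_ hX0 hY0 hm0 hGx hGy ?_ ?_
    (abs_le.mp (hα x₁ hx₁)).1 (abs_le.mp (hα y₁ hy₁)).2 ?_ hgb ?_ (hH (hA x₁ hx₁) hξ _)
    (hH (hA y₁ hy₁) hη _) (hB x₁ hx₁) (hB y₁ hy₁) ?_
  · rw [hD, mul_one_div, le_div_iff₀ hr0]
    exact le_trans (mul_le_mul_of_nonneg_left hr (by positivity)) hR2
  · rw [hD, one_div, inv_pow, ← div_eq_mul_inv, le_div_iff₀ (by positivity)]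
    exact le_trans (by gcongr) hR3
  · refine hM1.trans ?_
    calc M * β ≤ M * β * (r ^ β * D) := le_mul_of_one_le_right (by positivity) hpD
      _ = m * β * D := by rw [hm]; ring
  · calc 2 * N * (∑ i, A x₁ i i + ∑ i, A y₁ i i) ≤ 2 * N * (n * Lam + n * Lam) := by
          gcongr
          · exact (hA x₁ hx₁).trace_le
          · exact (hA y₁ hy₁).trace_le
      _ ≤ M * (β * lam / 32) := hM2
      _ ≤ M * (β * lam / 32) * (r ^ β * D ^ 2) := le_mul_of_one_le_right (by positivity) hpD2
      _ = _ := by rw [hm]; ring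
  · have h1 : (β - 2) * (lam + 2 * q) + (lam + 2 * q * n) ≤ -(lam / 2) := by
      have a1 : 0 ≤ q * (2 - β) := mul_nonneg hq0 (by linarith)
      have a2 : β * lam ≤ 1 / 4 * lam := mul_le_mul_of_nonneg_right hβ4 hl.le
      linarith
    calc m * β * D ^ 2 * ((β - 2) * (lam + 2 * q) + (lam + 2 * q * n)) ≤
          m * β * D ^ 2 * -(lam / 2) := mul_le_mul_of_nonneg_left h1 (by positivity)
      _ = _ := by ring
  · have h1 := mul_le_mul_of_nonneg_left hcross (by positivity : 0 ≤ 2 * m * β * D)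
    linarith
  · linarith [hsum]

end

set_option maxHeartbeats 1000000 in
theorem exists_gradient_holder (n : ℕ) {lam Lam C0 : ℝ} (hl : 0 < lam) (hLam : 0 ≤ Lam)
    (hC0 : 0 < C0) :
    ∃ β ∈ Ioo (0 : ℝ) 1, ∃ ε0 > (0 : ℝ), ∃ R0 ∈ Ioc (0 : ℝ) 1, ∃ C > (0 : ℝ),
      ∀ (v : Fin n → Eu n → ℝ) (A : Eu n → Matrix (Fin n) (Fin n) ℝ) (y0 : Eu n) (R : ℝ),
      0 < R → R ≤ R0 →
      (∀ x ∈ Metric.closedBall y0 R, ∀ i, ContDiffAt ℝ 2 (v i) x) →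
      (∀ x ∈ Metric.closedBall y0 R, EllipticMatrix lam Lam (A x)) →
      (∀ x ∈ Metric.closedBall y0 R, ∀ y ∈ Metric.closedBall y0 R, ∀ i j,
        |A x i j - A y i j| ≤ ε0) →
      (∀ x ∈ Metric.closedBall y0 R, ∀ c : Eu n,
        |∑ i, c i * trHess (A x) (fderiv ℝ (fderiv ℝ (v i)) x)| ≤
          C0 * (1 + √(∑ i, ‖fderiv ℝ (v i) x‖ ^ 2)) * (‖c‖ + ‖∑ i, c i • fderiv ℝ (v i) x‖)) →
      (∀ x ∈ Metric.closedBall y0 R, ∑ i, v i x ^ 2 ≤ ε0 ^ 2) →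
      ∀ e : Eu n, ‖e‖ ≤ 1 → ∀ x ∈ Metric.closedBall y0 R,
        ∑ i, e i * v i x - ∑ i, e i * v i y0 ≤ C / R ^ 2 * ‖x - y0‖ ^ β := by
  have hn : (0 : ℝ) ≤ n := Nat.cast_nonneg n
  set β := min (1 / 4) (lam ^ 2 / (128 * C0 ^ 2)) with hβ
  have hβ0 : 0 < β := by positivity
  have hβ4 : β ≤ 1 / 4 := min_le_left _ _
  have hβ1 : 128 * C0 ^ 2 * β ≤ lam ^ 2 := by
    have : β ≤ lam ^ 2 / (128 * C0 ^ 2) := min_le_right _ _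
    rwa [le_div_iff₀ (by positivity), mul_comm] at this
  obtain ⟨ε0, hε0, hε4, hε1, hε2, he1⟩ : ∃ ε0 > (0 : ℝ), ε0 ≤ 1 / 4 ∧ 16 * C0 * ε0 ≤ lam ∧
      2 * (lam + n * Lam) * ε0 ≤ C0 ∧ 2 * (n + 1) ^ 2 * ε0 ≤ lam := by
    have hp : 0 < lam + n * Lam := by positivity
    refine ⟨min (1 / 4) (min (lam / (16 * C0)) (min (C0 / (2 * (lam + n * Lam)))
      (lam / (2 * (n + 1) ^ 2)))), by positivity, min_le_left _ _, ?_, ?_, ?_⟩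
    · rw [← le_div_iff₀' (by positivity)]
      exact (min_le_right _ _).trans (min_le_left _ _)
    · rw [← le_div_iff₀' (by positivity)]
      exact (min_le_right _ _).trans ((min_le_right _ _).trans (min_le_left _ _))
    · rw [← le_div_iff₀' (by positivity)]
      exact (min_le_right _ _).trans ((min_le_right _ _).trans (min_le_right _ _))
  have hne0 : n * ε0 * (n + 1) ≤ lam / 2 := by nlinarith
  have hne0' : n * ε0 ≤ lam / 2 := by nlinarith [mul_nonneg hn hε0.le]
  have hne2 : (n * ε0) ^ 2 / (4 * lam) ≤ n * ε0 / 8 := by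
    rw [div_le_iff₀ (by positivity)]
    nlinarith [mul_nonneg hn hε0.le]
  set C2 : ℝ := 3 / β + 128 * (n * Lam) / (β * lam) with hC2
  have hC2p : 0 < C2 := by positivity
  set R0 : ℝ := min (1 / 2) (min (lam / (128 * C0)) (β / 128)) with hR0
  have hR0p : 0 < R0 := by positivity
  have hR0h : R0 ≤ 1 / 2 := min_le_left _ _
  refine ⟨β, ⟨hβ0, by linarith⟩, ε0, hε0, R0, ⟨hR0p, by linarith⟩, C2 + 1,
    by positivity, fun v A y0 R hR hRR hv hA hAA hQ hε e he x hx => ?_⟩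
  have hR1 : 2 * R ≤ 1 := by linarith
  have hR2 : 64 * C0 * (2 * R) ≤ lam := by
    have : R ≤ lam / (128 * C0) := hRR.trans ((min_le_right _ _).trans (min_le_left _ _))
    rw [le_div_iff₀ (by positivity)] at this
    linarith
  have hR3 : 32 * (2 * R) ^ 2 ≤ β := by
    have : R ≤ β / 128 := hRR.trans ((min_le_right _ _).trans (min_le_right _ _))
    nlinarith
  have hRi : 1 ≤ 1 / R ^ 2 := by rw [le_div_iff₀ (by positivity)]; nlinarith
  have hRi2 : 1 / R ^ 2 * R ≤ 1 / R ^ 2 := mul_le_of_le_one_right (by positivity) (by linarith)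
  have hC2β : C2 * β = 3 + 128 * (n * Lam) / lam := by rw [hC2]; field_simp
  have hC2β' : 0 ≤ 128 * (n * Lam) / lam := by positivity
  have hC2l : C2 * (β * lam / 32) = 3 * lam / 32 + 4 * (n * Lam) := by rw [hC2]; field_simp; ring
  have hy0 : y0 ∈ Metric.closedBall y0 R := Metric.mem_closedBall_self hR.le
  have := holder_doubling_le (N := 1 / R ^ 2) (M := C2 * (1 / R ^ 2)) (ε0 := ε0) (e0 := ε0)
    hl hLam hC0 hβ0 hβ4 hβ1 hε0.le hε4 hε1 hε2
    (by linarith) (by linarith) (by nlinarith) hR hR1 hR2 hR3 (by positivity)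
    (by rw [one_div, inv_mul_cancel₀ (by positivity)]; linarith) (by positivity)
    (by nlinarith) (by nlinarith) hv hA hAA hQ hε he hx hy0
  have hr1 : ‖x - y0‖ ≤ 1 := by
    rw [mem_closedBall_iff_norm] at hx; linarith
  have hr2 : ‖x - y0‖ ^ 2 ≤ ‖x - y0‖ ^ β := by
    rw [← Real.rpow_natCast]
    exact Real.rpow_le_rpow_of_exponent_ge_of_imp (norm_nonneg _) hr1 (by norm_num; linarith)
      fun _ h => by norm_num at h
  simp only [sub_self, norm_zero] at this
  set g := ∑ i, v i x ^ 2 + ∑ i, v i y0 ^ 2 with hg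
  have hg0 : 0 ≤ g := by positivity
  set r := ‖x - y0‖
  have h1 : C2 * (1 / R ^ 2) * (r ^ β * (1 - g)) ≤ C2 * (1 / R ^ 2) * r ^ β := by
    refine mul_le_mul_of_nonneg_left (mul_le_of_le_one_right ?_ ?_) (by positivity)
    · exact Real.rpow_nonneg (norm_nonneg _) _
    · linarith
  have h2 : 1 / R ^ 2 * r ^ 2 ≤ 1 / R ^ 2 * r ^ β :=
    mul_le_mul_of_nonneg_left hr2 (by positivity)
  have h3 : (C2 + 1) / R ^ 2 * r ^ β = C2 * (1 / R ^ 2) * r ^ β + 1 / R ^ 2 * r ^ β := by ring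
  norm_num at this h1 h2 h3 ⊢
  linarith

section

variable {n : ℕ} {F : Type*} [NormedAddCommGroup F]

theorem exists_uniform_radius {Ω S : Set (Eu n)} (hΩ : IsOpen Ω) (hS : IsCompact S) (hSΩ : S ⊆ Ω)
    {g : Eu n → F} (hg : ContinuousOn g Ω) {η : ℝ} (hη : 0 < η) :
    ∃ δ > 0, ∀ x ∈ S, ∀ y, dist y x ≤ δ → y ∈ Ω ∧ ‖g y - g x‖ ≤ η := by
  obtain ⟨δ₁, hδ₁, h₁⟩ := hS.exists_cthickening_subset_open hΩ hSΩ
  have h₂ := hS.uniformContinuousAt_of_continuousAt g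
    (fun x hx => hg.continuousAt (hΩ.mem_nhds (hSΩ hx))) (Metric.dist_mem_uniformity hη)
  obtain ⟨δ₂, hδ₂, h₂⟩ := Metric.mem_uniformity_dist.mp h₂
  refine ⟨min δ₁ (δ₂ / 2), by positivity, fun x hx y hy => ⟨h₁ ?_, ?_⟩⟩
  · exact Metric.mem_cthickening_of_dist_le y x δ₁ S hx (hy.trans (min_le_left _ _))
  · have : dist x y < δ₂ := by
      rw [dist_comm]; exact hy.trans_lt ((min_le_right _ _).trans_lt (by linarith))
    have := h₂ this hx
    rw [← dist_eq_norm, dist_comm]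
    exact (show dist (g x) (g y) < η from this).le

theorem eventually_shift_close {Ω S : Set (Eu n)} (hΩ : IsOpen Ω) (hS : IsCompact S) (hSΩ : S ⊆ Ω)
    {g : Eu n → F} (hg : ContinuousOn g Ω) {η : ℝ} (hη : 0 < η) :
    ∀ᶠ h in 𝓝[>] (0 : ℝ), ∀ x ∈ S, ∀ e : Eu n, ‖e‖ ≤ 1 →
      x + h • e ∈ Ω ∧ ‖g (x + h • e) - g x‖ ≤ η := by
  obtain ⟨δ, hδ, H⟩ := exists_uniform_radius hΩ hS hSΩ hg hη
  filter_upwards [Ioo_mem_nhdsGT hδ] with h hh x hx e he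
  refine H x hx _ ?_
  rw [dist_eq_norm, add_sub_cancel_left, norm_smul, Real.norm_eq_abs, abs_of_pos hh.1]
  nlinarith [hh.1, hh.2]

variable [NormedSpace ℝ F]

theorem eventually_diffQuot_close {Ω S : Set (Eu n)} (hΩ : IsOpen Ω) (hS : IsCompact S)
    (hSΩ : S ⊆ Ω) {g : Eu n → F} (hg : ContDiffOn ℝ 1 g Ω) {η : ℝ} (hη : 0 < η) :
    ∀ᶠ h in 𝓝[>] (0 : ℝ), ∀ x ∈ S, ∀ e : Eu n, ‖e‖ ≤ 1 →
      ‖h⁻¹ • (g (x + h • e) - g x) - fderiv ℝ g x e‖ ≤ η := by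
  have hd : ContinuousOn (fderiv ℝ g) Ω := hg.continuousOn_fderiv_of_isOpen hΩ le_rfl
  obtain ⟨δ, hδ, H⟩ := exists_uniform_radius hΩ hS hSΩ hd hη
  filter_upwards [Ioo_mem_nhdsGT hδ] with h hh x hx e he
  have hmem : x + h • e ∈ Metric.closedBall x δ := by
    rw [mem_closedBall_iff_norm, add_sub_cancel_left, norm_smul, Real.norm_eq_abs,
      abs_of_pos hh.1]
    nlinarith [hh.1, hh.2]
  have h1 := (convex_closedBall x δ).norm_image_sub_le_of_norm_fderiv_le' (f := g)
    (φ := fderiv ℝ g x) (C := η) (x := x) (y := x + h • e)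
    (fun y hy => (hg.differentiableOn one_ne_zero).differentiableAt (hΩ.mem_nhds (H x hx y hy).1))
    (fun y hy => (H x hx y hy).2) (Metric.mem_closedBall_self hδ.le) hmem
  rw [add_sub_cancel_left, norm_smul, Real.norm_eq_abs, abs_of_pos hh.1, map_smul] at h1
  have h2 : h⁻¹ • (g (x + h • e) - g x) - fderiv ℝ g x e =
      h⁻¹ • (g (x + h • e) - g x - h • fderiv ℝ g x e) := by
    rw [smul_sub h⁻¹ (_ - _), inv_smul_smul₀ hh.1.ne']
  rw [h2, norm_smul, norm_inv, Real.norm_eq_abs, abs_of_pos hh.1, inv_mul_le_iff₀ hh.1]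
  refine h1.trans ?_
  rw [mul_comm h η]
  exact mul_le_mul_of_nonneg_left (mul_le_of_le_one_right hh.1.le he) hη.le

theorem norm_sum_smul_sub_le {c : Eu n} {w : Fin n → F} {L : Eu n →L[ℝ] F} {η : ℝ}
    (h : ∀ k, ‖w k - L (EuclideanSpace.single k 1)‖ ≤ η) :
    ‖∑ k, c k • w k - L c‖ ≤ n * η * ‖c‖ := by
  have h1 : ∑ k, c k • w k - L c = ∑ k, c k • (w k - L (EuclideanSpace.single k 1)) := by
    rw [clm_apply_eq_sum L c]
    simp only [smul_sub, Finset.sum_sub_distrib]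
  rw [h1]
  calc _ ≤ ∑ k, ‖c k • (w k - L (EuclideanSpace.single k 1))‖ := norm_sum_le _ _
    _ ≤ ∑ _k : Fin n, ‖c‖ * η := Finset.sum_le_sum fun k _ => by
        rw [norm_smul]
        exact mul_le_mul (PiLp.norm_apply_le c k) (h k) (norm_nonneg _) (norm_nonneg _)
    _ = _ := by simp; ring

end

section

variable {n : ℕ}

theorem abs_sum_mul_mul_le {c : Eu n} {x y : Fin n → ℝ} {M η : ℝ} (hM : 0 ≤ M)
    (hη : n * η ≤ 1) (hx : ∀ k, |x k| ≤ M) (hy : ∀ k, |y k| ≤ η) :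
    |∑ k, c k * (x k * y k)| ≤ ‖c‖ * M := by
  have h : ∀ k, |c k * (x k * y k)| ≤ ‖c‖ * (M * η) := fun k => by
    have hc : |c k| ≤ ‖c‖ := PiLp.norm_apply_le c k
    rw [abs_mul, abs_mul]
    exact mul_le_mul hc (mul_le_mul (hx k) (hy k) (abs_nonneg _) hM)
      (mul_nonneg (abs_nonneg _) (abs_nonneg _)) (norm_nonneg _)
  calc _ ≤ ∑ k, |c k * (x k * y k)| := Finset.abs_sum_le_sum_abs _ _
    _ ≤ ∑ _k : Fin n, ‖c‖ * (M * η) := Finset.sum_le_sum fun k _ => h k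
    _ = (n * η) * (‖c‖ * M) := by simp; ring
    _ ≤ _ := mul_le_of_le_one_left (by positivity) hη

set_option maxHeartbeats 1000000 in
theorem abs_sum_trHess_le {C0 η : ℝ} (hC0 : 1 ≤ C0) (hη1 : η ≤ 1) (hnη : n * η ≤ 1)
    {P : Eu n →L[ℝ] Eu n →L[ℝ] ℝ} {Q : Fin n → Eu n →L[ℝ] Eu n →L[ℝ] ℝ}
    {d : Fin n → Eu n →L[ℝ] ℝ} {b : Fin n → ℝ} {a : Fin n → Fin n → Fin n → ℝ}
    {Lb : Eu n →L[ℝ] ℝ} {La : Fin n → Fin n → Eu n →L[ℝ] ℝ} {t : Fin n → ℝ}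
    (hQ : ∀ k, ‖Q k - P‖ ≤ η) (hd : ∀ k, ‖d k - P (EuclideanSpace.single k 1)‖ ≤ η)
    (hb : ∀ k, ‖b k - Lb (EuclideanSpace.single k 1)‖ ≤ η)
    (ha : ∀ i j k, ‖a i j k - La i j (EuclideanSpace.single k 1)‖ ≤ η)
    (hLb : ∀ c, |Lb c| ≤ C0 * (‖c‖ + ‖P c‖)) (hLa : ∀ i j c, |La i j c| ≤ C0 * (‖c‖ + ‖P c‖))
    (ht : ∀ k, t k = -b k - ∑ i, ∑ j, a i j k *
      Q k (EuclideanSpace.single i 1) (EuclideanSpace.single j 1)) (c : Eu n) :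
    |∑ k, c k * t k| ≤
      3 * C0 * (1 + 2 * n ^ 2) * (1 + √(∑ k, ‖d k‖ ^ 2)) * (‖c‖ + ‖∑ k, c k • d k‖) := by
  set Z := ‖∑ k, c k • d k‖ with hZ
  set X := √(∑ k, ‖d k‖ ^ 2) with hX
  have hX0 : 0 ≤ X := Real.sqrt_nonneg _
  have hZ0 : 0 ≤ Z := norm_nonneg _
  have hc0 : 0 ≤ ‖c‖ := norm_nonneg _
  have hC0' : 0 ≤ C0 := zero_le_one.trans hC0
  have hM0 : 0 ≤ 3 * C0 * (1 + X) := mul_nonneg (mul_nonneg zero_le_three hC0') (by linarith)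
  have hnc : n * η * ‖c‖ ≤ ‖c‖ := mul_le_of_le_one_left hc0 hnη
  have hPc : ‖P c‖ ≤ Z + ‖c‖ := by
    have := norm_sum_smul_sub_le (c := c) hd
    have h2 := norm_sub_norm_le (P c) (∑ k, c k • d k)
    rw [norm_sub_rev] at h2
    linarith
  have hdX : ∀ k, ‖d k‖ ≤ X := fun k => by
    refine Real.le_sqrt_of_sq_le ?_
    exact Finset.single_le_sum (f := fun k => ‖d k‖ ^ 2) (fun _ _ => by positivity)
      (Finset.mem_univ k)
  have hPe : ∀ k, ‖P (EuclideanSpace.single k 1)‖ ≤ X + 1 := fun k => by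
    have h2 := norm_sub_norm_le (P (EuclideanSpace.single k 1)) (d k)
    rw [norm_sub_rev] at h2
    linarith [hd k, hdX k]
  have hk1 : ∀ k : Fin n, ‖(EuclideanSpace.single k 1 : Eu n)‖ = 1 := fun k => by simp
  have hPij : ∀ i j, |P (EuclideanSpace.single i 1) (EuclideanSpace.single j 1)| ≤ X + 1 :=
    fun i j => by
      have := (P (EuclideanSpace.single i 1)).le_opNorm (EuclideanSpace.single j 1)
      rw [hk1, mul_one] at this
      exact this.trans (hPe i)
  have hQij : ∀ i j k, |Q k (EuclideanSpace.single i 1) (EuclideanSpace.single j 1) -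
      P (EuclideanSpace.single i 1) (EuclideanSpace.single j 1)| ≤ η := fun i j k => by
    have := (Q k - P).le_opNorm₂ (EuclideanSpace.single i 1) (EuclideanSpace.single j 1)
    rw [hk1, hk1, mul_one, mul_one] at this
    exact this.trans (hQ k)
  have hlin : ∀ {w : Fin n → ℝ} {L : Eu n →L[ℝ] ℝ},
      (∀ k, ‖w k - L (EuclideanSpace.single k 1)‖ ≤ η) →
      (∀ c, |L c| ≤ C0 * (‖c‖ + ‖P c‖)) → |∑ k, c k * w k| ≤ 3 * C0 * (‖c‖ + Z) := by
    intro w L hw hL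
    have h1 := norm_sum_smul_sub_le (c := c) hw
    simp only [smul_eq_mul, Real.norm_eq_abs] at h1
    have h2 := abs_sub_abs_le_abs_sub (∑ k, c k * w k) (L c)
    have h3 := hL c
    have h4 : C0 * (‖c‖ + ‖P c‖) ≤ C0 * (2 * ‖c‖ + Z) :=
      mul_le_mul_of_nonneg_left (by linarith) (by linarith)
    nlinarith [mul_nonneg (sub_nonneg.mpr hC0) hc0, mul_nonneg (sub_nonneg.mpr hC0) hZ0]
  have hak : ∀ i j k, |a i j k| ≤ 3 * C0 * (1 + X) := fun i j k => by
    have h1 := ha i j k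
    rw [Real.norm_eq_abs] at h1
    have h2 := abs_sub_abs_le_abs_sub (a i j k) (La i j (EuclideanSpace.single k 1))
    have h3 := hLa i j (EuclideanSpace.single k 1)
    rw [hk1] at h3
    have h4 : C0 * (1 + ‖P (EuclideanSpace.single k 1)‖) ≤ C0 * (1 + (X + 1)) :=
      mul_le_mul_of_nonneg_left (by linarith [hPe k]) (by linarith)
    nlinarith [mul_nonneg (sub_nonneg.mpr hC0) hX0]
  have hij : ∀ i j, |∑ k, c k * (a i j k *
      Q k (EuclideanSpace.single i 1) (EuclideanSpace.single j 1))| ≤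
      6 * C0 * (1 + X) * (‖c‖ + Z) := fun i j => by
    have h1 : ∑ k, c k * (a i j k * Q k (EuclideanSpace.single i 1) (EuclideanSpace.single j 1)) =
        (∑ k, c k * a i j k) * P (EuclideanSpace.single i 1) (EuclideanSpace.single j 1) +
        ∑ k, c k * (a i j k * (Q k (EuclideanSpace.single i 1) (EuclideanSpace.single j 1) -
          P (EuclideanSpace.single i 1) (EuclideanSpace.single j 1))) := by
      rw [Finset.sum_mul, ← Finset.sum_add_distrib]
      exact Finset.sum_congr rfl fun k _ => by ring
    have h2 : |(∑ k, c k * a i j k) * P (EuclideanSpace.single i 1) (EuclideanSpace.single j 1)| ≤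
        3 * C0 * (‖c‖ + Z) * (X + 1) := by
      rw [abs_mul]
      exact mul_le_mul (hlin (ha i j) (hLa i j)) (hPij i j) (abs_nonneg _)
        (mul_nonneg (mul_nonneg zero_le_three hC0') (add_nonneg hc0 hZ0))
    have h3 : |∑ k, c k * (a i j k * (Q k (EuclideanSpace.single i 1) (EuclideanSpace.single j 1) -
          P (EuclideanSpace.single i 1) (EuclideanSpace.single j 1)))| ≤
        ‖c‖ * (3 * C0 * (1 + X)) := by
      exact abs_sum_mul_mul_le hM0 hnη (hak i j) (hQij i j)
    rw [h1]
    refine (abs_add_le _ _).trans ((add_le_add h2 h3).trans ?_)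
    have : 0 ≤ 3 * C0 * (1 + X) * Z := mul_nonneg hM0 hZ0
    linarith
  have hsplit : ∑ k, c k * t k = -∑ k, c k * b k - ∑ i, ∑ j, ∑ k, c k * (a i j k *
      Q k (EuclideanSpace.single i 1) (EuclideanSpace.single j 1)) := by
    rw [Finset.sum_congr rfl fun i _ => Finset.sum_comm, Finset.sum_comm, ← Finset.sum_neg_distrib,
      ← Finset.sum_sub_distrib]
    refine Finset.sum_congr rfl fun k _ => ?_
    rw [ht]
    simp only [mul_sub, Finset.mul_sum]
    ring
  have hdbl : |∑ i, ∑ j, ∑ k, c k * (a i j k *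
      Q k (EuclideanSpace.single i 1) (EuclideanSpace.single j 1))| ≤
      n ^ 2 * (6 * C0 * (1 + X) * (‖c‖ + Z)) := by
    calc _ ≤ ∑ _i : Fin n, ∑ _j : Fin n, 6 * C0 * (1 + X) * (‖c‖ + Z) :=
          (Finset.abs_sum_le_sum_abs _ _).trans (Finset.sum_le_sum fun i _ =>
            (Finset.abs_sum_le_sum_abs _ _).trans (Finset.sum_le_sum fun j _ => hij i j))
      _ = _ := by simp; ring
  rw [hsplit]
  refine (abs_sub _ _).trans ?_
  rw [abs_neg]
  have h0 := hlin hb hLb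
  have h1 : 0 ≤ 3 * C0 * X * (‖c‖ + Z) :=
    mul_nonneg (mul_nonneg (mul_nonneg zero_le_three hC0') hX0) (add_nonneg hc0 hZ0)
  linarith

/-- `u` is a `C²` solution of `tr (A D²u) + f = 0` on `Ω` with bounded gradient, whose
coefficients depend on the point through `x` and `Du` in a Lipschitz way. -/
structure IsSolution (Ω : Set (Eu n)) (u : Eu n → ℝ) (A : Eu n → Matrix (Fin n) (Fin n) ℝ)
    (f : Eu n → ℝ) (lam C0 : ℝ) : Prop where
  isOpen : IsOpen Ω
  lam_pos : 0 < lam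
  one_le : 1 ≤ C0
  contDiffOn : ContDiffOn ℝ 2 u Ω
  contDiffOn_coeff : ∀ i j, ContDiffOn ℝ 1 (fun x => A x i j) Ω
  contDiffOn_rhs : ContDiffOn ℝ 1 f Ω
  elliptic : ∀ x ∈ Ω, EllipticMatrix lam C0 (A x)
  fderiv_coeff : ∀ x ∈ Ω, ∀ i j c, |fderiv ℝ (fun x => A x i j) x c| ≤
    C0 * (‖c‖ + ‖fderiv ℝ (fderiv ℝ u) x c‖)
  fderiv_rhs : ∀ x ∈ Ω, ∀ c, |fderiv ℝ f x c| ≤ C0 * (‖c‖ + ‖fderiv ℝ (fderiv ℝ u) x c‖)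
  coeff_sub_le : ∀ x y, segment ℝ x y ⊆ Ω → ∀ i j,
    |A x i j - A y i j| ≤ C0 * (‖x - y‖ + ‖fderiv ℝ u x - fderiv ℝ u y‖)
  rhs_le : ∀ x ∈ Ω, |f x| ≤ C0
  norm_fderiv_le : ∀ x ∈ Ω, ‖fderiv ℝ u x‖ ≤ C0
  eqn : ∀ x ∈ Ω, trHess (A x) (fderiv ℝ (fderiv ℝ u) x) + f x = 0

theorem trHess_sub (A : Matrix (Fin n) (Fin n) ℝ) (B B' : Eu n →L[ℝ] Eu n →L[ℝ] ℝ) :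
    trHess A (B - B') = trHess A B - trHess A B' := by
  simp only [trHess, sub_apply, mul_sub, Finset.sum_sub_distrib]

theorem trHess_smul (A : Matrix (Fin n) (Fin n) ℝ) (t : ℝ) (B : Eu n →L[ℝ] Eu n →L[ℝ] ℝ) :
    trHess A (t • B) = t * trHess A B := by
  simp only [trHess, smul_apply, smul_eq_mul, Finset.mul_sum]
  exact Finset.sum_congr rfl fun i _ => Finset.sum_congr rfl fun j _ => by ring

theorem fderiv_diffQuot {u : Eu n → ℝ} {x e : Eu n} {h p : ℝ}
    (h1 : ContDiffAt ℝ 2 u x) (h2 : ContDiffAt ℝ 2 u (x + h • e)) :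
    ContDiffAt ℝ 2 (fun y => h⁻¹ * (u (y + h • e) - u y) - p) x ∧
    fderiv ℝ (fun y => h⁻¹ * (u (y + h • e) - u y) - p) x =
      h⁻¹ • (fderiv ℝ u (x + h • e) - fderiv ℝ u x) ∧
    fderiv ℝ (fderiv ℝ (fun y => h⁻¹ * (u (y + h • e) - u y) - p)) x =
      h⁻¹ • (fderiv ℝ (fderiv ℝ u) (x + h • e) - fderiv ℝ (fderiv ℝ u) x) := by
  have hs : ContDiffAt ℝ 2 (fun y => u (y + h • e)) x :=
    h2.comp x (contDiffAt_id.add contDiffAt_const)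
  have key : ∀ y, ContDiffAt ℝ 2 u y → ContDiffAt ℝ 2 u (y + h • e) →
      fderiv ℝ (fun y => h⁻¹ * (u (y + h • e) - u y) - p) y =
      h⁻¹ • (fderiv ℝ u (y + h • e) - fderiv ℝ u y) := fun y hy1 hy2 => by
    have d1 := (hy1.differentiableAt two_ne_zero).hasFDerivAt
    have d2 := (hy2.differentiableAt two_ne_zero).hasFDerivAt.comp y
      ((hasFDerivAt_id y).add_const (h • e))
    exact (((d2.sub d1).const_mul h⁻¹).sub_const p).fderiv
  refine ⟨(contDiffAt_const.mul (hs.sub h1)).sub contDiffAt_const, key x h1 h2, ?_⟩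
  have hev : fderiv ℝ (fun y => h⁻¹ * (u (y + h • e) - u y) - p) =ᶠ[𝓝 x]
      fun y => h⁻¹ • (fderiv ℝ u (y + h • e) - fderiv ℝ u y) := by
    have e1 := h1.eventually (by simp)
    have e2 : ∀ᶠ y in 𝓝 x, ContDiffAt ℝ 2 u (y + h • e) :=
      ((continuous_add_const (h • e)).tendsto x).eventually (h2.eventually (by simp))
    filter_upwards [e1, e2] with y hy1 hy2 using key y hy1 hy2
  rw [hev.fderiv_eq]
  have d1 := ((h1.fderiv_right (m := 1) (by norm_num)).differentiableAt one_ne_zero).hasFDerivAt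
  have d2 := ((h2.fderiv_right (m := 1) (by norm_num)).differentiableAt
    one_ne_zero).hasFDerivAt.comp x ((hasFDerivAt_id x).add_const (h • e))
  exact ((d2.sub d1).const_smul h⁻¹).fderiv

end

section

variable {n : ℕ}

theorem IsSolution.diffQuot_eqn {Ω : Set (Eu n)} {u : Eu n → ℝ}
    {A : Eu n → Matrix (Fin n) (Fin n) ℝ} {f : Eu n → ℝ} {lam C0 : ℝ}
    (hs : IsSolution Ω u A f lam C0) {x y : Eu n} (hx : x ∈ Ω) (hy : y ∈ Ω) (t : ℝ) :
    trHess (A x) (t • (fderiv ℝ (fderiv ℝ u) y - fderiv ℝ (fderiv ℝ u) x)) =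
      -(t • (f y - f x)) - ∑ i, ∑ j, t • (A y i j - A x i j) *
        fderiv ℝ (fderiv ℝ u) y (EuclideanSpace.single i 1) (EuclideanSpace.single j 1) := by
  rw [trHess_smul, trHess_sub]
  have h1 := hs.eqn x hx
  have h2 := hs.eqn y hy
  have h3 : ∑ i, ∑ j, t • (A y i j - A x i j) *
      fderiv ℝ (fderiv ℝ u) y (EuclideanSpace.single i 1) (EuclideanSpace.single j 1) =
      t * (trHess (A y) (fderiv ℝ (fderiv ℝ u) y) - trHess (A x) (fderiv ℝ (fderiv ℝ u) y)) := by
    simp only [trHess, ← Finset.sum_sub_distrib, Finset.mul_sum]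
    refine Finset.sum_congr rfl fun i _ => Finset.sum_congr rfl fun j _ => ?_
    rw [smul_eq_mul]; ring
  rw [h3, smul_eq_mul]
  linear_combination (-t) * h1 + t * h2

theorem norm_clm_le_of_forall_le_one {L : Eu n →L[ℝ] ℝ} {M : ℝ} (hM : 0 ≤ M)
    (h : ∀ e : Eu n, ‖e‖ ≤ 1 → L e ≤ M) : ‖L‖ ≤ M := by
  refine L.opNorm_le_of_unit_norm hM fun e he => ?_
  rw [Real.norm_eq_abs, abs_le]
  refine ⟨?_, h e he.le⟩
  have := h (-e) (by rw [norm_neg]; exact he.le)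
  rw [map_neg] at this
  linarith

set_option maxHeartbeats 1000000 in
theorem exists_interior_holder (n : ℕ) {lam C0 : ℝ} (hl : 0 < lam) (hC0 : 1 ≤ C0) :
    ∃ β ∈ Ioo (0 : ℝ) 1, ∃ ε > (0 : ℝ), ∃ R0 ∈ Ioc (0 : ℝ) 1, ∃ C > (0 : ℝ),
      ∀ (Ω : Set (Eu n)) (u : Eu n → ℝ) (A : Eu n → Matrix (Fin n) (Fin n) ℝ) (f : Eu n → ℝ),
      IsSolution Ω u A f lam C0 → ∀ (y0 : Eu n) (R : ℝ), 0 < R → R ≤ R0 →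
      Metric.closedBall y0 R ⊆ Ω →
      (∀ x ∈ Metric.closedBall y0 R, ‖fderiv ℝ u x - fderiv ℝ u y0‖ ≤ ε) →
      ∀ x ∈ Metric.closedBall y0 R,
        ‖fderiv ℝ u x - fderiv ℝ u y0‖ ≤ C / R ^ 2 * ‖x - y0‖ ^ β := by
  have hC0p : 0 < C0 := by linarith
  obtain ⟨β, hβ, ε0, hε0, R0, hR0, C, hC, H⟩ := exists_gradient_holder n hl hC0p.le
    (show 0 < 3 * C0 * (1 + 2 * n ^ 2) by positivity)
  have hn : (0 : ℝ) ≤ n := Nat.cast_nonneg n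
  set ε := min (ε0 / (4 * C0)) (ε0 / (2 * (n + 1))) with hε
  have hεp : 0 < ε := by have := hε0.lt; positivity
  have hε1 : ε * (4 * C0) ≤ ε0 := by
    rw [← le_div_iff₀ (by positivity)]; exact min_le_left _ _
  have hε2 : ε * (2 * (n + 1)) ≤ ε0 := by
    rw [← le_div_iff₀ (by positivity)]; exact min_le_right _ _
  refine ⟨β, hβ, ε, hεp, min R0 ε, ⟨lt_min hR0.1 hεp, (min_le_left _ _).trans hR0.2⟩, C, hC,
    fun Ω u A f hs y0 R hR hRR hB hosc x hx => ?_⟩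
  have hRε : R ≤ ε := hRR.trans (min_le_right _ _)
  set B := Metric.closedBall y0 R with hBdef
  have hBc : IsCompact B := isCompact_closedBall _ _
  have hy0 : y0 ∈ B := Metric.mem_closedBall_self hR.le
  have hM : 0 ≤ C / R ^ 2 * ‖x - y0‖ ^ β := by positivity
  refine norm_clm_le_of_forall_le_one hM fun e he => ?_
  have hdu : ContDiffOn ℝ 1 (fderiv ℝ u) Ω :=
    hs.contDiffOn.fderiv_of_isOpen hs.isOpen (by norm_num)
  have hd2u : ContinuousOn (fderiv ℝ (fderiv ℝ u)) Ω :=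
    hdu.continuousOn_fderiv_of_isOpen hs.isOpen le_rfl
  have hk1 : ∀ k : Fin n, ‖(EuclideanSpace.single k 1 : Eu n)‖ ≤ 1 := fun k => by simp
  suffices hη : ∀ η > 0, η ≤ min ε (1 / (n + 1)) →
      (fderiv ℝ u x - fderiv ℝ u y0) e ≤ C / R ^ 2 * ‖x - y0‖ ^ β + 2 * n * η by
    set δ0 := min ε (1 / ((n : ℝ) + 1)) with hδ0
    have hδp : 0 < δ0 := by positivity
    refine le_of_forall_pos_le_add fun t ht => ?_
    have h1 := hη (min δ0 (t / (2 * n + 1))) (by positivity) (min_le_left _ _)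
    refine h1.trans (add_le_add le_rfl ?_)
    have h2 : min δ0 (t / (2 * n + 1)) * (2 * n + 1) ≤ t := by
      rw [← le_div_iff₀ (by positivity)]; exact min_le_right _ _
    have h3 : 0 < min δ0 (t / (2 * n + 1)) := by positivity
    linarith
  intro η hη hηle
  have hηε : η ≤ ε := hηle.trans (min_le_left _ _)
  have hηn : η * (n + 1) ≤ 1 := by
    rw [← le_div_iff₀ (by positivity)]; exact hηle.trans (min_le_right _ _)
  have hη1 : η ≤ 1 := by nlinarith
  have hnη : n * η ≤ 1 := by linarith
  have E1 := eventually_diffQuot_close hs.isOpen hBc hB (hs.contDiffOn.of_le one_le_two) hη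
  have E2 := eventually_diffQuot_close hs.isOpen hBc hB hdu hη
  have E3 := eventually_diffQuot_close hs.isOpen hBc hB hs.contDiffOn_rhs hη
  have E4 : ∀ᶠ h in 𝓝[>] (0 : ℝ), ∀ i j, ∀ x ∈ B, ∀ e : Eu n, ‖e‖ ≤ 1 →
      ‖h⁻¹ • (A (x + h • e) i j - A x i j) - fderiv ℝ (fun x => A x i j) x e‖ ≤ η :=
    Filter.eventually_all.mpr fun i => Filter.eventually_all.mpr fun j =>
      eventually_diffQuot_close hs.isOpen hBc hB (hs.contDiffOn_coeff i j) hη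
  have E5 := eventually_shift_close (F := Eu n →L[ℝ] Eu n →L[ℝ] ℝ) hs.isOpen hBc hB hd2u hη
  obtain ⟨h, h1, h2, h3, h4, h5⟩ := (E1.and (E2.and (E3.and (E4.and E5)))).exists
  set v : Fin n → Eu n → ℝ := fun k y => h⁻¹ * (u (y + h • EuclideanSpace.single k 1) - u y) -
    fderiv ℝ u y0 (EuclideanSpace.single k 1) with hv
  have hu : ∀ y ∈ Ω, ContDiffAt ℝ 2 u y := fun y hy => hs.contDiffOn.contDiffAt (hs.isOpen.mem_nhds hy)
  have hvd := fun y (hy : y ∈ B) (k : Fin n) => fderiv_diffQuot (h := h) (e := EuclideanSpace.single k 1)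
    (p := fderiv ℝ u y0 (EuclideanSpace.single k 1)) (hu y (hB hy)) (hu _ (h5 y hy _ (hk1 k)).1)
  have hvs : ∀ y ∈ B, ∀ k, |v k y - (fderiv ℝ u y - fderiv ℝ u y0) (EuclideanSpace.single k 1)| ≤ η :=
    fun y hy k => by
      have := h1 y hy _ (hk1 k)
      rw [Real.norm_eq_abs, smul_eq_mul] at this
      refine le_of_eq_of_le (congrArg _ ?_) this
      rw [sub_apply, hv]; ring
  have hvb : ∀ y ∈ B, ∀ k, |v k y| ≤ 2 * ε := fun y hy k => by
    have t1 := hvs y hy k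
    have t2 := (fderiv ℝ u y - fderiv ℝ u y0).le_of_opNorm_le_of_le (hosc y hy) (hk1 k)
    rw [Real.norm_eq_abs, mul_one] at t2
    have t3 := abs_sub_abs_le_abs_sub (v k y)
      ((fderiv ℝ u y - fderiv ℝ u y0) (EuclideanSpace.single k 1))
    linarith
  have hmain := H v A y0 R hR (hRR.trans (min_le_left _ _)) (fun y hy k => (hvd y hy k).1)
    (fun y hy => hs.elliptic y (hB hy)) ?_ ?_ ?_ e he x hx
  · have t1 : ∀ y ∈ B, |∑ k, e k * v k y - (fderiv ℝ u y - fderiv ℝ u y0) e| ≤ n * η := fun y hy => by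
      have := norm_sum_smul_sub_le (c := e) (w := fun k => v k y) (fun k => hvs y hy k)
      refine this.trans (mul_le_of_le_one_right (by positivity) he)
    have t2 := abs_le.mp (t1 x hx)
    have t3 := abs_le.mp (t1 y0 hy0)
    rw [sub_self, zero_apply] at t3
    linarith [t2.1, t3.2]
  · intro y hy z hz i j
    have t1 := hs.coeff_sub_le y z (((convex_closedBall y0 R).segment_subset hy hz).trans hB) i j
    refine t1.trans (le_trans ?_ hε1)
    have t2 : ‖y - z‖ ≤ 2 * ε := by
      have := dist_triangle_right y z y0
      rw [← dist_eq_norm]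
      linarith [Metric.mem_closedBall.mp hy, Metric.mem_closedBall.mp hz]
    have t3 : ‖fderiv ℝ u y - fderiv ℝ u z‖ ≤ 2 * ε := by
      have := norm_sub_le_norm_sub_add_norm_sub (fderiv ℝ u y) (fderiv ℝ u y0) (fderiv ℝ u z)
      rw [norm_sub_rev (fderiv ℝ u y0)] at this
      linarith [hosc y hy, hosc z hz]
    calc C0 * (‖y - z‖ + ‖fderiv ℝ u y - fderiv ℝ u z‖) ≤ C0 * (4 * ε) :=
          mul_le_mul_of_nonneg_left (by linarith) hC0p.le
      _ = _ := by ring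
  · intro y hy c
    have hd : ∀ k, fderiv ℝ (v k) y =
        h⁻¹ • (fderiv ℝ u (y + h • EuclideanSpace.single k 1) - fderiv ℝ u y) :=
      fun k => (hvd y hy k).2.1
    simp only [hd]
    refine abs_sum_trHess_le hC0 hη1 hnη (P := fderiv ℝ (fderiv ℝ u) y)
      (Q := fun k => fderiv ℝ (fderiv ℝ u) (y + h • EuclideanSpace.single k 1))
      (b := fun k => h⁻¹ • (f (y + h • EuclideanSpace.single k 1) - f y))
      (a := fun i j k => h⁻¹ • (A (y + h • EuclideanSpace.single k 1) i j - A y i j))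
      (fun k => (h5 y hy _ (hk1 k)).2) (fun k => h2 y hy _ (hk1 k)) (fun k => h3 y hy _ (hk1 k))
      (fun i j k => h4 i j y hy _ (hk1 k)) (hs.fderiv_rhs y (hB hy)) (hs.fderiv_coeff y (hB hy))
      (fun k => ?_) c
    rw [(hvd y hy k).2.2]
    exact hs.diffQuot_eqn (hB hy) (h5 y hy _ (hk1 k)).1 h⁻¹
  · intro y hy
    calc ∑ k, v k y ^ 2 ≤ ∑ _k : Fin n, (2 * ε) ^ 2 := Finset.sum_le_sum fun k _ => by
          rw [← sq_abs]
          exact pow_le_pow_left₀ (abs_nonneg _) (hvb y hy k) 2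
      _ = n * (2 * ε) ^ 2 := by simp
      _ ≤ (ε * (2 * (n + 1))) ^ 2 := by
        nlinarith [mul_nonneg (mul_nonneg hn hn) (sq_nonneg ε), mul_nonneg hn (sq_nonneg ε),
          sq_nonneg ε]
      _ ≤ ε0 ^ 2 := pow_le_pow_left₀ (by positivity) hε2 2

end

section

variable {n : ℕ}

/-- The class of functions to which the gradient bound and the boundary decay apply. -/
structure IsAdmissible (U : Set (Eu n)) (w : Eu n → ℝ) (A : Eu n → Matrix (Fin n) (Fin n) ℝ)
    (lam C0 : ℝ) : Prop where
  contDiffAt : ∀ x ∈ U, ContDiffAt ℝ 2 w x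
  elliptic : ∀ x ∈ U, EllipticMatrix lam C0 (A x)
  coeff_sub_le : ∀ x y, segment ℝ x y ⊆ U → ∀ i j,
    |A x i j - A y i j| ≤ C0 * (‖x - y‖ + ‖fderiv ℝ w x - fderiv ℝ w y‖)
  trHess_le : ∀ x ∈ U, |trHess (A x) (fderiv ℝ (fderiv ℝ w) x)| ≤ C0
  norm_fderiv_le : ∀ x ∈ U, ‖fderiv ℝ w x‖ ≤ C0

theorem exists_admissible_gradient_bound (n : ℕ) {lam C0 : ℝ} (hl : 0 < lam) (hC0 : 0 ≤ C0) :
    ∃ C > 0, ∀ (U : Set (Eu n)) (w : Eu n → ℝ) (A : Eu n → Matrix (Fin n) (Fin n) ℝ),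
      IsAdmissible U w A lam C0 → ∀ (y0 : Eu n) (ρ S : ℝ), 0 < ρ → Metric.closedBall y0 ρ ⊆ U →
      (∀ x ∈ Metric.closedBall y0 ρ, |w x| ≤ S) → ‖fderiv ℝ w y0‖ ≤ C * (S / ρ + ρ) := by
  obtain ⟨C, hC, H⟩ := exists_gradient_bound n (K' := C0) hl hC0 hC0 hC0
  refine ⟨C, hC, fun U w A h y0 ρ S hρ hU hS => H w A y0 ρ S hρ (fun x hx => h.contDiffAt x (hU hx))
    (fun x hx => h.elliptic x (hU hx)) (fun x hx y hy => h.coeff_sub_le x y ?_)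
    (fun x hx => h.trHess_le x (hU hx)) (fun x hx => h.norm_fderiv_le x (hU hx)) hS⟩
  exact ((convex_closedBall y0 ρ).segment_subset hx hy).trans hU

theorem abs_trHess_le {A : Matrix (Fin n) (Fin n) ℝ} {B : Eu n →L[ℝ] Eu n →L[ℝ] ℝ} {a b : ℝ}
    (hA : ∀ i j, |A i j| ≤ a) (hB : ‖B‖ ≤ b) : |trHess A B| ≤ n ^ 2 * (a * b) := by
  have h : ∀ i j, |A i j * B (EuclideanSpace.single i 1) (EuclideanSpace.single j 1)| ≤ a * b :=
    fun i j => by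
      have h1 := B.le_opNorm₂ (EuclideanSpace.single i 1) (EuclideanSpace.single j 1)
      have hk1 : ∀ k : Fin n, ‖(EuclideanSpace.single k 1 : Eu n)‖ = 1 := fun k => by simp
      rw [hk1, hk1, mul_one, mul_one] at h1
      rw [abs_mul]
      exact mul_le_mul (hA i j) (h1.trans hB) (abs_nonneg _) ((abs_nonneg _).trans (hA i j))
  calc |trHess A B| ≤ ∑ _i : Fin n, ∑ _j : Fin n, a * b :=
        (Finset.abs_sum_le_sum_abs _ _).trans (Finset.sum_le_sum fun i _ =>
          (Finset.abs_sum_le_sum_abs _ _).trans (Finset.sum_le_sum fun j _ => h i j))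
    _ = _ := by simp; ring

theorem barrier_arith {lam C0 C1 ρ μ σ ε N S2 tF tA E : ℝ}
    (hρ : 0 < ρ) (hρ1 : ρ ≤ 1) (hμ0 : 0 < μ) (hε0 : 0 ≤ ε) (hC : 0 ≤ C0 * C1)
    (hN : 0 ≤ N) (hμ : N * (C0 * C1) + 2 * (N * C0) + 1 ≤ μ * (lam * σ ^ 2))
    (hS : lam * σ ^ 2 ≤ S2) (hF : -(N * (C0 * C1)) ≤ tF) (htA : tA ≤ N * C0) (hE : 1 ≤ E)
    (hε : C0 < ε * (μ / ρ ^ 2))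
    (h : ε * (E * ((μ / ρ) ^ 2 * S2 + μ / ρ * (tF - 2 / ρ * tA))) ≤ C0) : False := by
  have h1 : μ / ρ ^ 2 ≤ (μ / ρ) ^ 2 * S2 + μ / ρ * (tF - 2 / ρ * tA) := by
    have e1 : (μ / ρ) ^ 2 * S2 + μ / ρ * (tF - 2 / ρ * tA) =
        μ / ρ ^ 2 * (μ * S2 + (ρ * tF - 2 * tA)) := by field_simp
    rw [e1]
    refine le_mul_of_one_le_right (by positivity) ?_
    have a1 : μ * (lam * σ ^ 2) ≤ μ * S2 := mul_le_mul_of_nonneg_left hS hμ0.le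
    have a2 : ρ * -(N * (C0 * C1)) ≤ ρ * tF := mul_le_mul_of_nonneg_left hF hρ.le
    have a3 : ρ * (N * (C0 * C1)) ≤ N * (C0 * C1) :=
      mul_le_of_le_one_left (mul_nonneg hN hC) hρ1
    linarith
  have h2 : μ / ρ ^ 2 ≤ E * ((μ / ρ) ^ 2 * S2 + μ / ρ * (tF - 2 / ρ * tA)) :=
    h1.trans (le_mul_of_one_le_left (le_trans (by positivity) h1) hE)
  have := mul_le_mul_of_nonneg_left h2 hε0
  linarith

theorem barrier_le {U : Set (Eu n)} {w F : Eu n → ℝ} {A : Eu n → Matrix (Fin n) (Fin n) ℝ}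
    {lam C0 C1 ρ μ σ ε r : ℝ} {p : Eu n} (hl : 0 < lam) (hC0 : 0 ≤ C0) (hC1 : 0 ≤ C1)
    (hw : IsAdmissible U w A lam C0)
    (hρ : 0 < ρ) (hρ1 : ρ ≤ 1) (hμ0 : 0 < μ) (hε0 : 0 ≤ ε) (hσ : 0 ≤ σ) (hr : 0 ≤ r)
    (hF : ∀ x ∈ Metric.closedBall p r, ContDiffAt ℝ 2 F x)
    (hF2 : ∀ x ∈ Metric.closedBall p r, ‖fderiv ℝ (fderiv ℝ F) x‖ ≤ C1)
    (hU : ∀ x ∈ Metric.closedBall p r, 0 < F x → x ∈ U)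
    (hw0 : ∀ x ∈ Metric.closedBall p r, 0 < F x → 0 ≤ w x)
    (hsph : ∀ x, ‖x - p‖ = r → F x - ‖x - p‖ ^ 2 / ρ < 0) (hFp : 0 < F p)
    (hgood : ∀ x ∈ Metric.closedBall p r, 0 < F x → 0 ≤ F x - ‖x - p‖ ^ 2 / ρ →
      ε * Real.exp (μ / ρ * (F x - ‖x - p‖ ^ 2 / ρ)) ≤ w x ∨
        σ ≤ ‖fderiv ℝ F x - (2 / ρ) • innerSL ℝ (x - p)‖)
    (hμ : n ^ 2 * (C0 * C1) + 2 * (n ^ 2 * C0) + 1 ≤ μ * (lam * σ ^ 2))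
    (hε : C0 < ε * (μ / ρ ^ 2)) :
    ε * (Real.exp (μ / ρ * F p) - 1) ≤ w p := by
  set Θ : Eu n → ℝ := fun x => F x - ‖x - p‖ ^ 2 / ρ with hΘ
  set g : Eu n → ℝ := fun x => ε * (Real.exp (μ / ρ * Θ x) - 1) - w x with hg
  set D : Set (Eu n) := Metric.closedBall p r ∩ Θ ⁻¹' Ici 0 with hD
  have hΘc : ContinuousOn Θ (Metric.closedBall p r) := fun x hx =>
    ((hF x hx).continuousAt.sub (by fun_prop)).continuousWithinAt
  have hDc : IsCompact D := (isCompact_closedBall p r).of_isClosed_subset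
    (hΘc.preimage_isClosed_of_isClosed Metric.isClosed_closedBall isClosed_Ici) inter_subset_left
  have hpD : p ∈ D := ⟨Metric.mem_closedBall_self hr, by simp [hΘ, hFp.le]⟩
  have hDF : ∀ x ∈ D, 0 < F x := fun x hx => by
    have h1 : 0 ≤ F x - ‖x - p‖ ^ 2 / ρ := hx.2
    rcases eq_or_ne x p with rfl | hne
    · exact hFp
    · have : 0 < ‖x - p‖ := norm_pos_iff.mpr (sub_ne_zero.mpr hne)
      have : 0 < ‖x - p‖ ^ 2 / ρ := by positivity
      linarith
  have hgc : ContinuousOn g D := by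
    have h1 : ContinuousOn w D := fun x hx =>
      (hw.contDiffAt x (hU x hx.1 (hDF x hx))).continuousAt.continuousWithinAt
    have h2 : ContinuousOn Θ D := hΘc.mono inter_subset_left
    exact (continuousOn_const.mul (((continuousOn_const.mul h2).rexp).sub continuousOn_const)).sub h1
  obtain ⟨x, hxD, hmax⟩ := hDc.exists_isMaxOn ⟨p, hpD⟩ hgc
  have hgp : g p = ε * (Real.exp (μ / ρ * F p) - 1) - w p := by simp [hg, hΘ]
  suffices h : g x ≤ 0 by
    have : g p ≤ g x := hmax hpD
    linarith
  by_contra! hpos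
  have hFx := hDF x hxD
  have hxU := hU x hxD.1 hFx
  have hΘ0 : 0 ≤ Θ x := hxD.2
  have hΘpos : 0 < Θ x := by
    refine lt_of_le_of_ne hΘ0 fun h0 => ?_
    have h1 := hw0 x hxD.1 hFx
    rw [hg] at hpos
    simp only [← h0, mul_zero, Real.exp_zero, sub_self] at hpos
    linarith
  have hxb : x ∈ Metric.ball p r := by
    rw [mem_ball_iff_norm]
    refine lt_of_le_of_ne (mem_closedBall_iff_norm.mp hxD.1) fun h => ?_
    exact absurd (hsph x h) (not_lt.mpr hΘ0)
  have hσx : σ ≤ ‖fderiv ℝ F x - (2 / ρ) • innerSL ℝ (x - p)‖ := by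
    refine (hgood x hxD.1 hFx hΘ0).resolve_left fun h => ?_
    have : ε * (Real.exp (μ / ρ * Θ x) - 1) - w x > 0 := hpos
    have h' : ε * Real.exp (μ / ρ * Θ x) ≤ w x := h
    linarith
  have hFd := hF x hxD.1
  have hwd := hw.contDiffAt x hxU
  have hDn : ∀ᶠ y in 𝓝 x, y ∈ D := by
    have h1 := Metric.isOpen_ball.mem_nhds hxb
    have h2 : ContinuousAt Θ x := hFd.continuousAt.sub (by fun_prop)
    filter_upwards [h1, h2.eventually (Ioi_mem_nhds hΘpos)] with y hy1 hy2
    exact ⟨Metric.ball_subset_closedBall hy1, le_of_lt hy2⟩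
  set E := Real.exp (μ / ρ * Θ x) with hE
  have hE1 : 1 ≤ E := Real.one_le_exp (by positivity)
  have hjet : ∀ ξ : Eu n, ε * (E * ((μ / ρ) ^ 2 * (fderiv ℝ F x - (2 / ρ) • innerSL ℝ (x - p)) ξ ^ 2
      + μ / ρ * (fderiv ℝ (fderiv ℝ F) x ξ ξ - 2 / ρ * ‖ξ‖ ^ 2)))
      - fderiv ℝ (fderiv ℝ w) x ξ ξ ≤ 0 := fun ξ => by
    have j1 := ((hasJet_line hFd ξ).sub
      ((hasJet_norm_sq (x - p) ξ).const_mul (1 / ρ))).const_mul (μ / ρ)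
    have j2 := ((j1.comp (ψ := Real.exp) (ψ' := Real.exp)
      (Filter.Eventually.of_forall fun s => Real.hasDerivAt_exp s)
      (Real.hasDerivAt_exp _)).sub (HasJet.const 1)).const_mul ε
    have j3 := j2.sub (hasJet_line hwd ξ)
    have hm : IsLocalMax (fun t : ℝ => g (x + t • ξ)) 0 := by
      have hc : ContinuousAt (fun t : ℝ => x + t • ξ) 0 := by fun_prop
      have : ∀ᶠ t in 𝓝 (0 : ℝ), x + t • ξ ∈ D :=
        hc.tendsto.eventually (p := fun y => y ∈ D) (by rwa [zero_smul, add_zero])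
      filter_upwards [this] with t ht
      simpa using hmax ht
    have j4 := (j3.congr (g := fun t : ℝ => g (x + t • ξ)) (fun t => by
      simp only [hg, hΘ]
      rw [show x + t • ξ - p = x - p + t • ξ by abel]
      ring_nf) rfl rfl).of_isLocalMax hm
    have hev : Real.exp (μ / ρ * (F (x + (0 : ℝ) • ξ) - 1 / ρ * ‖x - p + (0 : ℝ) • ξ‖ ^ 2)) = E := by
      rw [hE, hΘ]; simp only [zero_smul, add_zero]; ring_nf
    rw [hev] at j4
    refine le_of_eq_of_le ?_ j4.2
    simp only [sub_apply, smul_apply, innerSL_apply_apply, smul_eq_mul]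
    ring
  obtain ⟨ξ, hξ⟩ := (hw.elliptic x hxU).exists_factor hl.le
  have hsum := Finset.sum_nonpos fun k (_ : k ∈ Finset.univ) => hjet (ξ k)
  simp only [Finset.sum_sub_distrib, Finset.sum_add_distrib, ← Finset.mul_sum] at hsum
  rw [sum_bilin_eq_trHess hξ, sum_bilin_eq_trHess hξ, sum_norm_sq_eq hξ] at hsum
  have hS2 := (hw.elliptic x hxU).le_sum_sq hξ (fderiv ℝ F x - (2 / ρ) • innerSL ℝ (x - p))
  refine barrier_arith (E := E) hρ hρ1 hμ0 hε0 (mul_nonneg hC0 hC1) (sq_nonneg (n : ℝ)) hμ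
    (le_trans (mul_le_mul_of_nonneg_left (pow_le_pow_left₀ hσ hσx 2) hl.le) hS2)
    (abs_le.mp (abs_trHess_le (hw.elliptic x hxU).upper (hF2 x hxD.1))).1
    ((hw.elliptic x hxU).trace_le.trans ?_) hE1 hε
    (by linarith [(abs_le.mp (hw.trHess_le x hxU)).2])
  refine mul_le_mul_of_nonneg_right ?_ hC0
  exact_mod_cast Nat.le_self_pow two_ne_zero n

end

section

variable {n : ℕ}

/-- A defining function `F` of `U` in the ball of radius `r` around `x0`, with quantitative bounds
and a direction `ν` transversal to its level sets. -/
structure BoundaryChart (U : Set (Eu n)) (F : Eu n → ℝ) (ν x0 : Eu n) (r c C1 : ℝ) : Prop where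
  norm_dir : ‖ν‖ = 1
  pos : 0 < c
  le_one : c ≤ 1
  one_le : 1 ≤ C1
  contDiffAt : ∀ x ∈ Metric.ball x0 r, ContDiffAt ℝ 2 F x
  norm_fderiv_le : ∀ x ∈ Metric.ball x0 r, ‖fderiv ℝ F x‖ ≤ C1
  norm_fderiv_fderiv_le : ∀ x ∈ Metric.ball x0 r, ‖fderiv ℝ (fderiv ℝ F) x‖ ≤ C1
  le_fderiv_dir : ∀ x ∈ Metric.ball x0 r, c ≤ fderiv ℝ F x ν
  mem_iff : ∀ x ∈ Metric.ball x0 r, x ∈ U ↔ 0 < F x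

namespace BoundaryChart

variable {U : Set (Eu n)} {F : Eu n → ℝ} {ν x0 : Eu n} {r c C1 : ℝ}

theorem le_norm_fderiv (h : BoundaryChart U F ν x0 r c C1) {x : Eu n}
    (hx : x ∈ Metric.ball x0 r) : c ≤ ‖fderiv ℝ F x‖ := by
  have := (fderiv ℝ F x).le_opNorm ν
  rw [h.norm_dir, mul_one] at this
  exact (h.le_fderiv_dir x hx).trans ((le_abs_self _).trans this)

theorem abs_sub_le (h : BoundaryChart U F ν x0 r c C1) {x y : Eu n}
    (hx : x ∈ Metric.ball x0 r) (hy : y ∈ Metric.ball x0 r) : |F x - F y| ≤ C1 * ‖x - y‖ :=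
  (convex_ball x0 r).norm_image_sub_le_of_norm_fderiv_le
    (fun z hz => (h.contDiffAt z hz).differentiableAt (by norm_num)) h.norm_fderiv_le hy hx

theorem norm_fderiv_sub_le (h : BoundaryChart U F ν x0 r c C1) {x y : Eu n}
    (hx : x ∈ Metric.ball x0 r) (hy : y ∈ Metric.ball x0 r) :
    ‖fderiv ℝ F x - fderiv ℝ F y‖ ≤ C1 * ‖x - y‖ :=
  (convex_ball x0 r).norm_image_sub_le_of_norm_fderiv_le
    (fun z hz => ((h.contDiffAt z hz).fderiv_right (m := 1) (by norm_num)).differentiableAt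
      (by norm_num)) h.norm_fderiv_fderiv_le hy hx

theorem abs_sub_sub_le (h : BoundaryChart U F ν x0 r c C1) {x y : Eu n}
    (hx : x ∈ Metric.ball x0 r) (hy : y ∈ Metric.ball x0 r) :
    |F y - F x - fderiv ℝ F x (y - x)| ≤ C1 * ‖y - x‖ ^ 2 := by
  have hs := (convex_ball x0 r).segment_subset hx hy
  have := (convex_segment x y).norm_image_sub_le_of_norm_fderiv_le' (𝕜 := ℝ) (f := F)
    (φ := fderiv ℝ F x) (C := C1 * ‖y - x‖)
    (fun z hz => (h.contDiffAt z (hs hz)).differentiableAt (by norm_num))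
    (fun z hz => (h.norm_fderiv_sub_le (hs hz) hx).trans (mul_le_mul_of_nonneg_left
      (norm_sub_le_of_mem_segment hz) (zero_le_one.trans h.one_le)))
    (left_mem_segment ℝ x y) (right_mem_segment ℝ x y)
  rw [Real.norm_eq_abs] at this
  linarith [mul_assoc C1 ‖y - x‖ ‖y - x‖, sq ‖y - x‖]

end BoundaryChart

theorem quad_lower {c C1 ρ N q : ℝ} (hc : 0 < c) (hN : c ≤ N) (hρ : 0 < ρ) (h : C1 * ρ ≤ 1)
    (hq : |q - ρ / 2 * N ^ 2| ≤ C1 * (ρ / 2 * N) ^ 2) : c ^ 2 * ρ / 4 ≤ q := by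
  have h1 := (abs_le.mp hq).1
  have h2 : c ^ 2 ≤ N ^ 2 := pow_le_pow_left₀ hc.le hN 2
  have h3 : C1 * ρ * (ρ * N ^ 2) ≤ 1 * (ρ * N ^ 2) := mul_le_mul_of_nonneg_right h (by positivity)
  have h4 : ρ * c ^ 2 ≤ ρ * N ^ 2 := mul_le_mul_of_nonneg_left h2 hρ.le
  have h5 : 0 ≤ ρ * c ^ 2 := by positivity
  nlinarith

/-- The constants of the decay estimate. -/
theorem exists_decay_consts (n : ℕ) {lam C0 c C1 C : ℝ} (hl : 0 < lam) (hC0 : 0 ≤ C0) (hc : 0 < c)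
    (hc1 : c ≤ 1) (hC1 : 1 ≤ C1) (hC : 0 < C) :
    ∃ κ > 0, ∃ σ > 0, ∃ μ > 0, κ ≤ 1 ∧ σ ≤ κ ∧ κ * C1 = c ^ 2 / 16 ∧
      σ * (C * (C1 * (C1 + 3) / κ + 1)) ≤ c ^ 2 / 16 ∧
      n ^ 2 * (C0 * C1) + 2 * (n ^ 2 * C0) + 1 ≤ μ * (lam * σ ^ 2) := by
  have hC1' : 0 < C1 := by linarith
  have hκ : 0 < c ^ 2 / (16 * C1) := by positivity
  set κ := c ^ 2 / (16 * C1) with hκd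
  have hD : 0 < C * (C1 * (C1 + 3) / κ + 1) := by positivity
  set D := C * (C1 * (C1 + 3) / κ + 1) with hDd
  have hσ : 0 < min κ (c ^ 2 / 16 / D) := lt_min hκ (by positivity)
  set σ := min κ (c ^ 2 / 16 / D) with hσd
  have hls : 0 < lam * σ ^ 2 := by positivity
  refine ⟨κ, hκ, σ, hσ, (n ^ 2 * (C0 * C1) + 2 * (n ^ 2 * C0) + 1) / (lam * σ ^ 2), by positivity,
    ?_, min_le_left _ _, by rw [hκd]; field_simp, ?_, ?_⟩
  · rw [hκd, div_le_one (by positivity)]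
    nlinarith
  · exact (le_div_iff₀ hD).mp (min_le_right _ _)
  · rw [div_mul_cancel₀ _ hls.ne']

theorem mem_ball_of_le {x p : Eu n} {a b : ℝ} (h : ‖x - p‖ ≤ a) (hab : a < b) :
    x ∈ Metric.ball p b := by
  rw [mem_ball_iff_norm]; linarith

set_option maxHeartbeats 1000000 in
/-- Lower bound for `w` near the point `z + (ρ / 2) ∇F(z)`. -/
theorem BoundaryChart.interior_lower {U : Set (Eu n)} {F w : Eu n → ℝ} {ν x0 z g : Eu n}
    {A : Eu n → Matrix (Fin n) (Fin n) ℝ} {r c C1 C lam C0 κ σ ρ ω : ℝ}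
    (h : BoundaryChart U F ν x0 r c C1) (hw : IsAdmissible U w A lam C0) (hC : 0 < C)
    (hgrad : ∀ (y0 : Eu n) (ρ S : ℝ), 0 < ρ → Metric.closedBall y0 ρ ⊆ U →
      (∀ x ∈ Metric.closedBall y0 ρ, |w x| ≤ S) → ‖fderiv ℝ w y0‖ ≤ C * (S / ρ + ρ))
    (hκ : 0 < κ) (hκ1 : κ ≤ 1) (hσ : 0 < σ) (hσκ : σ ≤ κ) (hκC : κ * C1 = c ^ 2 / 16)
    (hσC : σ * (C * (C1 * (C1 + 3) / κ + 1)) ≤ c ^ 2 / 16)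
    (hρ : 0 < ρ) (hρC : C1 * ρ ≤ 1) (hsub : Metric.ball z ((C1 + 3) * ρ) ⊆ Metric.ball x0 r)
    (hz : F z = 0) (hg : innerSL ℝ g = fderiv ℝ F z)
    (hwF : ∀ x ∈ Metric.ball z ((C1 + 3) * ρ), x ∈ U → 0 ≤ w x ∧ w x ≤ ω * F x)
    (hx1 : ω * F (z + (ρ / 2) • g) / 2 ≤ w (z + (ρ / 2) • g)) (hω : ρ ≤ ω) :
    ∀ x ∈ Metric.closedBall (z + (ρ / 2) • g) (σ * ρ), c ^ 2 / 16 * (ω * ρ) ≤ w x := by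
  set x1 := z + (ρ / 2) • g with hx1d
  have hC1 := h.one_le
  have hc := h.pos
  have hω0 : 0 < ω := by linarith
  have hzb : z ∈ Metric.ball z ((C1 + 3) * ρ) := Metric.mem_ball_self (by positivity)
  have hgn : ‖g‖ = ‖fderiv ℝ F z‖ := by rw [← hg, innerSL_apply_norm]
  have hgC : ‖g‖ ≤ C1 := hgn ▸ h.norm_fderiv_le z (hsub hzb)
  have hx1z : ‖x1 - z‖ = ρ / 2 * ‖g‖ := by
    rw [hx1d, add_sub_cancel_left, norm_smul, Real.norm_eq_abs, abs_of_pos (by positivity)]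
  have hx1z' : ‖x1 - z‖ ≤ ρ / 2 * C1 := by
    rw [hx1z]; exact mul_le_mul_of_nonneg_left hgC (by positivity)
  have hball : ∀ y, ‖y - x1‖ ≤ 2 * (κ * ρ) → y ∈ Metric.ball z ((C1 + 3) * ρ) := fun y hy => by
    have h1 := norm_sub_le_norm_sub_add_norm_sub y x1 z
    have h2 : κ * ρ ≤ ρ := mul_le_of_le_one_left hρ.le hκ1
    have h3 : 0 < C1 * ρ := by positivity
    exact mem_ball_of_le (h1.trans (add_le_add hy hx1z')) (by nlinarith)
  have hx1b : x1 ∈ Metric.ball z ((C1 + 3) * ρ) := hball x1 (by simp; positivity)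
  have hFx1 : c ^ 2 * ρ / 4 ≤ F x1 := by
    refine quad_lower hc (hgn ▸ h.le_norm_fderiv (hsub hzb)) hρ hρC ?_
    have h1 := h.abs_sub_sub_le (hsub hzb) (hsub hx1b)
    rw [hz, hx1z] at h1
    convert h1 using 2
    rw [← hg, hx1d, add_sub_cancel_left, map_smul, innerSL_apply_apply, real_inner_self_eq_norm_sq,
      smul_eq_mul]
    ring
  have hFy : ∀ y, ‖y - x1‖ ≤ 2 * (κ * ρ) → 0 < F y := fun y hy => by
    have h1 := (abs_le.mp (h.abs_sub_le (hsub (hball y hy)) (hsub hx1b))).1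
    have h2 : C1 * ‖y - x1‖ ≤ 2 * ρ * (κ * C1) := by nlinarith
    rw [hκC] at h2
    have : 0 < c ^ 2 * ρ := by positivity
    nlinarith
  have hyU : ∀ y, ‖y - x1‖ ≤ 2 * (κ * ρ) → y ∈ U := fun y hy =>
    (h.mem_iff y (hsub (hball y hy))).2 (hFy y hy)
  have hwS : ∀ y, ‖y - x1‖ ≤ 2 * (κ * ρ) → |w y| ≤ ω * (C1 * (C1 + 3) * ρ) := fun y hy => by
    have h1 := hwF y (hball y hy) (hyU y hy)
    rw [abs_of_nonneg h1.1]
    refine h1.2.trans (mul_le_mul_of_nonneg_left ?_ hω0.le)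
    have h2 := (abs_le.mp (h.abs_sub_le (hsub (hball y hy)) (hsub hzb))).2
    have h3 := mem_ball_iff_norm.mp (hball y hy)
    rw [hz] at h2
    nlinarith
  have hσκρ : σ * ρ ≤ κ * ρ := mul_le_mul_of_nonneg_right hσκ hρ.le
  have hgr : ∀ y ∈ Metric.closedBall x1 (σ * ρ),
      ‖fderiv ℝ w y‖ ≤ C * (C1 * (C1 + 3) / κ + 1) * ω := fun y hy => by
    rw [mem_closedBall_iff_norm] at hy
    have hsm : ∀ x ∈ Metric.closedBall y (κ * ρ), ‖x - x1‖ ≤ 2 * (κ * ρ) := fun x hx => by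
      have := norm_sub_le_norm_sub_add_norm_sub x y x1
      rw [mem_closedBall_iff_norm] at hx
      linarith
    refine (hgrad y (κ * ρ) _ (by positivity) (fun x hx => hyU x (hsm x hx))
      (fun x hx => hwS x (hsm x hx))).trans ?_
    rw [mul_assoc C (C1 * (C1 + 3) / κ + 1) ω]
    refine mul_le_mul_of_nonneg_left ?_ hC.le
    have h1 : ω * (C1 * (C1 + 3) * ρ) / (κ * ρ) = C1 * (C1 + 3) / κ * ω := by field_simp
    have h2 : κ * ρ ≤ ρ := mul_le_of_le_one_left hρ.le hκ1
    rw [h1]; linarith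
  intro y hy
  have h1 := (convex_closedBall x1 (σ * ρ)).norm_image_sub_le_of_norm_fderiv_le (𝕜 := ℝ) (f := w)
    (fun x hx => (hw.contDiffAt x (hyU x ((mem_closedBall_iff_norm.mp hx).trans
      (by nlinarith [mul_pos hκ hρ])))).differentiableAt (by norm_num)) hgr
    (Metric.mem_closedBall_self (by positivity)) hy
  have h2 := (abs_le.mp h1).1
  have h3 : C * (C1 * (C1 + 3) / κ + 1) * ω * ‖y - x1‖ ≤
      σ * (C * (C1 * (C1 + 3) / κ + 1)) * (ω * ρ) := by
    calc _ ≤ C * (C1 * (C1 + 3) / κ + 1) * ω * (σ * ρ) :=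
          mul_le_mul_of_nonneg_left (mem_closedBall_iff_norm.mp hy) (by positivity)
      _ = _ := by ring
  have h4 := mul_le_mul_of_nonneg_right hσC (by positivity : 0 ≤ ω * ρ)
  have h5 := mul_le_mul_of_nonneg_left hFx1 hω0.le
  have h6 : ω * (c ^ 2 * ρ / 4) = 4 * (c ^ 2 / 16 * (ω * ρ)) := by ring
  linarith

set_option maxHeartbeats 1000000 in
theorem exists_decay (n : ℕ) {lam C0 c C1 : ℝ} (hl : 0 < lam) (hC0 : 0 ≤ C0) (hc : 0 < c)
    (hc1 : c ≤ 1) (hC1 : 1 ≤ C1) :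
    ∃ η ∈ Ioc (0 : ℝ) 1, ∃ c5 ∈ Ioo (0 : ℝ) 1, ∃ C4 ≥ (1 : ℝ), ∃ ρ0 ∈ Ioc (0 : ℝ) 1,
      ∀ (U : Set (Eu n)) (F : Eu n → ℝ) (ν x0 : Eu n) (r : ℝ), BoundaryChart U F ν x0 r c C1 →
      ∀ (w : Eu n → ℝ) (A : Eu n → Matrix (Fin n) (Fin n) ℝ), IsAdmissible U w A lam C0 →
      ∀ (z g : Eu n) (ρ ω : ℝ), 0 < ρ → ρ ≤ ρ0 →
      Metric.ball z ((C1 + 3) * ρ) ⊆ Metric.ball x0 r → F z = 0 → innerSL ℝ g = fderiv ℝ F z →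
      (∀ x ∈ Metric.ball z ((C1 + 3) * ρ), x ∈ U → 0 ≤ w x ∧ w x ≤ ω * F x) →
      ω * F (z + (ρ / 2) • g) / 2 ≤ w (z + (ρ / 2) • g) → C4 * ρ ≤ ω →
      ∀ x ∈ Metric.ball z (η * ρ), x ∈ U → c5 * (ω * F x) ≤ w x := by
  obtain ⟨C, hC, hgrad⟩ := exists_admissible_gradient_bound n hl hC0
  obtain ⟨κ, hκ, σ, hσ, μ, hμ, hκ1, hσκ, hκC, hσC, hμσ⟩ :=
    exists_decay_consts n hl hC0 hc hc1 hC1 hC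
  have hC1' : 0 < C1 := by linarith
  set L := C1 * (C1 + 2) with hL
  have hL0 : 0 < L := by positivity
  set e := c ^ 2 / 16 * Real.exp (-(μ * L)) with he
  have he0 : 0 < e := by positivity
  have hσ1 : σ ≤ 1 := hσκ.trans hκ1
  refine ⟨σ / 8, ⟨by positivity, by linarith⟩, min (e * μ) (1 / 2),
    ⟨lt_min (by positivity) (by norm_num), (min_le_right _ _).trans_lt (by norm_num)⟩,
    (C0 + 1) / (e * μ) + 1, by linarith [show 0 < (C0 + 1) / (e * μ) by positivity],
    min (1 / C1) (σ / (4 * L)), ⟨lt_min (by positivity) (by positivity), (min_le_left _ _).trans ?_⟩,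
    ?_⟩
  · rw [div_le_one hC1']; exact hC1
  intro U F ν x0 r h w A hw z g ρ ω hρ hρ0 hsub hz hg hwF hx1 hω p hp hpU
  have hρC : C1 * ρ ≤ 1 := by
    have := (le_div_iff₀ hC1').mp (hρ0.trans (min_le_left _ _))
    linarith
  have hρL : L * ρ ≤ σ / 4 := by
    have := (le_div_iff₀ (by positivity)).mp (hρ0.trans (min_le_right _ _))
    linarith
  have hρ1 : ρ ≤ 1 := by nlinarith
  have hωρ : ρ ≤ ω := by
    have : 0 ≤ (C0 + 1) / (e * μ) * ρ := by positivity
    linarith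
  have hω0 : 0 < ω := by linarith
  have hlow := h.interior_lower hw hC (hgrad U w A hw) hκ hκ1 hσ hσκ hκC hσC hρ hρC hsub hz hg hwF
    hx1 hωρ
  have hpz := mem_ball_iff_norm.mp hp
  have hσρ : σ * ρ ≤ ρ := mul_le_of_le_one_left hρ.le hσ1
  have hmem : ∀ x, ‖x - p‖ ≤ (C1 + 1) * ρ → ‖x - z‖ ≤ (C1 + 2) * ρ := fun x hx => by
    have := norm_sub_le_norm_sub_add_norm_sub x p z
    nlinarith
  have hb : ∀ x ∈ Metric.closedBall p ((C1 + 1) * ρ), x ∈ Metric.ball z ((C1 + 3) * ρ) :=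
    fun x hx => mem_ball_of_le (hmem x (mem_closedBall_iff_norm.mp hx)) (by nlinarith)
  have hzb : z ∈ Metric.ball z ((C1 + 3) * ρ) := Metric.mem_ball_self (by positivity)
  have hpc : p ∈ Metric.closedBall p ((C1 + 1) * ρ) := Metric.mem_closedBall_self (by positivity)
  have hFz : ∀ x ∈ Metric.closedBall p ((C1 + 1) * ρ), F x ≤ C1 * ‖x - z‖ := fun x hx => by
    have := (abs_le.mp (h.abs_sub_le (hsub (hb x hx)) (hsub hzb))).2
    linarith
  have hFp : 0 < F p := (h.mem_iff p (hsub (hb p hpc))).1 hpU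
  have hbar := barrier_le (ε := e * (ω * ρ)) (μ := μ) (σ := σ) (r := (C1 + 1) * ρ) (F := F)
    (p := p) hl hC0 hC1'.le hw hρ hρ1 hμ (by positivity) hσ.le (by positivity)
    (fun x hx => h.contDiffAt x (hsub (hb x hx)))
    (fun x hx => h.norm_fderiv_fderiv_le x (hsub (hb x hx)))
    (fun x hx => (h.mem_iff x (hsub (hb x hx))).2)
    (fun x hx hF => (hwF x (hb x hx) ((h.mem_iff x (hsub (hb x hx))).2 hF)).1) ?_ hFp ?_ hμσ ?_
  · have h1 : μ / ρ * F p ≤ Real.exp (μ / ρ * F p) - 1 := by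
      linarith [Real.add_one_le_exp (μ / ρ * F p)]
    have h2 := mul_le_mul_of_nonneg_left h1 (by positivity : 0 ≤ e * (ω * ρ))
    have h3 : e * (ω * ρ) * (μ / ρ * F p) = e * μ * (ω * F p) := by field_simp
    have h4 : min (e * μ) (1 / 2) * (ω * F p) ≤ e * μ * (ω * F p) :=
      mul_le_mul_of_nonneg_right (min_le_left _ _) (by positivity)
    linarith
  · intro x hx
    have hxc : x ∈ Metric.closedBall p ((C1 + 1) * ρ) := mem_closedBall_iff_norm.mpr hx.le
    have h1 := (abs_le.mp (h.abs_sub_le (hsub (hb x hxc)) (hsub (hb p hpc)))).2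
    have h2 := hFz p hpc
    rw [hx] at h1 ⊢
    have h3 : ((C1 + 1) * ρ) ^ 2 / ρ = (C1 + 1) ^ 2 * ρ := by field_simp
    have h4 : C1 * ‖p - z‖ ≤ C1 * ρ := mul_le_mul_of_nonneg_left (by linarith) hC1'.le
    rw [h3]
    nlinarith
  · intro x hx hFx hΘ
    have hxz := hmem x (mem_closedBall_iff_norm.mp hx)
    refine (le_or_gt σ ‖fderiv ℝ F x - (2 / ρ) • innerSL ℝ (x - p)‖).symm.imp (fun hlt => ?_) id
    have hx1 : x ∈ Metric.closedBall (z + (ρ / 2) • g) (σ * ρ) := by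
      have e1 : innerSL ℝ (g - (2 / ρ) • (x - p)) = (fderiv ℝ F z - fderiv ℝ F x) +
          (fderiv ℝ F x - (2 / ρ) • innerSL ℝ (x - p)) := by
        rw [map_sub, map_smul, hg]; abel
      have h1 : ‖g - (2 / ρ) • (x - p)‖ ≤ L * ρ + σ := by
        rw [← innerSL_apply_norm (𝕜 := ℝ), e1]
        have h2 := h.norm_fderiv_sub_le (hsub (hb x hx)) (hsub hzb)
        rw [norm_sub_rev] at h2
        have h3 := mul_le_mul_of_nonneg_left hxz hC1'.le
        have h4 : C1 * ((C1 + 2) * ρ) = L * ρ := by rw [hL]; ring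
        refine (norm_add_le _ _).trans ?_
        linarith
      have e2 : x - (z + (ρ / 2) • g) = (p - z) - (ρ / 2) • (g - (2 / ρ) • (x - p)) := by
        rw [smul_sub, smul_smul, show ρ / 2 * (2 / ρ) = 1 by field_simp, one_smul]; abel
      rw [mem_closedBall_iff_norm, e2]
      refine (norm_sub_le _ _).trans ?_
      rw [norm_smul, Real.norm_eq_abs, abs_of_pos (by positivity)]
      have h5 := mul_le_mul_of_nonneg_left h1 (by positivity : 0 ≤ ρ / 2)
      nlinarith
    have h1 := hlow x hx1
    refine le_trans ?_ h1
    have h2 : μ / ρ * (F x - ‖x - p‖ ^ 2 / ρ) ≤ μ * L := by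
      have h3 : F x - ‖x - p‖ ^ 2 / ρ ≤ L * ρ := by
        have h4 := hFz x hx
        have h5 := mul_le_mul_of_nonneg_left hxz hC1'.le
        have h6 : C1 * ((C1 + 2) * ρ) = L * ρ := by rw [hL]; ring
        have : 0 ≤ ‖x - p‖ ^ 2 / ρ := by positivity
        linarith
      calc _ ≤ μ / ρ * (L * ρ) := mul_le_mul_of_nonneg_left h3 (by positivity)
        _ = _ := by field_simp
    calc e * (ω * ρ) * Real.exp (μ / ρ * (F x - ‖x - p‖ ^ 2 / ρ))
        ≤ e * (ω * ρ) * Real.exp (μ * L) :=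
          mul_le_mul_of_nonneg_left (Real.exp_le_exp.mpr h2) (by positivity)
      _ = c ^ 2 / 16 * (ω * ρ) * (Real.exp (-(μ * L)) * Real.exp (μ * L)) := by rw [he]; ring
      _ = _ := by rw [← Real.exp_add]; simp
  · have h1 : (C0 + 1) / (e * μ) * ρ < ω := by linarith
    have h2 : e * (ω * ρ) * (μ / ρ ^ 2) = e * μ * ω / ρ := by field_simp
    rw [h2, lt_div_iff₀ hρ]
    have h3 := mul_lt_mul_of_pos_left h1 (by positivity : 0 < e * μ)
    have h4 : e * μ * ((C0 + 1) / (e * μ) * ρ) = (C0 + 1) * ρ := by field_simp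
    nlinarith

end

section

variable {n : ℕ}

theorem iterate_decay {U : Set (Eu n)} {F v : Eu n → ℝ} {ν x0 z : Eu n}
    {A : Eu n → Matrix (Fin n) (Fin n) ℝ} {r c C1 lam C0 η c5 C4 ρ0 W G s r1 : ℝ}
    (h : BoundaryChart U F ν x0 r c C1)
    (hη : 0 < η) (hc5 : c5 ∈ Ioo (0 : ℝ) 1) (hC4 : 1 ≤ C4)
    (hdec : ∀ (w : Eu n → ℝ) (A : Eu n → Matrix (Fin n) (Fin n) ℝ), IsAdmissible U w A lam C0 →
      ∀ (z g : Eu n) (ρ ω : ℝ), 0 < ρ → ρ ≤ ρ0 →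
      Metric.ball z ((C1 + 3) * ρ) ⊆ Metric.ball x0 r → F z = 0 → innerSL ℝ g = fderiv ℝ F z →
      (∀ x ∈ Metric.ball z ((C1 + 3) * ρ), x ∈ U → 0 ≤ w x ∧ w x ≤ ω * F x) →
      ω * F (z + (ρ / 2) • g) / 2 ≤ w (z + (ρ / 2) • g) → C4 * ρ ≤ ω →
      ∀ x ∈ Metric.ball z (η * ρ), x ∈ U → c5 * (ω * F x) ≤ w x)
    (hadm : ∀ m, |m| ≤ W → IsAdmissible U (fun x => v x - m * F x) A lam C0 ∧
      IsAdmissible U (fun x => m * F x - v x) A lam C0)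
    (hz : F z = 0) (hr1 : 0 < r1) (hr1' : r1 ≤ ρ0) (hr11 : r1 ≤ 1)
    (hsub : Metric.ball z r1 ⊆ Metric.ball x0 r)
    (hv : ∀ x ∈ Metric.ball z r1, x ∈ U → |v x| ≤ W * F x) (hW : 0 ≤ W)
    (hs : 1 - c5 ≤ s) (hqs : η / (C1 + 3) ≤ s) (hG : 2 * W ≤ G) (hG' : C4 ≤ G * (η / (C1 + 3)))
    (hq1 : η / (C1 + 3) ≤ 1) (k : ℕ) :
    ∃ m M : ℝ, -W ≤ m ∧ m ≤ M ∧ M ≤ W ∧ M - m ≤ G * s ^ k ∧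
      ∀ x ∈ Metric.ball z (r1 * (η / (C1 + 3)) ^ k), x ∈ U → m * F x ≤ v x ∧ v x ≤ M * F x := by
  have hC1 := h.one_le
  set q := η / (C1 + 3) with hq
  have hq0 : 0 < q := by positivity
  have hs0 : 0 < s := by linarith
  have hG0 : 0 < G := by
    by_contra! hh
    nlinarith
  induction k with
  | zero =>
    refine ⟨-W, W, le_rfl, by linarith, le_rfl, by simp; linarith, fun x hx hxU => ?_⟩
    have := abs_le.mp (hv x (by simpa using hx) hxU)
    exact ⟨by linarith [this.1], this.2⟩
  | succ k ih =>
    obtain ⟨m, M, hm, hmM, hM, hgap, hb⟩ := ih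
    have hnest : Metric.ball z (r1 * q ^ (k + 1)) ⊆ Metric.ball z (r1 * q ^ k) :=
      Metric.ball_subset_ball (mul_le_mul_of_nonneg_left
        (pow_le_pow_of_le_one hq0.le hq1 (Nat.le_succ k)) hr1.le)
    by_cases hkeep : M - m ≤ G * s ^ (k + 1)
    · exact ⟨m, M, hm, hmM, hM, hkeep, fun x hx => hb x (hnest hx)⟩
    push Not at hkeep
    set ρ := r1 * q ^ k / (C1 + 3) with hρd
    have hqk : 0 < q ^ k := by positivity
    have hρ : 0 < ρ := by positivity
    have hrk : (C1 + 3) * ρ = r1 * q ^ k := by rw [hρd]; field_simp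
    have hrk' : η * ρ = r1 * q ^ (k + 1) := by rw [hρd, pow_succ, hq]; field_simp
    have hqk1 : q ^ k ≤ 1 := pow_le_one₀ hq0.le hq1
    have hρle : ρ ≤ r1 * q ^ k := by rw [← hrk]; nlinarith
    have hr1q : r1 * q ^ k ≤ r1 := mul_le_of_le_one_right hr1.le hqk1
    have hr1q' : r1 * q ^ k ≤ q ^ k := mul_le_of_le_one_left hqk.le hr11
    have hω : C4 * ρ ≤ M - m := by
      have h1 : C4 * ρ ≤ C4 * q ^ k := mul_le_mul_of_nonneg_left (by linarith) (by linarith)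
      have h2 : C4 * q ^ k ≤ G * q * q ^ k := mul_le_mul_of_nonneg_right hG' hqk.le
      have h3 : q ^ (k + 1) ≤ s ^ (k + 1) := pow_le_pow_left₀ hq0.le hqs _
      have h4 := mul_le_mul_of_nonneg_left h3 hG0.le
      have h5 : G * q * q ^ k = G * q ^ (k + 1) := by ring
      linarith
    set g := (InnerProductSpace.toDual ℝ (Eu n)).symm (fderiv ℝ F z) with hgd
    have hg : innerSL ℝ g = fderiv ℝ F z := by
      have := (InnerProductSpace.toDual ℝ (Eu n)).apply_symm_apply (fderiv ℝ F z)
      rw [← this]; rfl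
    have hsub' : Metric.ball z ((C1 + 3) * ρ) ⊆ Metric.ball x0 r := by
      rw [hrk]; exact (Metric.ball_subset_ball hr1q).trans hsub
    have hgap' : (1 - c5) * (M - m) ≤ G * s ^ (k + 1) := by
      have h1 : (1 - c5) * (M - m) ≤ s * (G * s ^ k) :=
        mul_le_mul hs hgap (by linarith) hs0.le
      have h2 : s * (G * s ^ k) = G * s ^ (k + 1) := by ring
      linarith
    have hcω : 0 ≤ c5 * (M - m) := mul_nonneg hc5.1.le (by linarith)
    have hcω' : c5 * (M - m) ≤ M - m := mul_le_of_le_one_left (by linarith) hc5.2.le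
    have hρ0 : ρ ≤ ρ0 := by linarith
    set x1 := z + (ρ / 2) • g
    rcases le_total (v x1) ((m + M) / 2 * F x1) with hcase | hcase
    · have key := hdec _ A (hadm M (abs_le.mpr ⟨by linarith, hM⟩)).2 z g ρ (M - m) hρ
        hρ0 hsub' hz hg (fun x hx hxU => by
          have := hb x (by rwa [hrk] at hx) hxU
          constructor <;> linarith [this.1, this.2]) (by linarith) hω
      refine ⟨m, M - c5 * (M - m), hm, by linarith, by linarith, by linarith, fun x hx hxU => ?_⟩
      have h1 := key x (by rwa [hrk']) hxU
      have h2 := hb x (hnest hx) hxU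
      exact ⟨h2.1, by linarith⟩
    · have key := hdec _ A (hadm m (abs_le.mpr ⟨by linarith, by linarith⟩)).1 z g ρ (M - m) hρ
        hρ0 hsub' hz hg (fun x hx hxU => by
          have := hb x (by rwa [hrk] at hx) hxU
          constructor <;> linarith [this.1, this.2]) (by linarith) hω
      refine ⟨m + c5 * (M - m), M, by linarith, by linarith, by linarith, by linarith,
        fun x hx hxU => ?_⟩
      have h1 := key x (by rwa [hrk']) hxU
      have h2 := hb x (hnest hx) hxU
      exact ⟨by linarith, h2.2⟩

/-- Near a boundary point, `v` is a multiple of the defining function up to a Hölder error. -/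
theorem exists_boundary_expansion (n : ℕ) {lam C0 c C1 W : ℝ} (hl : 0 < lam) (hC0 : 0 ≤ C0)
    (hc : 0 < c) (hc1 : c ≤ 1) (hC1 : 1 ≤ C1) (hW : 0 ≤ W) :
    ∃ α ∈ Ioc (0 : ℝ) 1, ∃ ρ1 ∈ Ioc (0 : ℝ) 1, ∃ C > 0,
      ∀ (U : Set (Eu n)) (F : Eu n → ℝ) (ν x0 : Eu n) (r : ℝ), BoundaryChart U F ν x0 r c C1 →
      ∀ (v : Eu n → ℝ) (A : Eu n → Matrix (Fin n) (Fin n) ℝ),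
      (∀ m, |m| ≤ W → IsAdmissible U (fun x => v x - m * F x) A lam C0 ∧
        IsAdmissible U (fun x => m * F x - v x) A lam C0) →
      ∀ (z : Eu n) (r1 : ℝ), F z = 0 → 0 < r1 → r1 ≤ ρ1 →
      Metric.ball z r1 ⊆ Metric.ball x0 r →
      (∀ x ∈ Metric.ball z r1, x ∈ U → |v x| ≤ W * F x) → ∀ t, 0 < t → t ≤ r1 →
      ∃ m, |m| ≤ W ∧
        ∀ x ∈ Metric.ball z t, x ∈ U → |v x - m * F x| ≤ C * (t / r1) ^ α * F x := by
  obtain ⟨η, hη, c5, hc5, C4, hC4, ρ0, hρ0, hdec⟩ := exists_decay n hl hC0 hc hc1 hC1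
  set q := η / (C1 + 3) with hq
  have hη0 := hη.1
  have hq0 : 0 < q := by positivity
  have hq1 : q < 1 := by
    rw [hq, div_lt_one (by positivity)]; linarith [hη.2]
  set s := max (1 - c5) q with hs
  have hqs : q ≤ s := le_max_right _ _
  have hs0 : 0 < s := hq0.trans_le hqs
  have hs1 : s < 1 := max_lt (by linarith [hc5.1]) hq1
  have hlq : Real.log q < 0 := Real.log_neg hq0 hq1
  set α := Real.log s / Real.log q with hα
  have hα0 : 0 < α := div_pos_of_neg_of_neg (Real.log_neg hs0 hs1) hlq
  have hα1 : α ≤ 1 := by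
    rw [hα, div_le_one_of_neg hlq]; exact Real.log_le_log hq0 hqs
  have hqα : q ^ α = s := by
    rw [Real.rpow_def_of_pos hq0, hα, mul_div_cancel₀ _ hlq.ne, Real.exp_log hs0]
  set G := 2 * W + C4 / q with hG
  have hG0 : 0 < G := by positivity
  refine ⟨α, ⟨hα0, hα1⟩, ρ0, hρ0, G / s, by positivity, ?_⟩
  intro U F ν x0 r h v A hadm z r1 hz hr1 hr1' hsub hv t ht htr
  obtain ⟨k, hk1, hk2⟩ := exists_nat_pow_near_of_lt_one (div_pos ht hr1)
    ((div_le_one hr1).mpr htr) hq0 hq1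
  obtain ⟨m, M, hm, hmM, hM, hgap, hb⟩ := iterate_decay h hη0 hc5 hC4 (hdec U F ν x0 r h) hadm hz
    hr1 hr1' (hr1'.trans hρ0.2) hsub hv hW (le_max_left _ _) hqs (G := G)
    (by linarith [show 0 < C4 / q by positivity])
    (by
      have h1 : (2 * W + C4 / q) * q = 2 * W * q + C4 := by field_simp
      have : 0 ≤ 2 * W * q := by positivity
      rw [hG, h1]; linarith) hq1.le k
  refine ⟨m, abs_le.mpr ⟨hm, by linarith⟩, fun x hx hxU => ?_⟩
  have hxt : x ∈ Metric.ball z (r1 * q ^ k) :=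
    Metric.ball_subset_ball (by rw [div_le_iff₀ hr1] at hk2; linarith) hx
  have h1 := hb x hxt hxU
  have hFx : 0 < F x := (h.mem_iff x (hsub (Metric.ball_subset_ball htr hx))).1 hxU
  have hsk : s ^ (k + 1) ≤ (t / r1) ^ α := by
    rw [← hqα, ← Real.rpow_natCast, ← Real.rpow_mul hq0.le, mul_comm, Real.rpow_mul hq0.le,
      Real.rpow_natCast]
    exact Real.rpow_le_rpow (by positivity) hk1.le hα0.le
  have h2 : |v x - m * F x| ≤ (M - m) * F x := by
    rw [abs_of_nonneg (by linarith [h1.1])]; linarith [h1.2]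
  refine h2.trans (mul_le_mul_of_nonneg_right (hgap.trans ?_) hFx.le)
  calc G * s ^ k = G / s * s ^ (k + 1) := by rw [pow_succ]; field_simp
    _ ≤ _ := mul_le_mul_of_nonneg_left hsk (by positivity)

end

section

variable {n : ℕ}

theorem EllipticMatrix.mono {lam Lam Lam' : ℝ} {A : Matrix (Fin n) (Fin n) ℝ}
    (h : EllipticMatrix lam Lam A) (hL : Lam ≤ Lam') : EllipticMatrix lam Lam' A :=
  ⟨h.symm, h.lower, fun i j => (h.upper i j).trans hL⟩

theorem IsAdmissible.neg {U : Set (Eu n)} {w : Eu n → ℝ} {A : Eu n → Matrix (Fin n) (Fin n) ℝ}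
    {lam C0 : ℝ} (h : IsAdmissible U w A lam C0) : IsAdmissible U (fun x => -w x) A lam C0 := by
  have h1 : ∀ x, fderiv ℝ (fun x => -w x) x = -fderiv ℝ w x := fun x => fderiv_fun_neg
  have h2 : fderiv ℝ (fun x => -w x) = fun x => -fderiv ℝ w x := funext h1
  refine ⟨fun x hx => (h.contDiffAt x hx).neg, h.elliptic, fun x y hs i j => ?_, fun x hx => ?_,
    fun x hx => ?_⟩
  · rw [h1, h1, neg_sub_neg, norm_sub_rev (fderiv ℝ w y)]
    exact h.coeff_sub_le x y hs i j
  · rw [h2, fderiv_fun_neg, ← neg_one_smul ℝ, trHess_smul, neg_one_mul, abs_neg]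
    exact h.trHess_le x hx
  · rw [h1, norm_neg]; exact h.norm_fderiv_le x hx

theorem IsSolution.isAdmissible_sub {Ω U : Set (Eu n)} {u f ψ : Eu n → ℝ}
    {A : Eu n → Matrix (Fin n) (Fin n) ℝ} {lam C0 D : ℝ} (h : IsSolution Ω u A f lam C0)
    (hU : U ⊆ Ω) (hD : 0 ≤ D) (hψ : ∀ x ∈ U, ContDiffAt ℝ 2 ψ x)
    (hψ1 : ∀ x ∈ U, ‖fderiv ℝ ψ x‖ ≤ D) (hψ2 : ∀ x ∈ U, ‖fderiv ℝ (fderiv ℝ ψ) x‖ ≤ D) :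
    IsAdmissible U (fun x => u x - ψ x) A lam ((1 + n ^ 2) * (C0 * (1 + D))) := by
  have hC0 := h.one_le
  have hC0' : 0 ≤ C0 := by linarith
  have hN : (0 : ℝ) ≤ (n : ℝ) ^ 2 := by positivity
  have hCD : 0 ≤ C0 * D := mul_nonneg hC0' hD
  have hbig : C0 * (1 + D) ≤ (1 + n ^ 2) * (C0 * (1 + D)) :=
    le_mul_of_one_le_left (by positivity) (by linarith)
  have hu : ∀ x ∈ U, ContDiffAt ℝ 2 u x := fun x hx =>
    h.contDiffOn.contDiffAt (h.isOpen.mem_nhds (hU hx))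
  have hd : ∀ {g : Eu n → ℝ} {x}, ContDiffAt ℝ 2 g x → DifferentiableAt ℝ g x := fun hg =>
    hg.differentiableAt (by norm_num)
  have hd2 : ∀ {g : Eu n → ℝ} {x}, ContDiffAt ℝ 2 g x → DifferentiableAt ℝ (fderiv ℝ g) x :=
    fun hg => (hg.fderiv_right (m := 1) (by norm_num)).differentiableAt (by norm_num)
  have hw1 : ∀ x ∈ U, fderiv ℝ (fun x => u x - ψ x) x = fderiv ℝ u x - fderiv ℝ ψ x :=
    fun x hx => fderiv_fun_sub (hd (hu x hx)) (hd (hψ x hx))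
  refine ⟨fun x hx => (hu x hx).sub (hψ x hx), fun x hx => (h.elliptic x (hU hx)).mono ?_,
    fun x y hs i j => ?_, fun x hx => ?_, fun x hx => ?_⟩
  · linarith
  · have hx := hs (left_mem_segment ℝ x y)
    have hy := hs (right_mem_segment ℝ x y)
    have h1 := h.coeff_sub_le x y (hs.trans hU) i j
    have h2 := (convex_segment x y).norm_image_sub_le_of_norm_fderiv_le
      (𝕜 := ℝ) (f := fderiv ℝ ψ) (fun z hz => hd2 (hψ z (hs hz))) (fun z hz => hψ2 z (hs hz))
      (right_mem_segment ℝ x y) (left_mem_segment ℝ x y)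
    have h3 : ‖fderiv ℝ u x - fderiv ℝ u y‖ ≤ ‖(fderiv ℝ u x - fderiv ℝ ψ x) -
        (fderiv ℝ u y - fderiv ℝ ψ y)‖ + ‖fderiv ℝ ψ x - fderiv ℝ ψ y‖ := by
      refine le_trans (le_of_eq ?_) (norm_add_le _ _)
      congr 1; abel
    rw [hw1 x hx, hw1 y hy]
    set X := ‖(fderiv ℝ u x - fderiv ℝ ψ x) - (fderiv ℝ u y - fderiv ℝ ψ y)‖
    have hX : 0 ≤ X := norm_nonneg _
    calc _ ≤ C0 * (‖x - y‖ + ‖fderiv ℝ u x - fderiv ℝ u y‖) := h1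
      _ ≤ C0 * ((1 + D) * (‖x - y‖ + X)) := by
          refine mul_le_mul_of_nonneg_left ?_ hC0'
          linarith [mul_nonneg hD hX]
      _ = C0 * (1 + D) * (‖x - y‖ + X) := by ring
      _ ≤ _ := mul_le_mul_of_nonneg_right hbig (by positivity)
  · have he : fderiv ℝ (fun x => u x - ψ x) =ᶠ[𝓝 x] fun x => fderiv ℝ u x - fderiv ℝ ψ x := by
      filter_upwards [(hu x hx).eventually (by simp), (hψ x hx).eventually (by simp)] with y h1 h2
      exact fderiv_fun_sub (hd h1) (hd h2)
    rw [he.fderiv_eq, fderiv_fun_sub (hd2 (hu x hx)) (hd2 (hψ x hx)), trHess_sub]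
    have h1 := h.eqn x (hU hx)
    have h2 := h.rhs_le x (hU hx)
    have h3 := abs_trHess_le (h.elliptic x (hU hx)).upper (hψ2 x hx)
    have h4 : trHess (A x) (fderiv ℝ (fderiv ℝ u) x) = -f x := by linarith
    rw [h4]
    refine (abs_sub _ _).trans ?_
    rw [abs_neg]
    nlinarith [mul_nonneg hN hC0']
  · rw [hw1 x hx]
    refine (norm_sub_le _ _).trans ((add_le_add (h.norm_fderiv_le x (hU hx)) (hψ1 x hx)).trans ?_)
    nlinarith

namespace BoundaryChart

variable {U : Set (Eu n)} {F : Eu n → ℝ} {ν x0 : Eu n} {r c C1 : ℝ}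

theorem le_sub_dir (h : BoundaryChart U F ν x0 r c C1) {p : Eu n} {s : ℝ} (hs : 0 ≤ s)
    (hp : p ∈ Metric.ball x0 r) (hps : p + s • ν ∈ Metric.ball x0 r) :
    c * s ≤ F (p + s • ν) - F p := by
  have hmem : ∀ t ∈ Icc 0 s, p + t • ν ∈ Metric.ball x0 r := fun t ht => by
    refine (convex_ball x0 r).segment_subset hp hps ?_
    rw [segment_eq_image']
    rcases hs.eq_or_lt with rfl | hs'
    · obtain rfl : t = 0 := le_antisymm ht.2 ht.1
      exact ⟨0, by simp, by simp⟩
    · refine ⟨t / s, ⟨div_nonneg ht.1 hs, (div_le_one hs').mpr ht.2⟩, ?_⟩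
      simp only [add_sub_cancel_left, smul_smul]
      rw [div_mul_cancel₀ _ hs'.ne']
  have hder : ∀ t ∈ Icc 0 s, HasDerivAt (fun t : ℝ => F (p + t • ν)) (fderiv ℝ F (p + t • ν) ν) t :=
    fun t ht => by
      have h1 : HasDerivAt (fun t : ℝ => p + t • ν) ν t := by
        simpa using ((hasDerivAt_id t).smul_const ν).const_add p
      exact ((h.contDiffAt _ (hmem t ht)).differentiableAt (by norm_num)).hasFDerivAt.comp_hasDerivAt
        t h1
  have := (convex_Icc 0 s).mul_sub_le_image_sub_of_le_deriv (f := fun t : ℝ => F (p + t • ν)) (C := c)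
    (fun t ht => (hder t ht).continuousAt.continuousWithinAt)
    (fun t ht => (hder t (interior_subset ht)).differentiableAt.differentiableWithinAt)
    (fun t ht => by
      rw [(hder t (interior_subset ht)).deriv]
      exact h.le_fderiv_dir _ (hmem t (interior_subset ht)))
    0 (left_mem_Icc.mpr hs) s (right_mem_Icc.mpr hs) hs
  simpa using this

/-- The boundary point below `x` in the direction `ν`. -/
theorem exists_foot (h : BoundaryChart U F ν x0 r c C1) {x : Eu n} (hFx : 0 < F x)
    (hx : ‖x - x0‖ + F x / c < r) :
    ∃ t, 0 < t ∧ t ≤ F x / c ∧ F (x - t • ν) = 0 ∧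
      ∀ s ∈ Icc 0 t, x - s • ν ∈ Metric.ball x0 r ∧ (s < t → 0 < F (x - s • ν)) := by
  have hc := h.pos
  set L := F x / c with hL
  have hL0 : 0 < L := by positivity
  have hmem : ∀ s, 0 ≤ s → s ≤ L → x - s • ν ∈ Metric.ball x0 r := fun s hs hsL => by
    have h1 : ‖x - s • ν - x0‖ ≤ ‖x - x0‖ + s := by
      rw [sub_right_comm]
      refine (norm_sub_le _ _).trans ?_
      rw [norm_smul, h.norm_dir, mul_one, Real.norm_eq_abs, abs_of_nonneg hs]
    rw [mem_ball_iff_norm]; linarith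
  have hmono : ∀ s t, 0 ≤ s → s ≤ t → t ≤ L → c * (t - s) ≤ F (x - s • ν) - F (x - t • ν) :=
    fun s t hs hst htL => by
      have e : x - t • ν + (t - s) • ν = x - s • ν := by rw [sub_smul]; abel
      have := h.le_sub_dir (p := x - t • ν) (sub_nonneg.mpr hst) (hmem t (hs.trans hst) htL)
        (by rw [e]; exact hmem s hs (hst.trans htL))
      rwa [e] at this
  have hcont : ContinuousOn (fun s : ℝ => F (x - s • ν)) (Icc 0 L) := fun s hs => by
    have h1 : ContinuousAt F (x - s • ν) := (h.contDiffAt _ (hmem s hs.1 hs.2)).continuousAt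
    have h2 : ContinuousAt (fun s : ℝ => x - s • ν) s := by fun_prop
    exact (ContinuousAt.comp (f := fun s : ℝ => x - s • ν) (g := F) h1 h2).continuousWithinAt
  have hend : F (x - L • ν) ≤ 0 := by
    have h1 := hmono 0 L le_rfl hL0.le le_rfl
    have h2 : c * L = F x := by rw [hL]; field_simp
    simp only [zero_smul, sub_zero] at h1
    linarith
  obtain ⟨t, ht, hFt⟩ := intermediate_value_Icc' hL0.le hcont
    (show (0 : ℝ) ∈ Icc (F (x - L • ν)) (F (x - (0 : ℝ) • ν)) from ⟨hend, by simpa using hFx.le⟩)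
  have hFt : F (x - t • ν) = 0 := hFt
  have ht0 : 0 < t := by
    refine lt_of_le_of_ne ht.1 fun h0 => ?_
    rw [← h0] at hFt
    simp only [zero_smul, sub_zero] at hFt
    linarith
  refine ⟨t, ht0, ht.2, hFt, fun s hs => ⟨hmem s hs.1 (hs.2.trans ht.2), fun hst => ?_⟩⟩
  have h1 := hmono s t hs.1 hs.2 ht.2
  have h2 : 0 < c * (t - s) := mul_pos hc (by linarith)
  linarith

end BoundaryChart

/-- A comparison function `φ` with the boundary values of `u` on `{F = 0}`. -/
structure BoundaryDatum (U : Set (Eu n)) (u φ F : Eu n → ℝ) (x0 : Eu n) (r C1 : ℝ) : Prop where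
  contDiffAt : ∀ x ∈ U, ContDiffAt ℝ 2 φ x
  norm_fderiv_le : ∀ x ∈ U, ‖fderiv ℝ φ x‖ ≤ C1
  norm_fderiv_fderiv_le : ∀ x ∈ U, ‖fderiv ℝ (fderiv ℝ φ) x‖ ≤ C1
  tendsto : ∀ z ∈ Metric.ball x0 r, F z = 0 →
    Filter.Tendsto (fun x => u x - φ x) (𝓝[U] z) (𝓝 0)

theorem BoundaryDatum.abs_sub_le {Ω U : Set (Eu n)} {F u φ f : Eu n → ℝ} {ν x0 : Eu n}
    {A : Eu n → Matrix (Fin n) (Fin n) ℝ} {r c C1 lam C0 : ℝ}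
    (hφ : BoundaryDatum U u φ F x0 r C1) (h : BoundaryChart U F ν x0 r c C1)
    (hu : IsSolution Ω u A f lam C0) (hU : U ⊆ Ω) {x : Eu n} (hFx : 0 < F x)
    (hx : ‖x - x0‖ + F x / c < r) : |u x - φ x| ≤ (C0 + C1) / c * F x := by
  obtain ⟨t, ht0, htL, hFt, hseg⟩ := h.exists_foot hFx hx
  have hC : 0 ≤ C0 + C1 := by linarith [hu.one_le, h.one_le]
  have hmemU : ∀ s ∈ Ico 0 t, x - s • ν ∈ U := fun s hs =>
    (h.mem_iff _ (hseg s ⟨hs.1, hs.2.le⟩).1).2 ((hseg s ⟨hs.1, hs.2.le⟩).2 hs.2)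
  have hbound : ∀ s ∈ Ico 0 t, |u x - φ x - (u (x - s • ν) - φ (x - s • ν))| ≤ (C0 + C1) * t :=
    fun s hs => by
      have hdu : ∀ y ∈ U, ContDiffAt ℝ 2 u y := fun y hy =>
        hu.contDiffOn.contDiffAt (hu.isOpen.mem_nhds (hU hy))
      have hsegU : segment ℝ (x - s • ν) x ⊆ U := by
        rw [segment_eq_image']
        rintro _ ⟨θ, hθ, rfl⟩
        have e : x - s • ν + θ • (x - (x - s • ν)) = x - ((1 - θ) * s) • ν := by
          rw [sub_sub_cancel, smul_smul, sub_mul, sub_smul, one_mul]; abel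
        simp only [e]
        refine hmemU _ ⟨mul_nonneg (by linarith [hθ.2]) hs.1, ?_⟩
        nlinarith [hθ.1, hs.1, hs.2]
      have h1 := (convex_segment (x - s • ν) x).norm_image_sub_le_of_norm_fderiv_le (𝕜 := ℝ)
        (f := fun x => u x - φ x) (C := C0 + C1)
        (fun y hy => ((hdu y (hsegU hy)).sub (hφ.contDiffAt y (hsegU hy))).differentiableAt
          (by norm_num))
        (fun y hy => by
          rw [fderiv_fun_sub ((hdu y (hsegU hy)).differentiableAt (by norm_num))
            ((hφ.contDiffAt y (hsegU hy)).differentiableAt (by norm_num))]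
          exact (norm_sub_le _ _).trans (add_le_add (hu.norm_fderiv_le y (hU (hsegU hy)))
            (hφ.norm_fderiv_le y (hsegU hy))))
        (left_mem_segment ℝ _ _) (right_mem_segment ℝ _ _)
      rw [Real.norm_eq_abs, sub_sub_cancel, norm_smul, h.norm_dir, mul_one, Real.norm_eq_abs,
        abs_of_nonneg hs.1] at h1
      exact h1.trans (mul_le_mul_of_nonneg_left hs.2.le hC)
  have hlim : Filter.Tendsto (fun s : ℝ => u (x - s • ν) - φ (x - s • ν)) (𝓝[<] t) (𝓝 0) := by
    refine (hφ.tendsto _ (hseg t ⟨ht0.le, le_rfl⟩).1 hFt).comp ?_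
    refine tendsto_nhdsWithin_iff.mpr ⟨?_, ?_⟩
    · have : Continuous fun s : ℝ => x - s • ν := by fun_prop
      exact (this.tendsto t).mono_left nhdsWithin_le_nhds
    · filter_upwards [Ioo_mem_nhdsLT ht0] with s hs using hmemU s ⟨hs.1.le, hs.2⟩
  have hlim2 : Filter.Tendsto (fun s : ℝ => |u x - φ x - (u (x - s • ν) - φ (x - s • ν))|) (𝓝[<] t)
      (𝓝 |u x - φ x - 0|) := (tendsto_const_nhds.sub hlim).abs
  have h1 : |u x - φ x - 0| ≤ (C0 + C1) * t := le_of_tendsto hlim2 (by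
    filter_upwards [Ioo_mem_nhdsLT ht0] with s hs using hbound s ⟨hs.1.le, hs.2⟩)
  rw [sub_zero] at h1
  refine h1.trans ((mul_le_mul_of_nonneg_left htL hC).trans (le_of_eq ?_))
  ring

/-- `Dφ` is Lipschitz on `U` near `x0`. -/
theorem BoundaryDatum.norm_fderiv_sub_le {U : Set (Eu n)} {F u φ : Eu n → ℝ} {ν x0 : Eu n}
    {r c C1 : ℝ} (hφ : BoundaryDatum U u φ F x0 r C1) (h : BoundaryChart U F ν x0 r c C1)
    {y1 y2 : Eu n} (hF1 : 0 < F y1) (hF2 : 0 < F y2)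
    (hy1 : ‖y1 - x0‖ + C1 * ‖y1 - y2‖ / c < r) (hy2 : ‖y2 - x0‖ + C1 * ‖y1 - y2‖ / c < r) :
    ‖fderiv ℝ φ y1 - fderiv ℝ φ y2‖ ≤ C1 * (2 * C1 / c + 1) * ‖y1 - y2‖ := by
  have hc := h.pos
  have hC1 : 0 < C1 := zero_lt_one.trans_le h.one_le
  set s := ‖y1 - y2‖ with hs
  have hs0 : 0 ≤ s := norm_nonneg _
  set τ := C1 * s / c with hτ
  have hτ0 : 0 ≤ τ := by positivity
  have hcτ : c * τ = C1 * s := by rw [hτ]; field_simp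
  have hmem : ∀ y, ‖y - x0‖ + τ < r → ∀ σ ∈ Icc 0 τ, y + σ • ν ∈ Metric.ball x0 r :=
    fun y hy σ hσ => by
      rw [mem_ball_iff_norm, add_sub_right_comm]
      refine (norm_add_le _ _).trans_lt ?_
      rw [norm_smul, h.norm_dir, mul_one, Real.norm_eq_abs, abs_of_nonneg hσ.1]
      linarith [hσ.2]
  have hmem0 : ∀ y, ‖y - x0‖ + τ < r → y ∈ Metric.ball x0 r := fun y hy => by
    rw [mem_ball_iff_norm]; linarith
  have hlip : ∀ p q, segment ℝ p q ⊆ U → ‖fderiv ℝ φ q - fderiv ℝ φ p‖ ≤ C1 * ‖q - p‖ :=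
    fun p q hpq => (convex_segment p q).norm_image_sub_le_of_norm_fderiv_le
      (𝕜 := ℝ) (f := fderiv ℝ φ) (fun z hz => ((hφ.contDiffAt z (hpq hz)).fderiv_right (m := 1)
        (by norm_num)).differentiableAt (by norm_num))
      (fun z hz => hφ.norm_fderiv_fderiv_le z (hpq hz)) (left_mem_segment ℝ p q)
      (right_mem_segment ℝ p q)
  have hvert : ∀ y, ‖y - x0‖ + τ < r → 0 < F y →
      ‖fderiv ℝ φ (y + τ • ν) - fderiv ℝ φ y‖ ≤ C1 * τ := fun y hy hFy => by
    refine (hlip y (y + τ • ν) ?_).trans (le_of_eq ?_)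
    · rw [segment_eq_image']
      rintro _ ⟨θ, hθ, rfl⟩
      simp only [add_sub_cancel_left, smul_smul]
      have hθτ : θ * τ ∈ Icc 0 τ := ⟨mul_nonneg hθ.1 hτ0, mul_le_of_le_one_left hτ0 hθ.2⟩
      have hb := hmem y hy _ hθτ
      refine (h.mem_iff _ hb).2 ?_
      have := h.le_sub_dir hθτ.1 (hmem0 y hy) hb
      have := mul_nonneg hc.le hθτ.1
      linarith
    · rw [add_sub_cancel_left, norm_smul, h.norm_dir, mul_one, Real.norm_eq_abs, abs_of_nonneg hτ0]
  have hhor : ‖fderiv ℝ φ (y1 + τ • ν) - fderiv ℝ φ (y2 + τ • ν)‖ ≤ C1 * s := by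
    refine (hlip (y2 + τ • ν) (y1 + τ • ν) ?_).trans (le_of_eq ?_)
    · rw [segment_eq_image']
      rintro _ ⟨θ, hθ, rfl⟩
      have e : y2 + τ • ν + θ • (y1 + τ • ν - (y2 + τ • ν)) = y2 + θ • (y1 - y2) + τ • ν := by
        rw [add_sub_add_right_eq_sub]; abel
      simp only [e]
      set y := y2 + θ • (y1 - y2) with hy
      have hyb : ‖y - x0‖ + τ < r := by
        have hconv := (convex_ball x0 (r - τ)).segment_subset
          (mem_ball_iff_norm.mpr (by linarith)) (mem_ball_iff_norm.mpr (by linarith))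
          (show y ∈ segment ℝ y2 y1 by rw [segment_eq_image']; exact ⟨θ, hθ, rfl⟩)
        have := mem_ball_iff_norm.mp hconv
        linarith
      have hb := hmem y hyb τ ⟨hτ0, le_rfl⟩
      refine (h.mem_iff _ hb).2 ?_
      have h1 := h.le_sub_dir hτ0 (hmem0 y hyb) hb
      have h2 := (abs_le.mp (h.abs_sub_le (hmem0 y hyb) (hmem0 y2 hy2))).1
      have h3 : ‖y - y2‖ ≤ s := by
        rw [hy, add_sub_cancel_left, norm_smul, Real.norm_eq_abs, abs_of_nonneg hθ.1]
        exact mul_le_of_le_one_left hs0 hθ.2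
      have h4 := mul_le_mul_of_nonneg_left h3 hC1.le
      linarith
    · rw [add_sub_add_right_eq_sub]
  have h1 := hvert y1 hy1 hF1
  have h2 := hvert y2 hy2 hF2
  rw [norm_sub_rev] at h1
  have e : fderiv ℝ φ y1 - fderiv ℝ φ y2 = (fderiv ℝ φ y1 - fderiv ℝ φ (y1 + τ • ν)) +
    (fderiv ℝ φ (y1 + τ • ν) - fderiv ℝ φ (y2 + τ • ν)) +
    (fderiv ℝ φ (y2 + τ • ν) - fderiv ℝ φ y2) := by abel
  rw [e]
  refine (norm_add₃_le).trans ?_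
  have h5 : C1 * (2 * C1 / c + 1) * s = C1 * τ + C1 * s + C1 * τ := by rw [hτ]; field_simp; ring
  linarith

end

section

variable {n : ℕ} {Ω U : Set (Eu n)} {F u φ f : Eu n → ℝ} {ν x0 : Eu n}
  {A : Eu n → Matrix (Fin n) (Fin n) ℝ} {r c C1 lam C0 : ℝ}

theorem BoundaryDatum.isAdmissible (hφ : BoundaryDatum U u φ F x0 r C1)
    (h : BoundaryChart U F ν x0 r c C1) (hu : IsSolution Ω u A f lam C0) (hU : U ⊆ Ω)
    (hUb : U ⊆ Metric.ball x0 r) {W m : ℝ} (hW : 0 ≤ W) (hm : |m| ≤ W) :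
    IsAdmissible U (fun x => u x - φ x - m * F x) A lam
        ((1 + n ^ 2) * (C0 * (1 + (C1 + W * C1)))) ∧
      IsAdmissible U (fun x => m * F x - (u x - φ x)) A lam
        ((1 + n ^ 2) * (C0 * (1 + (C1 + W * C1)))) := by
  have hC1 : 0 ≤ C1 := zero_le_one.trans h.one_le
  have hd : ∀ {g : Eu n → ℝ} {x}, ContDiffAt ℝ 2 g x → DifferentiableAt ℝ g x := fun hg =>
    hg.differentiableAt (by norm_num)
  have hd2 : ∀ {g : Eu n → ℝ} {x}, ContDiffAt ℝ 2 g x → DifferentiableAt ℝ (fderiv ℝ g) x :=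
    fun hg => (hg.fderiv_right (m := 1) (by norm_num)).differentiableAt (by norm_num)
  have hfd : ∀ {x}, ContDiffAt ℝ 2 φ x → ContDiffAt ℝ 2 F x →
      fderiv ℝ (fun x => φ x + m * F x) x = fderiv ℝ φ x + m • fderiv ℝ F x := fun h1 h2 => by
    rw [fderiv_fun_add (hd h1) ((hd h2).const_mul m), fderiv_const_mul (hd h2)]
  have hb : ∀ {G : Type} [NormedAddCommGroup G] [NormedSpace ℝ G] {a b : G}, ‖a‖ ≤ C1 → ‖b‖ ≤ C1 →
      ‖a + m • b‖ ≤ C1 + W * C1 := fun {G} _ _ {a b} h1 h2 => by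
    refine (norm_add_le _ _).trans (add_le_add h1 ?_)
    rw [norm_smul]
    exact mul_le_mul hm h2 (norm_nonneg _) hW
  have key := hu.isAdmissible_sub (ψ := fun x => φ x + m * F x) (D := C1 + W * C1) hU (by positivity)
    (fun x hx => (hφ.contDiffAt x hx).add (contDiffAt_const.mul (h.contDiffAt x (hUb hx))))
    (fun x hx => by
      rw [hfd (hφ.contDiffAt x hx) (h.contDiffAt x (hUb hx))]
      exact hb (hφ.norm_fderiv_le x hx) (h.norm_fderiv_le x (hUb hx)))
    (fun x hx => by
      have h1 := hφ.contDiffAt x hx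
      have h2 := h.contDiffAt x (hUb hx)
      have he : fderiv ℝ (fun x => φ x + m * F x) =ᶠ[𝓝 x]
          fun x => fderiv ℝ φ x + m • fderiv ℝ F x := by
        filter_upwards [h1.eventually (by simp), h2.eventually (by simp)] with y a1 a2 using hfd a1 a2
      rw [he.fderiv_eq, fderiv_fun_add (hd2 h1) ((hd2 h2).fun_const_smul m),
        fderiv_fun_const_smul (hd2 h2)]
      exact hb (G := Eu n →L[ℝ] Eu n →L[ℝ] ℝ) (hφ.norm_fderiv_fderiv_le x hx)
        (h.norm_fderiv_fderiv_le x (hUb hx)))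
  have e1 : (fun x => u x - (φ x + m * F x)) = fun x => u x - φ x - m * F x := by
    funext x; ring
  have e2 : (fun x => -(u x - (φ x + m * F x))) = fun x => m * F x - (u x - φ x) := by
    funext x; ring
  exact ⟨e1 ▸ key, e2 ▸ key.neg⟩

theorem BoundaryDatum.fderiv_sub (hφ : BoundaryDatum U u φ F x0 r C1)
    (h : BoundaryChart U F ν x0 r c C1) (hu : IsSolution Ω u A f lam C0) (hU : U ⊆ Ω)
    (hUb : U ⊆ Metric.ball x0 r) (m : ℝ) {x : Eu n} (hx : x ∈ U) :
    fderiv ℝ (fun x => u x - φ x - m * F x) x =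
      fderiv ℝ u x - fderiv ℝ φ x - m • fderiv ℝ F x := by
  have h1 : DifferentiableAt ℝ u x :=
    (hu.contDiffOn.contDiffAt (hu.isOpen.mem_nhds (hU hx))).differentiableAt (by norm_num)
  have h2 := (hφ.contDiffAt x hx).differentiableAt (by norm_num)
  have h3 := (h.contDiffAt x (hUb hx)).differentiableAt (by norm_num)
  rw [fderiv_fun_sub (h1.fun_sub h2) (h3.const_mul m), fderiv_fun_sub h1 h2, fderiv_const_mul h3]

/-- The ball of radius `F y / (2 C1)` around `y` stays well inside `U`. -/
theorem BoundaryChart.mem_closedBall (h : BoundaryChart U F ν x0 r c C1) {x y : Eu n}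
    (hy : 0 < F y) (hyr : ‖y - x0‖ + F y / (2 * C1) < r)
    (hx : x ∈ Metric.closedBall y (F y / (2 * C1))) : x ∈ U ∧ F x ≤ 3 / 2 * F y := by
  have hC1 : 0 < C1 := zero_lt_one.trans_le h.one_le
  rw [mem_closedBall_iff_norm] at hx
  have hd : 0 < F y / (2 * C1) := by positivity
  have hxb : x ∈ Metric.ball x0 r := by
    have := norm_sub_le_norm_sub_add_norm_sub x y x0
    rw [mem_ball_iff_norm]; linarith
  have hyb : y ∈ Metric.ball x0 r := by rw [mem_ball_iff_norm]; linarith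
  have h1 := abs_le.mp (h.abs_sub_le hxb hyb)
  have h2 : C1 * ‖x - y‖ ≤ F y / 2 := by
    calc _ ≤ C1 * (F y / (2 * C1)) := mul_le_mul_of_nonneg_left hx hC1.le
      _ = _ := by field_simp
  exact ⟨(h.mem_iff x hxb).2 (by linarith [h1.1]), by linarith [h1.2]⟩

theorem osc_arith {Cg C1 E d1 d2 C W L s C0 X T : ℝ} (hCg : 0 < Cg) (hE : E = C * T)
    (hd1 : d1 ≤ T) (hd2 : d2 ≤ T) (hs : s ≤ T) (hL : 0 ≤ L) (hW : 0 ≤ W * C1) (hC0 : 0 ≤ C0)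
    (hT : 0 ≤ T)
    (hX : X ≤ Cg * (3 * C1 * E + d1) + Cg * (3 * C1 * E + d2) + L * s + W * C1 * s) :
    X ≤ (2 * Cg * (3 * C1 * C + 1) + L + W * C1 + 2 * C0) * T := by
  have h1 := mul_le_mul_of_nonneg_left hd1 hCg.le
  have h2 := mul_le_mul_of_nonneg_left hd2 hCg.le
  have h3 := mul_le_mul_of_nonneg_left hs hL
  have h4 := mul_le_mul_of_nonneg_left hs hW
  have h5 := mul_nonneg hC0 hT
  subst hE
  nlinarith

set_option maxHeartbeats 1000000 in
theorem BoundaryDatum.exists_osc (hφ : BoundaryDatum U u φ F x0 r C1)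
    (h : BoundaryChart U F ν x0 r c C1) (hu : IsSolution Ω u A f lam C0) (hU : U ⊆ Ω)
    (hUb : U ⊆ Metric.ball x0 r) (hr : 0 < r) (hF0 : F x0 = 0) :
    ∃ r4 ∈ Ioc 0 (r / 2), ∃ α ∈ Ioc (0 : ℝ) 1, ∃ C > 0, ∀ y1 ∈ Metric.ball x0 r4,
      ∀ y2 ∈ Metric.ball x0 r4, 0 < F y1 → 0 < F y2 →
      ‖fderiv ℝ u y1 - fderiv ℝ u y2‖ ≤ C * (F y1 + ‖y1 - y2‖) ^ α := by
  have hc := h.pos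
  have hc1 := h.le_one
  have hC1' := h.one_le
  have hC1 : 0 < C1 := by linarith
  have hC0 := hu.one_le
  have hC0' : 0 < C0 := by linarith
  set W := (C0 + C1) / c with hW
  have hW0 : 0 < W := by positivity
  set C0' := (1 + (n : ℝ) ^ 2) * (C0 * (1 + (C1 + W * C1))) with hC0d
  have hC0'0 : 0 ≤ C0' := by positivity
  obtain ⟨α, hα, ρ1, hρ1, Ce, hCe, hexp⟩ :=
    exists_boundary_expansion n hu.lam_pos hC0'0 hc hc1 hC1' hW0.le
  obtain ⟨Cg, hCg, hgrad⟩ := exists_admissible_gradient_bound n hu.lam_pos hC0'0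
  set q := c / (4 * C1) with hq
  have hq0 : 0 < q := by positivity
  have hq4 : q ≤ 1 / 4 := by rw [hq, div_le_iff₀ (by positivity)]; linarith
  have hqC : ∀ R : ℝ, C1 * (q * R) / c = R / 4 := fun R => by rw [hq]; field_simp
  set r3 := q * r with hr3
  set r4 := q * r3 with hr4
  have hr30 : 0 < r3 := by positivity
  have hr40 : 0 < r4 := by positivity
  have hr3r : r3 ≤ r / 4 := by nlinarith
  have hr4r : r4 ≤ r3 / 4 := by nlinarith
  have hx0b : x0 ∈ Metric.ball x0 r := Metric.mem_ball_self hr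
  have hFle : ∀ y ∈ Metric.ball x0 r, F y ≤ C1 * ‖y - x0‖ := fun y hy => by
    have := (abs_le.mp (h.abs_sub_le hy hx0b)).2
    linarith
  have hFc : ∀ R y, ‖y - x0‖ < q * R → R ≤ r → F y / c ≤ R / 4 := fun R y hy hR => by
    have h1 : q * R ≤ 1 / 4 * r := by
      have : 0 < q * R := (norm_nonneg _).trans_lt hy
      have : 0 < R := by by_contra! hh; nlinarith
      nlinarith
    rw [← hqC R]
    refine div_le_div_of_nonneg_right ?_ hc.le
    exact (hFle y (by rw [mem_ball_iff_norm]; linarith)).trans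
      (mul_le_mul_of_nonneg_left hy.le hC1.le)
  have hv3 : ∀ x ∈ Metric.ball x0 r3, x ∈ U → |u x - φ x| ≤ W * F x := fun x hx hxU => by
    have hx' := mem_ball_iff_norm.mp hx
    have h1 := hFc r x hx' le_rfl
    exact hφ.abs_sub_le h hu hU ((h.mem_iff x (hUb hxU)).1 hxU) (by linarith)
  set r1 := min ρ1 (r3 / 2) with hr1
  have hr10 : 0 < r1 := lt_min hρ1.1 (by positivity)
  have hr11 : r1 ≤ 1 := (min_le_left _ _).trans hρ1.2
  set L := C1 * (2 * C1 / c + 1) with hL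
  have hL0 : 0 < L := by positivity
  set Ct := 2 * Cg * (3 * C1 * Ce + 1) + L + W * C1 + 2 * C0 with hCt
  have hCt0 : 0 < Ct := by positivity
  refine ⟨r4, ⟨hr40, by linarith⟩, α, hα, Ct * (2 / (c * r1)) ^ α, by positivity, ?_⟩
  intro y1 hy1 y2 hy2 hF1 hF2
  rw [mem_ball_iff_norm] at hy1 hy2
  set s := ‖y1 - y2‖ with hs
  have hs0 : 0 ≤ s := norm_nonneg _
  have hsr : s < 2 * r4 := by
    have := norm_sub_le_norm_sub_add_norm_sub y1 x0 y2
    rw [norm_sub_rev x0 y2] at this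
    linarith
  have hyU : ∀ y, ‖y - x0‖ < r4 → 0 < F y → y ∈ U := fun y hy hFy =>
    (h.mem_iff y (by rw [mem_ball_iff_norm]; linarith)).2 hFy
  set t := 2 * (F y1 / c + s) with ht
  have ht0 : 0 < t := by positivity
  set T := (t / r1) ^ α with hT
  have hT0 : 0 ≤ T := by positivity
  have hfin : Ct * T ≤ Ct * (2 / (c * r1)) ^ α * (F y1 + s) ^ α := by
    rw [mul_assoc, ← Real.mul_rpow (by positivity) (by positivity)]
    refine mul_le_mul_of_nonneg_left (Real.rpow_le_rpow (by positivity) ?_ hα.1.le) hCt0.le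
    have e : 2 / (c * r1) * (F y1 + s) = 2 * (F y1 / c + s / c) / r1 := by field_simp
    rw [e]
    refine div_le_div_of_nonneg_right ?_ hr10.le
    have : s ≤ s / c := by rw [le_div_iff₀ hc]; nlinarith
    linarith
  refine le_trans ?_ hfin
  rcases lt_or_ge r1 t with htr | htr
  · have h1 : ‖fderiv ℝ u y1 - fderiv ℝ u y2‖ ≤ 2 * C0 := by
      refine (norm_sub_le _ _).trans ?_
      linarith [hu.norm_fderiv_le y1 (hU (hyU y1 hy1 hF1)),
        hu.norm_fderiv_le y2 (hU (hyU y2 hy2 hF2))]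
    have h2 : 1 ≤ T := Real.one_le_rpow ((one_le_div hr10).mpr htr.le) hα.1.le
    have h3 : 2 * C0 ≤ Ct := by
      have : 0 < 2 * Cg * (3 * C1 * Ce + 1) + L + W * C1 := by positivity
      linarith
    nlinarith
  have htT : t ≤ T := by
    have h1 : t / r1 ≤ 1 := (div_le_one hr10).mpr htr
    have h2 : t / r1 ≤ T := by
      have := Real.rpow_le_rpow_of_exponent_ge (by positivity : 0 < t / r1) h1 hα.2
      rwa [Real.rpow_one] at this
    have h3 : t ≤ t / r1 := by rw [le_div_iff₀ hr10]; nlinarith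
    linarith
  have hF1c := hFc r3 y1 hy1 (by linarith)
  obtain ⟨t', ht'0, ht'L, hFz, hz⟩ := h.exists_foot hF1 (by linarith)
  set z := y1 - t' • ν with hzd
  have hzy : ‖y1 - z‖ = t' := by
    rw [hzd, sub_sub_cancel, norm_smul, h.norm_dir, mul_one, Real.norm_eq_abs, abs_of_pos ht'0]
  have hzx0 : ‖z - x0‖ ≤ r3 / 2 := by
    have := norm_sub_le_norm_sub_add_norm_sub z y1 x0
    rw [norm_sub_rev z y1, hzy] at this
    linarith
  have hb3 : Metric.ball z r1 ⊆ Metric.ball x0 r3 := Metric.ball_subset_ball' (by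
    rw [dist_eq_norm]
    have : r1 ≤ r3 / 2 := min_le_right _ _
    linarith)
  obtain ⟨m, hm, hexpm⟩ := hexp U F ν x0 r h (fun x => u x - φ x) A
    (fun m hm => hφ.isAdmissible h hu hU hUb hW0.le hm) z r1 hFz hr10 (min_le_left _ _)
    (hb3.trans (Metric.ball_subset_ball (by linarith)))
    (fun x hx hxU => hv3 x (hb3 hx) hxU) t ht0 htr
  have hpt : ∀ y, ‖y - x0‖ < r4 → 0 < F y → ‖y - y1‖ + F y / (2 * C1) + F y1 / c < t →
      ‖fderiv ℝ (fun x => u x - φ x - m * F x) y‖ ≤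
        Cg * (3 * C1 * (Ce * T) + F y / (2 * C1)) := fun y hy hFy hyt => by
    have hd0 : 0 < F y / (2 * C1) := by positivity
    have hdr : ‖y - x0‖ + F y / (2 * C1) < r := by
      have h1 := hFle y (by rw [mem_ball_iff_norm]; linarith)
      have h2 : F y / (2 * C1) ≤ ‖y - x0‖ / 2 := by
        rw [div_le_iff₀ (by positivity)]; linarith
      linarith
    have hmem := fun x hx => h.mem_closedBall (x := x) hFy hdr hx
    refine (hgrad U _ A (hφ.isAdmissible h hu hU hUb hW0.le hm).1 y (F y / (2 * C1))
      (Ce * T * (3 / 2 * F y)) hd0 (fun x hx => (hmem x hx).1) fun x hx => ?_).trans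
      (le_of_eq ?_)
    · refine (hexpm x ?_ (hmem x hx).1).trans
        (mul_le_mul_of_nonneg_left (hmem x hx).2 (by positivity))
      rw [mem_closedBall_iff_norm] at hx
      rw [mem_ball_iff_norm]
      have h1 := norm_sub_le_norm_sub_add_norm_sub x y z
      have h2 := norm_sub_le_norm_sub_add_norm_sub y y1 z
      linarith
    · congr 2
      field_simp
  have hd1 : F y1 / (2 * C1) ≤ F y1 / c / 2 := by
    rw [div_div]; exact div_le_div_of_nonneg_left hF1.le (by positivity) (by linarith)
  have hd2 : F y2 / (2 * C1) ≤ F y1 / c / 2 + s / 2 := by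
    have h1 := (abs_le.mp (h.abs_sub_le (x := y1) (y := y2) (by rw [mem_ball_iff_norm]; linarith)
      (by rw [mem_ball_iff_norm]; linarith))).1
    have h2 : F y2 / (2 * C1) ≤ (F y1 + C1 * s) / (2 * C1) :=
      div_le_div_of_nonneg_right (by linarith) (by positivity)
    have h3 : (F y1 + C1 * s) / (2 * C1) = F y1 / (2 * C1) + s / 2 := by field_simp
    linarith
  have hF1c0 : 0 < F y1 / c := by positivity
  have g1 := hpt y1 hy1 hF1 (by rw [sub_self, norm_zero]; linarith)
  have g2 := hpt y2 hy2 hF2 (by rw [norm_sub_rev]; linarith)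
  rw [hφ.fderiv_sub h hu hU hUb m (hyU y1 hy1 hF1)] at g1
  rw [hφ.fderiv_sub h hu hU hUb m (hyU y2 hy2 hF2)] at g2
  have hCs : C1 * s / c ≤ r3 / 2 := by
    have h1 := hqC r3
    rw [← hr4] at h1
    have h2 : C1 * s / c ≤ C1 * (2 * r4) / c :=
      div_le_div_of_nonneg_right (mul_le_mul_of_nonneg_left hsr.le hC1.le) hc.le
    have h3 : C1 * (2 * r4) / c = 2 * (C1 * r4 / c) := by ring
    linarith
  have g3 := hφ.norm_fderiv_sub_le h hF1 hF2 (by linarith) (by linarith)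
  have g4 := h.norm_fderiv_sub_le (x := y1) (y := y2) (by rw [mem_ball_iff_norm]; linarith)
      (by rw [mem_ball_iff_norm]; linarith)
  refine osc_arith hCg rfl (d1 := F y1 / (2 * C1)) (d2 := F y2 / (2 * C1)) (s := s) (by linarith)
    (by linarith) (by linarith) hL0.le (by positivity) hC0'.le hT0 ?_
  have e : fderiv ℝ u y1 - fderiv ℝ u y2 =
      (fderiv ℝ u y1 - fderiv ℝ φ y1 - m • fderiv ℝ F y1) -
      (fderiv ℝ u y2 - fderiv ℝ φ y2 - m • fderiv ℝ F y2) + (fderiv ℝ φ y1 - fderiv ℝ φ y2)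
      + m • (fderiv ℝ F y1 - fderiv ℝ F y2) := by
    rw [smul_sub]; abel
  rw [e]
  refine (norm_add₃_le).trans (add_le_add (add_le_add ((norm_sub_le _ _).trans
    (add_le_add g1 g2)) g3) ?_)
  rw [norm_smul, mul_assoc]
  exact mul_le_mul hm g4 (norm_nonneg _) hW0.le

end

section

theorem holder_combine {X C Ci C1 s d α β : ℝ} (hs : 0 < s) (hs1 : s ≤ 1) (hd : 0 < d)
    (hC1 : 1 ≤ C1) (hd1 : d ≤ 1 / (2 * C1)) (hC : 0 < C) (hCi : 0 < Ci) (hα : α ∈ Ioc (0 : ℝ) 1)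
    (hβ : β ∈ Ioo (0 : ℝ) 1) (h1 : X ≤ C * (d + s) ^ α)
    (h2 : s ≤ d / (2 * C1) → X ≤ Ci / (d / (2 * C1)) ^ 2 * s ^ β) :
    X ≤ (2 * C + 4 * C1 ^ 2 * Ci) * s ^ (α * β / 4) := by
  obtain ⟨hα0, hα1⟩ := hα
  obtain ⟨hβ0, hβ1⟩ := hβ
  have hC1' : 0 < C1 := by linarith
  have hst : 0 < s ^ (α * β / 4) := Real.rpow_pos_of_pos hs _
  rcases le_total d (s ^ (β / 4)) with hcase | hcase
  · have h3 : s ≤ s ^ (β / 4) := by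
      have := Real.rpow_le_rpow_of_exponent_ge hs hs1 (show β / 4 ≤ 1 by linarith)
      rwa [Real.rpow_one] at this
    have h4 : (d + s) ^ α ≤ (2 * s ^ (β / 4)) ^ α :=
      Real.rpow_le_rpow (by positivity) (by linarith) hα0.le
    have h5 : (2 * s ^ (β / 4)) ^ α = 2 ^ α * s ^ (α * β / 4) := by
      rw [Real.mul_rpow (by norm_num) (by positivity), ← Real.rpow_mul hs.le]
      congr 2; ring
    have h6 : (2 : ℝ) ^ α ≤ 2 := by
      have := Real.rpow_le_rpow_of_exponent_le (by norm_num : (1 : ℝ) ≤ 2) hα1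
      rwa [Real.rpow_one] at this
    have h7 : (d + s) ^ α ≤ 2 * s ^ (α * β / 4) :=
      h4.trans (h5.le.trans (mul_le_mul_of_nonneg_right h6 hst.le))
    have h8 := mul_le_mul_of_nonneg_left h7 hC.le
    have h9 : 0 ≤ 4 * C1 ^ 2 * Ci * s ^ (α * β / 4) := by positivity
    linarith
  · have hd2 : d * (2 * C1) ≤ 1 := (le_div_iff₀ (by positivity)).mp hd1
    have hd1' : d ≤ 1 := by nlinarith
    have hsβ : s ^ (β / 2) ≤ d ^ 2 := by
      have := pow_le_pow_left₀ (by positivity) hcase 2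
      have e : s ^ (β / 2) = (s ^ (β / 4)) ^ 2 := by
        rw [← Real.rpow_natCast, ← Real.rpow_mul hs.le]
        congr 1; push_cast; ring
      rwa [e]
    have hsR : s ≤ d / (2 * C1) := by
      have e1 : (s ^ (β / 4)) ^ 4 = s ^ β := by
        rw [← Real.rpow_natCast, ← Real.rpow_mul hs.le]
        congr 1; push_cast; ring
      have e2 : s ≤ s ^ β := by
        have := Real.rpow_le_rpow_of_exponent_ge hs hs1 hβ1.le
        rwa [Real.rpow_one] at this
      have e3 := pow_le_pow_left₀ (by positivity) hcase 4
      have e4 : d ^ 4 ≤ d ^ 2 := pow_le_pow_of_le_one hd.le hd1' (by norm_num)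
      rw [le_div_iff₀ (by positivity)]
      have e5 : s ≤ d ^ 2 := by linarith
      have e6 := mul_le_mul_of_nonneg_right e5 (by positivity : 0 ≤ 2 * C1)
      nlinarith
    have h3 := h2 hsR
    have e1 : s ^ β = s ^ (β / 2) * s ^ (β / 2) := by
      rw [← Real.rpow_add hs]; congr 1; ring
    have h4 : Ci / (d / (2 * C1)) ^ 2 * s ^ β ≤ 4 * C1 ^ 2 * Ci * s ^ (β / 2) := by
      calc Ci / (d / (2 * C1)) ^ 2 * s ^ β
          = 4 * C1 ^ 2 * Ci * s ^ (β / 2) * (s ^ (β / 2) / d ^ 2) := by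
            rw [e1]; field_simp; ring
        _ ≤ _ := mul_le_of_le_one_right (by positivity) ((div_le_one (by positivity)).mpr hsβ)
    have h5 : s ^ (β / 2) ≤ s ^ (α * β / 4) :=
      Real.rpow_le_rpow_of_exponent_ge hs hs1 (by nlinarith)
    have h6 := mul_le_mul_of_nonneg_left h5 (by positivity : 0 ≤ 4 * C1 ^ 2 * Ci)
    have h7 : 0 ≤ 2 * C * s ^ (α * β / 4) := by positivity
    linarith

variable {n : ℕ} {Ω U : Set (Eu n)} {F u φ f : Eu n → ℝ} {ν x0 : Eu n}
  {A : Eu n → Matrix (Fin n) (Fin n) ℝ} {r c C1 lam C0 : ℝ}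

/-- Hölder continuity of the gradient up to the boundary, locally. -/
theorem BoundaryDatum.exists_local_holder (hφ : BoundaryDatum U u φ F x0 r C1)
    (h : BoundaryChart U F ν x0 r c C1) (hu : IsSolution Ω u A f lam C0) (hU : U ⊆ Ω)
    (hUb : U ⊆ Metric.ball x0 r) (hr : 0 < r) (hF0 : F x0 = 0) :
    ∃ r5 > 0, ∃ τ ∈ Ioo (0 : ℝ) 1, ∃ C > 0, ∀ y1 ∈ U ∩ Metric.ball x0 r5,
      ∀ y2 ∈ U ∩ Metric.ball x0 r5,
      ‖fderiv ℝ u y1 - fderiv ℝ u y2‖ ≤ C * ‖y1 - y2‖ ^ τ := by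
  have hC1 := h.one_le
  have hC1' : 0 < C1 := by linarith
  obtain ⟨r4, hr4, α, hα, C, hC, hosc⟩ := hφ.exists_osc h hu hU hUb hr hF0
  obtain ⟨β, hβ, ε, hε, R0, hR0, Ci, hCi, hinterior⟩ := exists_interior_holder n hu.lam_pos hu.one_le
  have hα0 := hα.1
  set δ := min (1 / (2 * C1)) (min R0 ((ε / C) ^ (1 / α) / 2)) with hδ
  have hδ0 : 0 < δ := lt_min (by positivity) (lt_min hR0.1 (by positivity))
  have hδ1 : δ ≤ 1 / (2 * C1) := min_le_left _ _
  have hδR : δ ≤ R0 := (min_le_right _ _).trans (min_le_left _ _)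
  have hδε : C * (2 * δ) ^ α ≤ ε := by
    have h1 : 2 * δ ≤ (ε / C) ^ (1 / α) := by
      have : δ ≤ (ε / C) ^ (1 / α) / 2 := (min_le_right _ _).trans (min_le_right _ _)
      linarith
    have h2 := Real.rpow_le_rpow (by positivity) h1 hα0.le
    rw [← Real.rpow_mul (by positivity), one_div_mul_cancel hα0.ne', Real.rpow_one] at h2
    have h3 := mul_le_mul_of_nonneg_left h2 hC.le
    rwa [mul_div_cancel₀ _ hC.ne'] at h3
  have hr40 := hr4.1
  set r5 := min (1 / 2) (min (r4 / 2) (δ / C1)) with hr5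
  have hr50 : 0 < r5 := lt_min (by norm_num) (lt_min (by positivity) (by positivity))
  have hr5h : r5 ≤ 1 / 2 := min_le_left _ _
  have hr54 : r5 ≤ r4 / 2 := (min_le_right _ _).trans (min_le_left _ _)
  have hr5δ : r5 * C1 ≤ δ :=
    (le_div_iff₀ hC1').mp ((min_le_right _ _).trans (min_le_right _ _))
  have hτ : α * β / 4 ∈ Ioo (0 : ℝ) 1 := by
    have h1 := mul_pos hα.1 hβ.1
    have h2 : α * β < 1 := by nlinarith [hα.2, hβ.2, hβ.1]
    exact ⟨by linarith, by linarith⟩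
  refine ⟨r5, hr50, α * β / 4, hτ, 2 * C + 4 * C1 ^ 2 * Ci, by positivity, ?_⟩
  rintro y1 ⟨hy1U, hy1⟩ y2 ⟨hy2U, hy2⟩
  rcases eq_or_ne y1 y2 with rfl | hne
  · simp only [sub_self, norm_zero]
    positivity
  rw [mem_ball_iff_norm] at hy1 hy2
  have hs : 0 < ‖y1 - y2‖ := norm_pos_iff.mpr (sub_ne_zero.mpr hne)
  have hs1 : ‖y1 - y2‖ ≤ 1 := by
    have := norm_sub_le_norm_sub_add_norm_sub y1 x0 y2
    rw [norm_sub_rev x0 y2] at this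
    linarith
  have hF1 : 0 < F y1 := (h.mem_iff y1 (hUb hy1U)).1 hy1U
  have hF2 : 0 < F y2 := (h.mem_iff y2 (hUb hy2U)).1 hy2U
  have hF1le : F y1 ≤ C1 * ‖y1 - x0‖ := by
    have := (abs_le.mp (h.abs_sub_le (hUb hy1U) (Metric.mem_ball_self hr))).2
    linarith
  have hF1δ : F y1 ≤ δ := by nlinarith
  set R := F y1 / (2 * C1) with hR
  have hR0' : 0 < R := by positivity
  have hRx : R ≤ ‖y1 - x0‖ / 2 := by rw [hR, div_le_iff₀ (by positivity)]; linarith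
  have hRF : R ≤ F y1 := by rw [hR, div_le_iff₀ (by positivity)]; nlinarith
  have hmem : ∀ x ∈ Metric.closedBall y1 R, x ∈ U ∧ ‖x - x0‖ < r4 := fun x hx => by
    refine ⟨(h.mem_closedBall hF1 (by linarith [hr4.2]) hx).1, ?_⟩
    rw [mem_closedBall_iff_norm] at hx
    have := norm_sub_le_norm_sub_add_norm_sub x y1 x0
    linarith
  have hy1r4 : y1 ∈ Metric.ball x0 r4 := by rw [mem_ball_iff_norm]; linarith
  have hoscR : ∀ x ∈ Metric.closedBall y1 R, ‖fderiv ℝ u x - fderiv ℝ u y1‖ ≤ ε := fun x hx => by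
    obtain ⟨hxU, hxr⟩ := hmem x hx
    have h1 := hosc y1 hy1r4 x (mem_ball_iff_norm.mpr hxr) hF1 ((h.mem_iff x (hUb hxU)).1 hxU)
    rw [norm_sub_rev]
    refine h1.trans (le_trans (mul_le_mul_of_nonneg_left (Real.rpow_le_rpow (by positivity) ?_
      hα0.le) hC.le) hδε)
    rw [mem_closedBall_iff_norm, norm_sub_rev] at hx
    linarith
  have hholder := hinterior Ω u A f hu y1 R hR0' (by linarith) (fun x hx => hU (hmem x hx).1) hoscR
  refine holder_combine hs hs1 hF1 hC1 (hF1δ.trans hδ1) hC hCi hα hβ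
    (hosc y1 hy1r4 y2 (by rw [mem_ball_iff_norm]; linarith) hF1 hF2) fun hle => ?_
  have := hholder y2 (by rw [mem_closedBall_iff_norm, norm_sub_rev]; exact hle)
  rwa [norm_sub_rev, norm_sub_rev y2 y1] at this

end

section

theorem exists_eventually_norm_fderiv_le {E G : Type*} [NormedAddCommGroup E] [NormedSpace ℝ E]
    [NormedAddCommGroup G] [NormedSpace ℝ G] {g : E → G} {S V : Set E} {p : E}
    (hg : ContDiffWithinAt ℝ 1 g S p) (hV : IsOpen V) (hVS : V ⊆ S) :
    ∃ M, ∀ᶠ x in 𝓝[V] p, ‖fderiv ℝ g x‖ ≤ M := by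
  obtain ⟨u, hu, -, g', hg', hc⟩ := (contDiffWithinAt_succ_iff_hasFDerivWithinAt (n := 0)
    (by simp)).1 (by simpa using hg)
  have huV : ∀ᶠ x in 𝓝[V] p, x ∈ u :=
    nhdsWithin_mono p (hVS.trans (subset_insert p S)) hu
  have hc' : ContinuousWithinAt g' V p := hc.continuousWithinAt.mono_of_mem_nhdsWithin huV
  refine ⟨‖g' p‖ + 1, ?_⟩
  filter_upwards [eventually_eventually_nhdsWithin.2 huV, huV, self_mem_nhdsWithin,
    hc'.norm.eventually (Iio_mem_nhds (lt_add_one _))] with x h1 h2 h3 h4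
  rw [hV.nhdsWithin_eq h3] at h1
  rw [((hg' x h2).hasFDerivAt h1).fderiv]
  exact le_of_lt h4

theorem exists_eventually_norm_fderiv_fderiv_le {E G : Type*} [NormedAddCommGroup E]
    [NormedSpace ℝ E] [NormedAddCommGroup G] [NormedSpace ℝ G] {g : E → G} {S V : Set E} {p : E}
    (hg : ContDiffWithinAt ℝ 2 g S p) (hV : IsOpen V) (hVS : V ⊆ S) :
    ∃ M, ∀ᶠ x in 𝓝[V] p, ‖fderiv ℝ g x‖ ≤ M ∧ ‖fderiv ℝ (fderiv ℝ g) x‖ ≤ M := by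
  obtain ⟨M1, hM1⟩ := exists_eventually_norm_fderiv_le (hg.of_le one_le_two) hV hVS
  obtain ⟨u, hu, -, g', hg', hc⟩ := (contDiffWithinAt_succ_iff_hasFDerivWithinAt (n := 1)
    (by simp)).1 (by rwa [one_add_one_eq_two])
  have huV : ∀ᶠ x in 𝓝[V] p, x ∈ u :=
    nhdsWithin_mono p (hVS.trans (subset_insert p S)) hu
  obtain ⟨M2, hM2⟩ := exists_eventually_norm_fderiv_le
    ((hc.mono inter_subset_right).mono_of_mem_nhdsWithin (Filter.inter_mem self_mem_nhdsWithin huV))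
    hV Subset.rfl
  refine ⟨max M1 M2, ?_⟩
  filter_upwards [eventually_eventually_nhdsWithin.2 huV, self_mem_nhdsWithin, hM1, hM2]
    with x h1 h3 h4 h5
  rw [hV.nhdsWithin_eq h3] at h1
  have he : fderiv ℝ g =ᶠ[𝓝 x] g' := by
    filter_upwards [eventually_eventually_nhds.2 h1, h1] with y hy hyu
    exact ((hg' y hyu).hasFDerivAt hy).fderiv
  rw [he.fderiv_eq]
  exact ⟨h4.trans (le_max_left _ _), h5.trans (le_max_right _ _)⟩

theorem eventually_norm_lt_add_one {X G : Type*} [TopologicalSpace X] [NormedAddCommGroup G]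
    {g : X → G} (hg : Continuous g) (x : X) : ∀ᶠ y in 𝓝 x, ‖g y‖ < ‖g x‖ + 1 :=
  hg.norm.continuousAt.eventually (Iio_mem_nhds (lt_add_one _))

theorem exists_unit_dir {n : ℕ} {L : Eu n →L[ℝ] ℝ} (hL : L ≠ 0) : ∃ ν : Eu n, ‖ν‖ = 1 ∧ 0 < L ν := by
  obtain ⟨v, hv⟩ : ∃ v, L v ≠ 0 := by
    by_contra! hh
    exact hL (ContinuousLinearMap.ext hh)
  have hv0 : v ≠ 0 := fun h0 => hv (by rw [h0, map_zero])
  have hvn : 0 < ‖v‖ := norm_pos_iff.mpr hv0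
  rcases lt_or_gt_of_ne hv with h | h
  · refine ⟨-(‖v‖⁻¹ • v), ?_, ?_⟩
    · rw [norm_neg, norm_smul, norm_inv, norm_norm, inv_mul_cancel₀ hvn.ne']
    · rw [map_neg, map_smul, smul_eq_mul, ← mul_neg]
      exact mul_pos (by positivity) (by linarith)
  · refine ⟨‖v‖⁻¹ • v, ?_, ?_⟩
    · rw [norm_smul, norm_inv, norm_norm, inv_mul_cancel₀ hvn.ne']
    · rw [map_smul, smul_eq_mul]
      exact mul_pos (by positivity) h

variable {n : ℕ} {Ω T : Set (Eu n)} {u φ f : Eu n → ℝ} {x0 : Eu n}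
  {A : Eu n → Matrix (Fin n) (Fin n) ℝ} {lam C0 : ℝ}

theorem IsSolution.exists_holder_of_mem_boundary (hu : IsSolution Ω u A f lam C0)
    (hTopen : ∃ O : Set (Eu n), IsOpen O ∧ T = frontier Ω ∩ O)
    (hT : BoundaryCAt 2 Ω x0) (hx0 : x0 ∈ T) (hφ : ContDiffOn ℝ 2 φ (Ω ∪ T))
    (huc : ContinuousOn u (Ω ∪ T)) (hbc : ∀ x ∈ T, u x = φ x) :
    ∃ r > 0, ∃ τ ∈ Ioo (0 : ℝ) 1, ∃ C > 0, ∀ y1 ∈ Ω ∩ Metric.ball x0 r,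
      ∀ y2 ∈ Ω ∩ Metric.ball x0 r,
      ‖fderiv ℝ u y1 - fderiv ℝ u y2‖ ≤ C * ‖y1 - y2‖ ^ τ := by
  obtain ⟨O, hO, rfl⟩ := hTopen
  obtain ⟨g, s, hs, hx0s, hg, hgs, hfr, hin⟩ := hT
  set F : Eu n → ℝ := fun x => -g x with hF
  have hFc : ContDiff ℝ 2 F := hg.neg
  have hF0 : F x0 = 0 := by
    have : x0 ∈ {x ∈ s | g x = 0} := hfr ▸ ⟨hx0.1, hx0s⟩
    simp [hF, this.2]
  have hdF : fderiv ℝ F x0 ≠ 0 := by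
    rw [hF, fderiv_fun_neg]; exact neg_ne_zero.mpr (hgs x0 hx0s)
  obtain ⟨ν, hν, hdν⟩ := exists_unit_dir hdF
  have hF1 : ContDiff ℝ 1 (fderiv ℝ F) := hFc.fderiv_right (by norm_num)
  have hF2 : Continuous (fderiv ℝ (fderiv ℝ F)) := hF1.continuous_fderiv (by norm_num)
  obtain ⟨M, hM⟩ := exists_eventually_norm_fderiv_fderiv_le (hφ x0 (Or.inr hx0)) hu.isOpen
    (subset_union_left (t := frontier Ω ∩ O))
  set C1 := max 1 (max M (max (‖fderiv ℝ F x0‖ + 1) (‖fderiv ℝ (fderiv ℝ F) x0‖ + 1))) with hC1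
  set c := min 1 (fderiv ℝ F x0 ν / 2) with hc
  have hMC : M ≤ C1 := (le_max_left _ _).trans (le_max_right _ _)
  have e1 : ∀ᶠ x in 𝓝 x0, ‖fderiv ℝ F x‖ < ‖fderiv ℝ F x0‖ + 1 :=
    eventually_norm_lt_add_one hF1.continuous x0
  have e2 : ∀ᶠ x in 𝓝 x0, ‖fderiv ℝ (fderiv ℝ F) x‖ < ‖fderiv ℝ (fderiv ℝ F) x0‖ + 1 :=
    eventually_norm_lt_add_one (G := Eu n →L[ℝ] Eu n →L[ℝ] ℝ) hF2 x0
  have e3 : ∀ᶠ x in 𝓝 x0, fderiv ℝ F x0 ν / 2 < fderiv ℝ F x ν :=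
    (hF1.continuous.clm_apply continuous_const).continuousAt.eventually
      (Ioi_mem_nhds (half_lt_self hdν))
  obtain ⟨r, hr, hball⟩ := Metric.eventually_nhds_iff_ball.1 (((e1.and e2).and e3).and
    ((eventually_nhdsWithin_iff.1 hM).and ((hs.eventually_mem hx0s).and (hO.eventually_mem hx0.2))))
  have hchart : BoundaryChart (Ω ∩ Metric.ball x0 r) F ν x0 r c C1 :=
    { norm_dir := hν
      pos := lt_min one_pos (by positivity)
      le_one := min_le_left _ _
      one_le := le_max_left _ _
      contDiffAt := fun x _ => hFc.contDiffAt
      norm_fderiv_le := fun x hx => (hball x hx).1.1.1.le.trans ((le_max_left _ _).trans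
        ((le_max_right _ _).trans (le_max_right _ _)))
      norm_fderiv_fderiv_le := fun x hx => (hball x hx).1.1.2.le.trans ((le_max_right _ _).trans
        ((le_max_right _ _).trans (le_max_right _ _)))
      le_fderiv_dir := fun x hx => (min_le_right _ _).trans (hball x hx).1.2.le
      mem_iff := fun x hx => by
        have hxs : x ∈ s := (hball x hx).2.2.1
        have h1 : x ∈ Ω ∩ s ↔ x ∈ {x ∈ s | g x < 0} := by rw [hin]
        simp only [mem_inter_iff, mem_ofPred_eq, hxs, and_true, true_and] at h1
        simp only [mem_inter_iff, hx, and_true, hF, Left.neg_pos_iff]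
        exact h1 }
  have hdatum : BoundaryDatum (Ω ∩ Metric.ball x0 r) u φ F x0 r C1 :=
    { contDiffAt := fun x hx => hφ.contDiffAt
        (Filter.mem_of_superset (hu.isOpen.mem_nhds hx.1) subset_union_left)
      norm_fderiv_le := fun x hx => ((hball x hx.2).2.1 hx.1).1.trans hMC
      norm_fderiv_fderiv_le := fun x hx => ((hball x hx.2).2.1 hx.1).2.trans hMC
      tendsto := fun z hz hFz => by
        have hzs : z ∈ s := (hball z hz).2.2.1
        have hz1 : z ∈ frontier Ω ∩ s := by
          rw [hfr]; exact ⟨hzs, by simpa [hF] using hFz⟩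
        have hzT : z ∈ frontier Ω ∩ O := ⟨hz1.1, (hball z hz).2.2.2⟩
        have h1 : ContinuousWithinAt (fun x => u x - φ x) (Ω ∪ frontier Ω ∩ O) z :=
          (huc z (Or.inr hzT)).sub (hφ.continuousOn z (Or.inr hzT))
        have h2 := h1.mono (inter_subset_left.trans subset_union_left :
          Ω ∩ Metric.ball x0 r ⊆ Ω ∪ frontier Ω ∩ O)
        have h3 : u z - φ z = 0 := sub_eq_zero.mpr (hbc z hzT)
        unfold ContinuousWithinAt at h2
        simpa only [h3] using h2 }
  obtain ⟨r5, hr5, τ, hτ, C, hC, H⟩ := hdatum.exists_local_holder hchart hu inter_subset_left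
    inter_subset_right hr hF0
  refine ⟨min r r5, lt_min hr hr5, τ, hτ, C, hC, fun y1 hy1 y2 hy2 => H y1 ?_ y2 ?_⟩
  · exact ⟨⟨hy1.1, Metric.ball_subset_ball (min_le_left _ _) hy1.2⟩,
      Metric.ball_subset_ball (min_le_right _ _) hy1.2⟩
  · exact ⟨⟨hy2.1, Metric.ball_subset_ball (min_le_left _ _) hy2.2⟩,
      Metric.ball_subset_ball (min_le_right _ _) hy2.2⟩

theorem IsSolution.exists_holder_of_mem (hu : IsSolution Ω u A f lam C0) (hx0 : x0 ∈ Ω) :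
    ∃ r > 0, ∃ τ ∈ Ioo (0 : ℝ) 1, ∃ C > 0, ∀ y1 ∈ Ω ∩ Metric.ball x0 r,
      ∀ y2 ∈ Ω ∩ Metric.ball x0 r,
      ‖fderiv ℝ u y1 - fderiv ℝ u y2‖ ≤ C * ‖y1 - y2‖ ^ τ := by
  have h1 : ContDiffAt ℝ 1 (fderiv ℝ u) x0 :=
    (hu.contDiffOn.contDiffAt (hu.isOpen.mem_nhds hx0)).fderiv_right (by norm_num)
  obtain ⟨K, t, ht, hK⟩ := h1.exists_lipschitzOnWith
  obtain ⟨r, hr, hball⟩ := Metric.mem_nhds_iff.1 ht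
  refine ⟨min r (1 / 2), lt_min hr (by norm_num), 1 / 2, ⟨by norm_num, by norm_num⟩, K + 1,
    by positivity, fun y1 hy1 y2 hy2 => ?_⟩
  have hb1 := Metric.ball_subset_ball (min_le_left r (1 / 2)) hy1.2
  have hb2 := Metric.ball_subset_ball (min_le_left r (1 / 2)) hy2.2
  have h2 := hK.norm_sub_le (hball hb1) (hball hb2)
  have hs : ‖y1 - y2‖ ≤ 1 := by
    have h3 := mem_ball_iff_norm.1 (Metric.ball_subset_ball (min_le_right r (1 / 2)) hy1.2)
    have h4 := mem_ball_iff_norm.1 (Metric.ball_subset_ball (min_le_right r (1 / 2)) hy2.2)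
    have := norm_sub_le_norm_sub_add_norm_sub y1 x0 y2
    rw [norm_sub_rev x0 y2] at this
    linarith
  have h5 : ‖y1 - y2‖ ≤ ‖y1 - y2‖ ^ (1 / 2 : ℝ) := by
    have := Real.rpow_le_rpow_of_exponent_ge' (norm_nonneg (y1 - y2)) hs (by norm_num : (0:ℝ) ≤ 1 / 2)
      (by norm_num : (1 / 2 : ℝ) ≤ 1)
    rwa [Real.rpow_one] at this
  have h6 : (K : ℝ) * ‖y1 - y2‖ ≤ (K + 1) * ‖y1 - y2‖ ^ (1 / 2 : ℝ) :=
    mul_le_mul (by linarith) h5 (norm_nonneg _) (by positivity)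
  exact h2.trans h6

end

section

variable {n : ℕ}

/-- The vector representing a linear form. -/
noncomputable def formVec (n : ℕ) : (Eu n →L[ℝ] ℝ) →L[ℝ] Eu n :=
  ∑ i, (ContinuousLinearMap.apply ℝ ℝ (EuclideanSpace.single i (1 : ℝ) : Eu n)).smulRight
    (EuclideanSpace.single i (1 : ℝ) : Eu n)

theorem formVec_apply (l : Eu n →L[ℝ] ℝ) (i : Fin n) :
    formVec n l i = l (EuclideanSpace.single i 1) := by
  simp [formVec, sum_apply, Finset.sum_apply, Pi.single_apply]

theorem inner_formVec (l : Eu n →L[ℝ] ℝ) (v : Eu n) : inner ℝ (formVec n l) v = l v := by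
  rw [clm_apply_eq_sum l v, PiLp.inner_apply]
  exact Finset.sum_congr rfl fun i _ => by simp [formVec_apply]

theorem norm_formVec (l : Eu n →L[ℝ] ℝ) : ‖formVec n l‖ = ‖l‖ := by
  apply le_antisymm
  · rcases (norm_nonneg (formVec n l)).eq_or_lt with h | h
    · rw [← h]; positivity
    · have h1 := inner_formVec l (formVec n l)
      rw [real_inner_self_eq_norm_sq] at h1
      have h2 := (le_abs_self _).trans (l.le_opNorm (formVec n l))
      rw [← h1, sq] at h2
      exact le_of_mul_le_mul_right h2 h
  · refine l.opNorm_le_bound (norm_nonneg _) fun v => ?_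
    rw [← inner_formVec l v]
    exact norm_inner_le_norm _ _

theorem gradE_eq_formVec (u : Eu n → ℝ) (x : Eu n) : gradE u x = formVec n (fderiv ℝ u x) := by
  ext i
  rw [formVec_apply]
  rfl

theorem norm_gradE_sub (u : Eu n → ℝ) (x y : Eu n) :
    ‖gradE u x - gradE u y‖ = ‖fderiv ℝ u x - fderiv ℝ u y‖ := by
  rw [gradE_eq_formVec, gradE_eq_formVec, ← map_sub, norm_formVec]

theorem sdE_eq {u : Eu n → ℝ} {x : Eu n} (h : DifferentiableAt ℝ (fderiv ℝ u) x) (i j : Fin n) :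
    sdE u x i j = fderiv ℝ (fderiv ℝ u) x (EuclideanSpace.single i 1)
      (EuclideanSpace.single j 1) := by
  unfold sdE
  rw [fderiv_clm_apply h (differentiableAt_const _)]
  simp

theorem exists_norm_fderiv_le_of_isCompact {E G : Type*} [NormedAddCommGroup E] [NormedSpace ℝ E]
    [NormedAddCommGroup G] [NormedSpace ℝ G] {g : E → G} {S V D : Set E}
    (hg : ContDiffOn ℝ 1 g S) (hV : IsOpen V) (hVS : V ⊆ S) (hD : IsCompact D) (hDS : D ⊆ S) :
    ∃ M, ∀ x ∈ D ∩ V, ‖fderiv ℝ g x‖ ≤ M := by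
  refine hD.induction_on (p := fun D' => ∃ M, ∀ x ∈ D' ∩ V, ‖fderiv ℝ g x‖ ≤ M)
    ⟨0, by simp⟩ (fun s t hst ⟨M, hM⟩ => ⟨M, fun x hx => hM x ⟨hst hx.1, hx.2⟩⟩)
    (fun s t ⟨M, hM⟩ ⟨M', hM'⟩ => ⟨max M M', fun x hx => ?_⟩) (fun x hx => ?_)
  · rcases hx.1 with h | h
    · exact (hM x ⟨h, hx.2⟩).trans (le_max_left _ _)
    · exact (hM' x ⟨h, hx.2⟩).trans (le_max_right _ _)
  · obtain ⟨M, hM⟩ := exists_eventually_norm_fderiv_le (hg x (hDS hx)) hV hVS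
    exact ⟨_, mem_nhdsWithin_of_mem_nhds (eventually_nhdsWithin_iff.1 hM), M,
      fun y hy => hy.1 hy.2⟩

variable {Ω : Set (Eu n)} {u : Eu n → ℝ} {K : ℝ} {g : Eu n × ℝ × Eu n → ℝ}

theorem mul_max_le {M K s t d : ℝ} (hM : 0 ≤ M) (hK : 0 ≤ K) (hs : 0 ≤ s) (hd : 0 ≤ d)
    (ht : t ≤ K * s) : M * max s (max t d) ≤ M * (1 + K) * (s + d) := by
  rw [mul_assoc]
  refine mul_le_mul_of_nonneg_left (max_le ?_ (max_le ?_ ?_)) hM <;>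
    nlinarith [mul_nonneg hK hs, mul_nonneg hK hd]

theorem exists_bounds_comp_jet (hΩ : IsOpen Ω) (hb : Bornology.IsBounded Ω)
    (hu : ContDiffOn ℝ 2 u Ω) (hK : 0 ≤ K) (hKu : ∀ x ∈ Ω, |u x| + ‖gradE u x‖ ≤ K)
    (hg : ContDiffOn ℝ 1 g (closure Ω ×ˢ (univ : Set (ℝ × Eu n)))) :
    ∃ M, ContDiffOn ℝ 1 (fun x => g (x, u x, gradE u x)) Ω ∧
      (∀ x ∈ Ω, |g (x, u x, gradE u x)| ≤ M) ∧
      (∀ x ∈ Ω, ∀ c, |fderiv ℝ (fun x => g (x, u x, gradE u x)) x c| ≤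
        M * (‖c‖ + ‖fderiv ℝ (fderiv ℝ u) x c‖)) ∧
      ∀ x y, segment ℝ x y ⊆ Ω → |g (x, u x, gradE u x) - g (y, u y, gradE u y)| ≤
        M * (‖x - y‖ + ‖fderiv ℝ u x - fderiv ℝ u y‖) := by
  set B : Set (ℝ × Eu n) := Icc (-K) K ×ˢ Metric.closedBall 0 K with hB
  set D : Set (Eu n × ℝ × Eu n) := closure Ω ×ˢ B with hD
  have hBc : IsCompact B := isCompact_Icc.prod (isCompact_closedBall 0 K)
  have hDc : IsCompact D := hb.isCompact_closure.prod hBc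
  have hDS : D ⊆ closure Ω ×ˢ univ := prod_mono_right (subset_univ _)
  have hVS : Ω ×ˢ (univ : Set (ℝ × Eu n)) ⊆ closure Ω ×ˢ univ := prod_mono_left subset_closure
  have hV : IsOpen (Ω ×ˢ (univ : Set (ℝ × Eu n))) := hΩ.prod isOpen_univ
  have hgV : ∀ y ∈ Ω ×ˢ (univ : Set (ℝ × Eu n)), DifferentiableAt ℝ g y := fun y hy =>
    ((hg.mono hVS).contDiffAt (hV.mem_nhds hy)).differentiableAt one_ne_zero
  obtain ⟨M0, hM0⟩ := hDc.exists_bound_of_continuousOn (hg.continuousOn.mono hDS)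
  obtain ⟨M1, hM1⟩ := exists_norm_fderiv_le_of_isCompact hg hV hVS hDc hDS
  have hw : ∀ x ∈ Ω, (u x, gradE u x) ∈ B := fun x hx => by
    have h1 := hKu x hx
    have h2 := norm_nonneg (gradE u x)
    have h3 := abs_nonneg (u x)
    exact ⟨abs_le.1 (by linarith), by simpa using (by linarith : ‖gradE u x‖ ≤ K)⟩
  have hdu : ∀ x ∈ Ω, ‖fderiv ℝ u x‖ ≤ K := fun x hx => by
    rw [← norm_formVec, ← gradE_eq_formVec]
    linarith [hKu x hx, abs_nonneg (u x)]
  have hcd : ∀ x ∈ Ω, ContDiffAt ℝ 2 u x := fun x hx => hu.contDiffAt (hΩ.mem_nhds hx)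
  have hgr : gradE u = fun x => formVec n (fderiv ℝ u x) := funext (gradE_eq_formVec u)
  set N := max M1 0 with hN
  have hN0 : 0 ≤ N := le_max_right _ _
  have hMN : M0 ≤ max M0 (N * (1 + K)) := le_max_left _ _
  have hNN : N * (1 + K) ≤ max M0 (N * (1 + K)) := le_max_right _ _
  refine ⟨max M0 (N * (1 + K)), ?_, fun x hx => ?_, fun x hx c => ?_, fun x y hxy => ?_⟩
  · refine hg.comp (t := closure Ω ×ˢ univ) (fun x hx => ?_)
      fun x hx => ⟨subset_closure hx, mem_univ _⟩
    have h1 : ContDiffAt ℝ 1 (gradE u) x := by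
      rw [hgr]
      exact (formVec n).contDiff.contDiffAt.comp x ((hcd x hx).fderiv_right (by norm_num))
    exact (contDiffAt_id.prodMk
      (((hcd x hx).of_le one_le_two).prodMk h1)).contDiffWithinAt
  · exact (hM0 _ ⟨subset_closure hx, hw x hx⟩).trans hMN
  · have h1 := ((hcd x hx).differentiableAt two_ne_zero).hasFDerivAt
    have h2 : HasFDerivAt (fderiv ℝ u) (fderiv ℝ (fderiv ℝ u) x) x :=
      (((hcd x hx).fderiv_right (m := 1) (by norm_num)).differentiableAt one_ne_zero).hasFDerivAt
    have h3 : HasFDerivAt (gradE u) ((formVec n).comp (fderiv ℝ (fderiv ℝ u) x)) x := by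
      rw [hgr]
      exact (formVec n).hasFDerivAt.comp x h2
    have h4 := (hgV (x, u x, gradE u x) ⟨hx, mem_univ _⟩).hasFDerivAt.comp x
      ((hasFDerivAt_id x).prodMk (h1.prodMk h3))
    have h5 : fderiv ℝ (fun x => g (x, u x, gradE u x)) x = _ := h4.fderiv
    rw [h5]
    refine le_trans ?_ (mul_le_mul_of_nonneg_right hNN (by positivity))
    refine le_trans ?_ (mul_max_le (t := ‖fderiv ℝ u x c‖) hN0 hK (norm_nonneg c) (norm_nonneg _)
      (((fderiv ℝ u x).le_opNorm c).trans
        (mul_le_mul_of_nonneg_right (hdu x hx) (norm_nonneg c))))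
    refine (ContinuousLinearMap.le_of_opNorm_le _
      ((hM1 _ ⟨⟨subset_closure hx, hw x hx⟩, hx, mem_univ _⟩).trans (le_max_left M1 0)) _).trans
      (le_of_eq ?_)
    simp [Prod.norm_def, norm_formVec, hN]
  · have hx := hxy (left_mem_segment ℝ x y)
    have hy := hxy (right_mem_segment ℝ x y)
    have hconv : Convex ℝ (segment ℝ x y ×ˢ B) :=
      (convex_segment x y).prod ((convex_Icc _ _).prod (convex_closedBall _ _))
    have h1 := hconv.norm_image_sub_le_of_norm_fderiv_le (𝕜 := ℝ) (f := g) (C := N)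
      (fun z hz => hgV z ⟨hxy hz.1, mem_univ _⟩)
      (fun z hz => (hM1 z ⟨⟨subset_closure (hxy hz.1), hz.2⟩, hxy hz.1, mem_univ _⟩).trans
        (le_max_left M1 0))
      (show (y, u y, gradE u y) ∈ _ from ⟨right_mem_segment ℝ x y, hw y hy⟩)
      (show (x, u x, gradE u x) ∈ _ from ⟨left_mem_segment ℝ x y, hw x hx⟩)
    have h2 := (convex_segment x y).norm_image_sub_le_of_norm_fderiv_le (𝕜 := ℝ) (f := u) (C := K)
      (fun z hz => (hcd z (hxy hz)).differentiableAt two_ne_zero) (fun z hz => hdu z (hxy hz))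
      (right_mem_segment ℝ x y) (left_mem_segment ℝ x y)
    refine le_trans ?_ (mul_le_mul_of_nonneg_right hNN (by positivity))
    refine le_trans ?_ (mul_max_le hN0 hK (norm_nonneg (x - y)) (norm_nonneg _) h2)
    refine h1.trans (le_of_eq ?_)
    rw [← norm_gradE_sub]
    rfl

variable {a : Fin n → Fin n → Eu n × ℝ × Eu n → ℝ} {b : Eu n × ℝ × Eu n → ℝ}

theorem exists_ellipticity_const {X : Type*} [TopologicalSpace X] {D : Set X}
    {α : Fin n → Fin n → X → ℝ} (hD : IsCompact D) (hα : ∀ i j, ContinuousOn (α i j) D)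
    (hpos : ∀ w ∈ D, ∀ ξ : Eu n, ξ ≠ 0 → 0 < ∑ i, ∑ j, α i j w * ξ i * ξ j) :
    ∃ lam > 0, ∀ w ∈ D, ∀ ξ : Eu n, lam * ‖ξ‖ ^ 2 ≤ ∑ i, ∑ j, α i j w * ξ i * ξ j := by
  have hcont : ContinuousOn (fun q : X × Eu n => ∑ i, ∑ j, α i j q.1 * q.2 i * q.2 j)
      (D ×ˢ Metric.sphere (0 : Eu n) 1) := by
    refine continuousOn_finsetSum _ fun i _ => continuousOn_finsetSum _ fun j _ => ?_
    have h1 : ContinuousOn (fun q : X × Eu n => α i j q.1) (D ×ˢ Metric.sphere (0 : Eu n) 1) :=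
      (hα i j).comp continuousOn_fst fun q hq => hq.1
    exact (h1.mul (by fun_prop)).mul (by fun_prop)
  obtain ⟨lam, hlam, H⟩ := (hD.prod (isCompact_sphere (0 : Eu n) 1)).exists_forall_le' hcont
    (a := 0) fun q hq => hpos q.1 hq.1 q.2 (ne_zero_of_mem_unit_sphere ⟨q.2, hq.2⟩)
  refine ⟨lam, hlam, fun w hw ξ => ?_⟩
  rcases eq_or_ne ξ 0 with rfl | hξ
  · simp
  · have hn : 0 < ‖ξ‖ := norm_pos_iff.2 hξ
    have h1 := H (w, ‖ξ‖⁻¹ • ξ) ⟨hw, by simp [norm_smul, hn.ne']⟩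
    have h2 : ∑ i, ∑ j, α i j w * (‖ξ‖⁻¹ • ξ) i * (‖ξ‖⁻¹ • ξ) j =
        (‖ξ‖ ^ 2)⁻¹ * ∑ i, ∑ j, α i j w * ξ i * ξ j := by
      simp only [Finset.mul_sum]
      refine Finset.sum_congr rfl fun i _ => Finset.sum_congr rfl fun j _ => ?_
      simp only [PiLp.smul_apply, smul_eq_mul]
      ring
    rw [h2, inv_mul_eq_div, le_div_iff₀ (by positivity)] at h1
    exact h1

theorem exists_isSolution (hΩ : IsOpen Ω) (hbd : Bornology.IsBounded Ω)
    (ha : ∀ i j, ContDiffOn ℝ 1 (a i j) (closure Ω ×ˢ (univ : Set (ℝ × Eu n))))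
    (hb : ContDiffOn ℝ 1 b (closure Ω ×ˢ (univ : Set (ℝ × Eu n))))
    (hsym : ∀ (i j : Fin n) (x : Eu n) (z : ℝ) (p : Eu n), x ∈ closure Ω →
      a i j (x, z, p) = a j i (x, z, p))
    (hell : ∀ (x : Eu n) (z : ℝ) (p : Eu n), x ∈ closure Ω → ∀ ξ : Eu n, ξ ≠ 0 →
      0 < ∑ i, ∑ j, a i j (x, z, p) * ξ i * ξ j)
    (hu : ContDiffOn ℝ 2 u Ω)
    (hQ : ∀ x ∈ Ω,
      (∑ i, ∑ j, a i j (x, u x, gradE u x) * sdE u x i j) + b (x, u x, gradE u x) = 0)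
    (hK : 0 ≤ K) (hKu : ∀ x ∈ Ω, |u x| + ‖gradE u x‖ ≤ K) :
    ∃ lam C0, IsSolution Ω u (fun x i j => a i j (x, u x, gradE u x))
      (fun x => b (x, u x, gradE u x)) lam C0 := by
  choose Ma hMa using fun i j => exists_bounds_comp_jet hΩ hbd hu hK hKu (ha i j)
  obtain ⟨Mb, hMb⟩ := exists_bounds_comp_jet hΩ hbd hu hK hKu hb
  obtain ⟨lam, hlam, hl⟩ := exists_ellipticity_const
    (D := closure Ω ×ˢ (Icc (-K) K ×ˢ Metric.closedBall (0 : Eu n) K)) (α := a)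
    (hbd.isCompact_closure.prod (isCompact_Icc.prod (isCompact_closedBall 0 K)))
    (fun i j => (ha i j).continuousOn.mono (prod_mono_right (subset_univ _)))
    (fun w hw ξ hξ => hell w.1 w.2.1 w.2.2 hw.1 ξ hξ)
  set C0 := 1 + K + |Mb| + ∑ i, ∑ j, |Ma i j| with hC0
  have hsum : 0 ≤ ∑ i, ∑ j, |Ma i j| := by positivity
  have hMaC : ∀ i j, Ma i j ≤ C0 := fun i j => by
    have h1 : |Ma i j| ≤ ∑ j, |Ma i j| :=
      Finset.single_le_sum (f := fun j => |Ma i j|) (fun _ _ => abs_nonneg _) (Finset.mem_univ j)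
    have h2 : ∑ j, |Ma i j| ≤ ∑ i, ∑ j, |Ma i j| :=
      Finset.single_le_sum (f := fun i => ∑ j, |Ma i j|)
        (fun _ _ => Finset.sum_nonneg fun _ _ => abs_nonneg _) (Finset.mem_univ i)
    linarith [le_abs_self (Ma i j), abs_nonneg Mb]
  have hMbC : Mb ≤ C0 := by linarith [le_abs_self Mb]
  refine ⟨lam, C0, ?_⟩
  exact
    { isOpen := hΩ
      lam_pos := hlam
      one_le := by linarith [abs_nonneg Mb]
      contDiffOn := hu
      contDiffOn_coeff := fun i j => (hMa i j).1
      contDiffOn_rhs := hMb.1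
      elliptic := fun x hx =>
        { symm := fun i j => hsym i j x _ _ (subset_closure hx)
          lower := fun ξ => by
            have h1 := hKu x hx
            have h2 := norm_nonneg (gradE u x)
            have h3 := abs_nonneg (u x)
            exact hl (x, u x, gradE u x) ⟨subset_closure hx, abs_le.1 (by linarith),
              by simpa using (by linarith : ‖gradE u x‖ ≤ K)⟩ ξ
          upper := fun i j => ((hMa i j).2.1 x hx).trans (hMaC i j) }
      fderiv_coeff := fun x hx i j c => ((hMa i j).2.2.1 x hx c).trans
        (mul_le_mul_of_nonneg_right (hMaC i j) (by positivity))
      fderiv_rhs := fun x hx c => (hMb.2.2.1 x hx c).trans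
        (mul_le_mul_of_nonneg_right hMbC (by positivity))
      coeff_sub_le := fun x y hxy i j => ((hMa i j).2.2.2 x y hxy).trans
        (mul_le_mul_of_nonneg_right (hMaC i j) (by positivity))
      rhs_le := fun x hx => (hMb.2.1 x hx).trans hMbC
      norm_fderiv_le := fun x hx => by
        rw [← norm_formVec, ← gradE_eq_formVec]
        linarith [hKu x hx, abs_nonneg (u x), abs_nonneg Mb]
      eqn := fun x hx => by
        rw [← hQ x hx]
        congr 1
        have h2 : DifferentiableAt ℝ (fderiv ℝ u) x :=
          ((hu.contDiffAt (hΩ.mem_nhds hx)).fderiv_right (m := 1)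
            (by norm_num)).differentiableAt one_ne_zero
        simp only [trHess, sdE_eq h2] }

end

section

/-- Local Hölder bounds around the points of a compact set give a global one. -/
theorem exists_holder_of_local {E F : Type*} [NormedAddCommGroup E] [NormedAddCommGroup F]
    {Ω D : Set E} {v : E → F} {M : ℝ} (hD : IsCompact D) (hM : ∀ x ∈ Ω, ‖v x‖ ≤ M)
    (hloc : ∀ x0 ∈ D, ∃ r > 0, ∃ τ ∈ Ioo (0 : ℝ) 1, ∃ C > 0, ∀ y1 ∈ Ω ∩ Metric.ball x0 r,
      ∀ y2 ∈ Ω ∩ Metric.ball x0 r, ‖v y1 - v y2‖ ≤ C * ‖y1 - y2‖ ^ τ) :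
    ∃ τ ∈ Ioo (0 : ℝ) 1, ∃ C > 0, ∀ y1 ∈ Ω ∩ D, ∀ y2 ∈ Ω ∩ D,
      ‖v y1 - v y2‖ ≤ C * ‖y1 - y2‖ ^ τ := by
  have key : ∃ τ ∈ Ioo (0 : ℝ) 1, ∃ δ ∈ Ioc (0 : ℝ) 1, ∃ C > 0, ∀ y1 ∈ Ω ∩ D, ∀ y2 ∈ Ω,
      ‖y1 - y2‖ < δ → ‖v y1 - v y2‖ ≤ C * ‖y1 - y2‖ ^ τ := by
    refine hD.induction_on (p := fun D' => ∃ τ ∈ Ioo (0 : ℝ) 1, ∃ δ ∈ Ioc (0 : ℝ) 1, ∃ C > 0,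
      ∀ y1 ∈ Ω ∩ D', ∀ y2 ∈ Ω, ‖y1 - y2‖ < δ → ‖v y1 - v y2‖ ≤ C * ‖y1 - y2‖ ^ τ) ?_ ?_ ?_ ?_
    · exact ⟨1 / 2, by norm_num, 1, by norm_num, 1, one_pos, by simp⟩
    · rintro s t hst ⟨τ, hτ, δ, hδ, C, hC, H⟩
      exact ⟨τ, hτ, δ, hδ, C, hC, fun y1 h1 => H y1 ⟨h1.1, hst h1.2⟩⟩
    · rintro s t ⟨τ, hτ, δ, hδ, C, hC, H⟩ ⟨τ', hτ', δ', hδ', C', hC', H'⟩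
      refine ⟨min τ τ', ⟨lt_min hτ.1 hτ'.1, min_lt_of_left_lt hτ.2⟩, min δ δ',
        ⟨lt_min hδ.1 hδ'.1, min_le_of_left_le hδ.2⟩, max C C', lt_max_of_lt_left hC,
        fun y1 h1 y2 h2 h3 => ?_⟩
      have hle : ‖y1 - y2‖ ≤ 1 := h3.le.trans (min_le_of_left_le hδ.2)
      rcases h1.2 with h | h
      · refine (H y1 ⟨h1.1, h⟩ y2 h2 (h3.trans_le (min_le_left _ _))).trans ?_
        exact mul_le_mul (le_max_left _ _) (Real.rpow_le_rpow_of_exponent_ge'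
          (norm_nonneg _) hle (lt_min hτ.1 hτ'.1).le (min_le_left _ _)) (by positivity)
          (hC.le.trans (le_max_left _ _))
      · refine (H' y1 ⟨h1.1, h⟩ y2 h2 (h3.trans_le (min_le_right _ _))).trans ?_
        exact mul_le_mul (le_max_right _ _) (Real.rpow_le_rpow_of_exponent_ge'
          (norm_nonneg _) hle (lt_min hτ.1 hτ'.1).le (min_le_right _ _)) (by positivity)
          (hC.le.trans (le_max_left _ _))
    · intro x hx
      obtain ⟨r, hr, τ, hτ, C, hC, H⟩ := hloc x hx
      refine ⟨Metric.ball x (r / 2), mem_nhdsWithin_of_mem_nhds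
        (Metric.ball_mem_nhds x (half_pos hr)), τ, hτ, min 1 (r / 2),
        ⟨lt_min one_pos (half_pos hr), min_le_left _ _⟩, C, hC, fun y1 h1 y2 h2 h3 => ?_⟩
      have h4 : dist y2 x < r := by
        have h5 : dist y2 y1 < r / 2 := by
          rw [dist_eq_norm, norm_sub_rev]; exact h3.trans_le (min_le_right _ _)
        have h6 : dist y1 x < r / 2 := h1.2
        linarith [dist_triangle y2 y1 x]
      exact H y1 ⟨h1.1, Metric.ball_subset_ball (half_le_self hr.le) h1.2⟩ y2 ⟨h2, h4⟩
  obtain ⟨τ, hτ, δ, hδ, C, hC, H⟩ := key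
  have hδτ : 0 < δ ^ τ := Real.rpow_pos_of_pos hδ.1 τ
  refine ⟨τ, hτ, max C (2 * |M| / δ ^ τ), lt_max_of_lt_left hC, fun y1 h1 y2 h2 => ?_⟩
  rcases lt_or_ge ‖y1 - y2‖ δ with h | h
  · exact (H y1 h1 y2 h2.1 h).trans
      (mul_le_mul_of_nonneg_right (le_max_left _ _) (by positivity))
  · calc ‖v y1 - v y2‖ ≤ 2 * |M| := by
          linarith [norm_sub_le (v y1) (v y2), hM y1 h1.1, hM y2 h2.1, le_abs_self M]
      _ = 2 * |M| / δ ^ τ * δ ^ τ := by field_simp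
      _ ≤ max C (2 * |M| / δ ^ τ) * ‖y1 - y2‖ ^ τ :=
          mul_le_mul (le_max_right _ _) (Real.rpow_le_rpow hδ.1.le h hτ.1.le) hδτ.le
            (hC.le.trans (le_max_left _ _))

theorem exists_holder_extension {E F : Type*} [NormedAddCommGroup E] [NormedAddCommGroup F]
    [CompleteSpace F] {S : Set E} {v : E → F} {τ C : ℝ} (hτ : 0 < τ)
    (hv : ∀ x ∈ S, ∀ y ∈ S, ‖v x - v y‖ ≤ C * ‖x - y‖ ^ τ) :
    ∃ G : E → F, ContinuousOn G (closure S) ∧ (∀ x ∈ S, G x = v x) ∧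
      ∀ x ∈ closure S, ∀ y ∈ closure S, ‖G x - G y‖ ≤ C * ‖x - y‖ ^ τ := by
  have hcont : Continuous (fun p : E × E => C * ‖p.1 - p.2‖ ^ τ) :=
    continuous_const.mul ((continuous_fst.sub continuous_snd).norm.rpow_const
      fun _ => Or.inr hτ.le)
  have hlim : ∀ x ∈ closure S, ∃ y, Filter.Tendsto v (𝓝[S] x) (𝓝 y) := by
    intro x hx
    have : (𝓝[S] x).NeBot := mem_closure_iff_nhdsWithin_neBot.1 hx
    refine cauchy_map_iff_exists_tendsto.1 (cauchy_map_iff.2 ⟨inferInstance, ?_⟩)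
    rw [tendsto_uniformity_iff_dist_tendsto_zero]
    have h1 : Filter.Tendsto (fun p : E × E => C * ‖p.1 - p.2‖ ^ τ) (𝓝[S] x ×ˢ 𝓝[S] x) (𝓝 0) := by
      have h2 := hcont.tendsto (x, x)
      simp only [sub_self, norm_zero, Real.zero_rpow hτ.ne', mul_zero, nhds_prod_eq] at h2
      exact h2.mono_left (Filter.prod_mono nhdsWithin_le_nhds nhdsWithin_le_nhds)
    refine squeeze_zero' (Filter.Eventually.of_forall fun _ => dist_nonneg) ?_ h1
    filter_upwards [Filter.prod_mem_prod self_mem_nhdsWithin self_mem_nhdsWithin] with p hp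
    rw [dist_eq_norm]
    exact hv p.1 hp.1 p.2 hp.2
  have hvc : ContinuousOn v S := by
    intro x hx
    obtain ⟨y, hy⟩ := hlim x (subset_closure hx)
    have h1 : Filter.Tendsto v (𝓝[{x}] x) (𝓝 y) :=
      hy.mono_left (nhdsWithin_mono x (singleton_subset_iff.2 hx))
    have h2 : y = v x := by
      rw [nhdsWithin_singleton] at h1
      exact tendsto_nhds_unique h1 (tendsto_pure_nhds v x)
    rw [h2] at hy
    exact hy
  refine ⟨extendFrom S v, continuousOn_extendFrom subset_rfl hlim, fun x hx =>
    extendFrom_extends hvc x hx, fun x hx y hy => ?_⟩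
  have : (𝓝[S] x).NeBot := mem_closure_iff_nhdsWithin_neBot.1 hx
  have : (𝓝[S] y).NeBot := mem_closure_iff_nhdsWithin_neBot.1 hy
  have h1 := (((tendsto_extendFrom (hlim x hx)).comp Filter.tendsto_fst).sub
    ((tendsto_extendFrom (hlim y hy)).comp (Filter.tendsto_snd (f := 𝓝[S] x)))).norm
  have h2 : Filter.Tendsto (fun p : E × E => C * ‖p.1 - p.2‖ ^ τ) (𝓝[S] x ×ˢ 𝓝[S] y)
      (𝓝 (C * ‖x - y‖ ^ τ)) := by
    have h3 := hcont.tendsto (x, y)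
    rw [nhds_prod_eq] at h3
    exact h3.mono_left (Filter.prod_mono nhdsWithin_le_nhds nhdsWithin_le_nhds)
  refine le_of_tendsto_of_tendsto h1 h2 ?_
  filter_upwards [Filter.prod_mem_prod self_mem_nhdsWithin self_mem_nhdsWithin] with p hp
  exact hv p.1 hp.1 p.2 hp.2

end

/-- **Local `C^{1,τ}` boundary regularity**: if `u ∈ C⁰(Ω ∪ T) ∩ C²(Ω)` solves the elliptic
quasilinear equation `Q(u) = 0` in a bounded `C²` domain `Ω ⊂ ℝⁿ`, with `u = φ ∈ C²(Ω ∪ T)`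
on a nonempty relatively open `C²` boundary portion `T ⊂ ∂Ω`, `|u| + |Du| ≤ K` in `Ω`, and
`Ω₀ ⊂ Ω` is a `C²` subdomain with `Ω̄₀ ∩ ∂Ω ⊂ T`, then there are `τ ∈ (0,1)` and `C > 0`
such that `u ∈ C¹(Ω̄₀)` and its gradient is `τ`-Hölder on `Ω̄₀`; i.e. `u ∈ C^{1,τ}(Ω̄₀)`. -/
theorem local_C1tau_regularity
    {n : ℕ} (hn : 2 ≤ n)
    (Ω : Set (EuclideanSpace ℝ (Fin n)))
    (hΩopen : IsOpen Ω) (hΩconn : IsConnected Ω) (hΩbdd : Bornology.IsBounded Ω)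
    (hΩbd : HasCBoundary 2 Ω)
    (a : Fin n → Fin n → EuclideanSpace ℝ (Fin n) × ℝ × EuclideanSpace ℝ (Fin n) → ℝ)
    (b : EuclideanSpace ℝ (Fin n) × ℝ × EuclideanSpace ℝ (Fin n) → ℝ)
    (ha : ∀ i j, ContDiffOn ℝ 1 (a i j)
      (closure Ω ×ˢ (univ : Set (ℝ × EuclideanSpace ℝ (Fin n)))))
    (hb : ContDiffOn ℝ 1 b (closure Ω ×ˢ (univ : Set (ℝ × EuclideanSpace ℝ (Fin n)))))
    (hsym : ∀ (i j : Fin n) (x : EuclideanSpace ℝ (Fin n)) (z : ℝ)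
      (p : EuclideanSpace ℝ (Fin n)), x ∈ closure Ω → a i j (x, z, p) = a j i (x, z, p))
    (hell : ∀ (x : EuclideanSpace ℝ (Fin n)) (z : ℝ) (p : EuclideanSpace ℝ (Fin n)),
      x ∈ closure Ω → ∀ ξ : EuclideanSpace ℝ (Fin n), ξ ≠ 0 →
        0 < ∑ i, ∑ j, a i j (x, z, p) * ξ i * ξ j)
    -- `T` is a nonempty relatively open `C²` portion of `∂Ω`
    (T : Set (EuclideanSpace ℝ (Fin n)))
    (hT : T ⊆ frontier Ω) (hTne : T.Nonempty)
    (hTopen : ∃ O : Set (EuclideanSpace ℝ (Fin n)), IsOpen O ∧ T = frontier Ω ∩ O)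
    (hTreg : ∀ p ∈ T, BoundaryCAt 2 Ω p)
    -- `Ω₀` is a subdomain with `C²` boundary such that `Ω̄₀ ∩ ∂Ω ⊆ T`
    (Ω₀ : Set (EuclideanSpace ℝ (Fin n)))
    (hΩ₀open : IsOpen Ω₀) (hΩ₀conn : IsConnected Ω₀) (hΩ₀sub : Ω₀ ⊆ Ω)
    (hΩ₀bd : HasCBoundary 2 Ω₀)
    (hΩ₀T : closure Ω₀ ∩ frontier Ω ⊆ T)
    (φ u : EuclideanSpace ℝ (Fin n) → ℝ)
    (hφ : ContDiffOn ℝ 2 φ (Ω ∪ T))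
    (hu0 : ContinuousOn u (Ω ∪ T)) (hu2 : ContDiffOn ℝ 2 u Ω)
    (hQ : ∀ x ∈ Ω,
      (∑ i, ∑ j, a i j (x, u x, gradE u x) * sdE u x i j) + b (x, u x, gradE u x) = 0)
    (hbc : ∀ x ∈ T, u x = φ x)
    (K : ℝ) (hK : 0 < K) (hKbound : ∀ x ∈ Ω, |u x| + ‖gradE u x‖ ≤ K) :
    ∃ τ ∈ Ioo (0 : ℝ) 1, ∃ C > (0 : ℝ),
      ∃ G : EuclideanSpace ℝ (Fin n) → EuclideanSpace ℝ (Fin n),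
        ContinuousOn G (closure Ω₀) ∧ (∀ x ∈ Ω₀, G x = gradE u x) ∧
        ∀ x₁ ∈ closure Ω₀, ∀ x₂ ∈ closure Ω₀, ‖G x₁ - G x₂‖ ≤ C * ‖x₁ - x₂‖ ^ τ := by
  obtain ⟨lam, C0, hsol⟩ := exists_isSolution hΩopen hΩbdd ha hb hsym hell hu2 hQ hK.le hKbound
  have hcompact : IsCompact (closure Ω₀) := (hΩbdd.subset hΩ₀sub).isCompact_closure
  obtain ⟨τ, hτ, C, hC, H⟩ := exists_holder_of_local (Ω := Ω) (v := fderiv ℝ u) hcompact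
    hsol.norm_fderiv_le fun x0 hx0 => by
      rcases em (x0 ∈ Ω) with h | h
      · exact hsol.exists_holder_of_mem h
      · have hfr : x0 ∈ frontier Ω := by
          rw [hΩopen.frontier_eq]
          exact ⟨closure_mono hΩ₀sub hx0, h⟩
        have hxT := hΩ₀T ⟨hx0, hfr⟩
        exact hsol.exists_holder_of_mem_boundary hTopen (hTreg x0 hxT) hxT hφ hu0 hbc
  obtain ⟨G, hG⟩ := exists_holder_extension (S := Ω₀) (v := gradE u) hτ.1 fun x hx y hy => by
    rw [norm_gradE_sub]
    exact H x ⟨hΩ₀sub hx, subset_closure hx⟩ y ⟨hΩ₀sub hy, subset_closure hy⟩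
  exact ⟨τ, hτ, C, hC, G, hG⟩
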